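/- Let X be a metric space homeomorphic to ℝ², Ω ⊆ X open, and u : Ω → ℝ continuous such that for almost every t ∈ ℝ the level set u⁻¹(t) has locally finite Hausdorff 1-measure (with respect to the metric of X). Then for almost every t ∈ ℝ each component of u⁻¹(t) is either a point, a Jordan curve, or homeomorphic to an interval. If in addition u is monotone, then for almost every t the level set u⁻¹(t) is an embedded 1-dimensional topological submanifold of X. -/

import Mathlib

open Set Metric MeasureTheory
open scoped ENNReal

noncomputable section

/-- Lebesgue monotonicity on an open set. -/
def LebMonotoneOn {E : Type*} [TopologicalSpace E] (Ω : Set E) (f : E → ℝ) : Prop :=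
  ∀ U : Set E, IsOpen U → U.Nonempty → IsCompact (closure U) → closure U ⊆ Ω →
    (∃ x ∈ frontier U, ∀ y ∈ closure U, f y ≤ f x) ∧
    (∃ x ∈ frontier U, ∀ y ∈ closure U, f x ≤ f y)

/-- A Jordan curve: a homeomorphic copy of the circle `S¹`. -/
def IsJordanCurve {X : Type*} [TopologicalSpace X] (S : Set X) : Prop :=
  Nonempty (↥(Metric.sphere (0 : ℝ × ℝ) 1) ≃ₜ ↥S)

/-- `S` is homeomorphic to an interval of `ℝ`. -/
def HomeoToInterval {X : Type*} [TopologicalSpace X] (S : Set X) : Prop :=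
  ∃ I : Set ℝ, I.OrdConnected ∧ I.Nonempty ∧ Nonempty (↥I ≃ₜ ↥S)

/-- `J` is an embedded 1-dimensional topological submanifold of `X`. -/
def IsEmbedded1Submanifold {X : Type*} [TopologicalSpace X] (J : Set X) : Prop :=
  ∀ x ∈ J, ∃ U : Set X, IsOpen U ∧ x ∈ U ∧
    ∃ φ : ↥U ≃ₜ ℝ × ℝ,
      {p : ℝ × ℝ | ∃ y : ↥U, (y : X) ∈ J ∧ φ y = p} = {p : ℝ × ℝ | p.2 = 0}

namespace PlaneTop

section

theorem exists_continuous_log {E : Type*} [NormedAddCommGroup E] [NormedSpace ℝ E] {g : E → ℂ}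
    (hg : Continuous g) (h0 : ∀ x, g x ≠ 0) :
    ∃ l : E → ℂ, Continuous l ∧ ∀ x, Complex.exp (l x) = g x := by
  have hs : IsSimplyConnected (univ : Set E) := by
    have : ContractibleSpace (univ : Set E) :=
      (convex_univ (𝕜 := ℝ) (E := E)).contractibleSpace univ_nonempty
    exact (inferInstance : SimplyConnectedSpace (univ : Set E))
  obtain ⟨f, hf, hfe⟩ := Complex.exists_continuousOn_eqOn_exp_comp hs isOpen_univ hg.continuousOn
    (by rintro ⟨x, -, hx⟩; exact h0 x hx)
  exact ⟨f, continuousOn_univ.1 hf, fun x => hfe (mem_univ x)⟩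

theorem eq_of_exp_eq_one {E : Type*} [TopologicalSpace E] {S : Set E} (hS : IsPreconnected S)
    {h : E → ℂ} (hc : ContinuousOn h S) (h1 : ∀ x ∈ S, Complex.exp (h x) = 1) {x y : E}
    (hx : x ∈ S) (hy : y ∈ S) : h x = h y := by
  have key : ∀ z ∈ S, ∃ n : ℤ, h z = n * (2 * Real.pi * Complex.I) := fun z hz =>
    Complex.exp_eq_one_iff.1 (h1 z hz)
  have hcont : ContinuousOn (fun z => (h z).im) S := Complex.continuous_im.comp_continuousOn hc
  have hlt : ∀ x ∈ S, ∀ y ∈ S, ¬ (h x).im < (h y).im := by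
    intro x hx y hy hxy
    obtain ⟨n, hn⟩ := key x hx
    obtain ⟨m, hm⟩ := key y hy
    have e1 : (h x).im = n * (2 * Real.pi) := by rw [hn]; simp
    have e2 : (h y).im = m * (2 * Real.pi) := by rw [hm]; simp
    have hnm : n < m := by
      rw [e1, e2] at hxy
      have := lt_of_mul_lt_mul_right hxy (by positivity)
      exact_mod_cast this
    have hnm' : (n : ℝ) + 1 ≤ m := by exact_mod_cast hnm
    have hpi := Real.pi_pos
    obtain ⟨z, hz, hzz⟩ := hS.intermediate_value hx hy hcont
      (show (n + 1 / 2 : ℝ) * (2 * Real.pi) ∈ Icc (h x).im (h y).im by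
        rw [e1, e2]
        constructor <;> gcongr <;> linarith)
    obtain ⟨k, hk⟩ := key z hz
    have e3 : (h z).im = k * (2 * Real.pi) := by rw [hk]; simp
    simp only [e3] at hzz
    have h2 : (k : ℝ) = n + 1 / 2 := mul_right_cancel₀ (by positivity) hzz
    have h3 : (2 * k : ℤ) = 2 * n + 1 := by
      have : (2 * k : ℝ) = 2 * n + 1 := by linarith
      exact_mod_cast this
    omega
  have him : (h x).im = (h y).im := le_antisymm (not_lt.1 (hlt y hy x hx)) (not_lt.1 (hlt x hx y hy))
  obtain ⟨n, hn⟩ := key x hx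
  obtain ⟨m, hm⟩ := key y hy
  apply Complex.ext _ him
  rw [hn, hm]; simp

/-- A nowhere vanishing function has a continuous logarithm on `A`. -/
def HasLogOn (A : Set ℂ) (g : ℂ → ℂ) : Prop :=
  ∃ l : ℂ → ℂ, ContinuousOn l A ∧ ∀ z ∈ A, Complex.exp (l z) = g z

/-- `A` does not separate `p` from `q`. -/
def Unsep (A : Set ℂ) (p q : ℂ) : Prop :=
  ∃ S, IsPreconnected S ∧ S ⊆ Aᶜ ∧ p ∈ S ∧ q ∈ S

theorem Unsep.symm {A : Set ℂ} {p q : ℂ} (h : Unsep A p q) : Unsep A q p := by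
  obtain ⟨S, h1, h2, h3, h4⟩ := h
  exact ⟨S, h1, h2, h4, h3⟩

theorem Unsep.trans {A : Set ℂ} {p q r : ℂ} (h : Unsep A p q) (h' : Unsep A q r) :
    Unsep A p r := by
  obtain ⟨S, h1, h2, h3, h4⟩ := h
  obtain ⟨T, g1, g2, g3, g4⟩ := h'
  exact ⟨S ∪ T, h1.union q h4 g3 g1, union_subset h2 g2, Or.inl h3, Or.inr g4⟩

theorem Unsep.mono {A B : Set ℂ} {p q : ℂ} (h : Unsep A p q) (hBA : B ⊆ A) : Unsep B p q := by
  obtain ⟨S, h1, h2, h3, h4⟩ := h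
  exact ⟨S, h1, h2.trans (compl_subset_compl.2 hBA), h3, h4⟩

theorem HasLogOn.of_locally {A : Set ℂ} {p q : ℂ}
    (h : ∀ z ∈ A, ‖q - p‖ < ‖z - q‖) : HasLogOn A (fun z => (z - p) / (z - q)) := by
  have hne : ∀ z ∈ A, z - q ≠ 0 := fun z hz h0 => by
    have := h z hz
    rw [h0, norm_zero] at this
    exact absurd this (not_lt.2 (norm_nonneg _))
  have key : ∀ z ∈ A, (z - p) / (z - q) ∈ Complex.slitPlane := by
    intro z hz
    have e : (z - p) / (z - q) = 1 + (q - p) / (z - q) := by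
      field_simp [hne z hz]; ring
    rw [e]
    apply Complex.mem_slitPlane_of_norm_lt_one
    rw [norm_div, div_lt_one (norm_pos_iff.2 (hne z hz))]
    exact h z hz
  refine ⟨fun z => Complex.log ((z - p) / (z - q)), ?_, ?_⟩
  · apply ContinuousOn.clog _ key
    exact ContinuousOn.div (by fun_prop) (by fun_prop) hne
  · intro z hz
    exact Complex.exp_log (Complex.slitPlane_ne_zero (key z hz))

theorem HasLogOn.mul_chain {A : Set ℂ} {p q r : ℂ} (hq : q ∉ A)
    (h : HasLogOn A (fun z => (z - p) / (z - q)))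
    (h' : HasLogOn A (fun z => (z - q) / (z - r))) : HasLogOn A (fun z => (z - p) / (z - r)) := by
  obtain ⟨l, h1, h2⟩ := h
  obtain ⟨m, g1, g2⟩ := h'
  refine ⟨fun z => l z + m z, h1.add g1, fun z hz => ?_⟩
  have : z - q ≠ 0 := fun h => hq (by rw [sub_eq_zero] at h; exact h ▸ hz)
  simp only [Complex.exp_add, h2 z hz, g2 z hz]
  field_simp

theorem HasLogOn.inv_chain {A : Set ℂ} {p q : ℂ}
    (h : HasLogOn A (fun z => (z - p) / (z - q))) : HasLogOn A (fun z => (z - q) / (z - p)) := by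
  obtain ⟨l, h1, h2⟩ := h
  refine ⟨fun z => - l z, h1.neg, fun z hz => ?_⟩
  simp only [Complex.exp_neg, h2 z hz, inv_div]

theorem hasLogOn_of_unsep {A : Set ℂ} (hA : IsClosed A) {p q : ℂ} (h : Unsep A p q) :
    HasLogOn A (fun z => (z - p) / (z - q)) := by
  obtain ⟨S, hS, hSA, hp, hq⟩ := h
  have loc : ∀ x ∉ A, ∃ r > 0, ∀ y ∈ ball x r, y ∉ A ∧ HasLogOn A (fun z => (z - y) / (z - x)) := by
    intro x hx
    obtain ⟨r, hr, hrA⟩ := Metric.isOpen_iff.1 hA.isOpen_compl x hx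
    refine ⟨r, hr, fun y hy => ⟨hrA hy, HasLogOn.of_locally fun z hz => ?_⟩⟩
    rw [mem_ball, dist_comm, dist_eq_norm] at hy
    refine hy.trans_le (not_lt.1 fun hlt => hrA ?_ hz)
    rwa [mem_ball, dist_eq_norm]
  let U : Set ℂ := {x | x ∉ A ∧ HasLogOn A (fun z => (z - p) / (z - x))}
  let V : Set ℂ := {x | x ∉ A ∧ ¬ HasLogOn A (fun z => (z - p) / (z - x))}
  have hU : IsOpen U := Metric.isOpen_iff.2 fun x hx => by
    obtain ⟨r, hr, h⟩ := loc x hx.1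
    exact ⟨r, hr, fun y hy => ⟨(h y hy).1, hx.2.mul_chain hx.1 (h y hy).2.inv_chain⟩⟩
  have hV : IsOpen V := Metric.isOpen_iff.2 fun x hx => by
    obtain ⟨r, hr, h⟩ := loc x hx.1
    exact ⟨r, hr, fun y hy => ⟨(h y hy).1, fun hn => hx.2 (hn.mul_chain (h y hy).1 (h y hy).2)⟩⟩
  have hpU : p ∈ U := by
    refine ⟨hSA hp, 0, continuousOn_const, fun z hz => ?_⟩
    have : z - p ≠ 0 := fun h => hSA hp (by rw [sub_eq_zero] at h; exact h ▸ hz)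
    simp [div_self this]
  by_contra hcon
  obtain ⟨z, -, hz1, hz2⟩ := hS U V hU hV (fun x hx => by
    by_cases hx' : HasLogOn A (fun z => (z - p) / (z - x))
    · exact Or.inl ⟨hSA hx, hx'⟩
    · exact Or.inr ⟨hSA hx, hx'⟩) ⟨p, hp, hpU⟩ ⟨q, hq, hSA hq, hcon⟩
  exact hz2.2 hz1.2


theorem isPreconnected_norm_gt {R : ℝ} (hR : 0 < R) : IsPreconnected {z : ℂ | R < ‖z‖} := by
  have : {z : ℂ | R < ‖z‖} = Complex.exp '' {w | Real.log R < w.re} := by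
    ext z
    constructor
    · intro hz
      have hz0 : 0 < ‖z‖ := hR.trans hz
      refine ⟨Complex.log z, ?_, Complex.exp_log (norm_pos_iff.1 hz0)⟩
      simpa [Complex.log_re] using Real.log_lt_log hR hz
    · rintro ⟨w, hw, rfl⟩
      have := Real.exp_lt_exp.2 hw
      rw [Real.exp_log hR] at this
      simpa [Complex.norm_exp] using this
  rw [this]
  exact (convex_halfSpace_re_gt _).isPreconnected.image _ Complex.continuous_exp.continuousOn

theorem frontier_connectedComponentIn_subset {E : Type*} [TopologicalSpace E]
    [LocallyConnectedSpace E] {U : Set E} (hU : IsOpen U) (x : E) :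
    frontier (connectedComponentIn U x) ⊆ Uᶜ := by
  intro y hy hyU
  have ho : IsOpen (connectedComponentIn U y) := hU.connectedComponentIn
  have hox : IsOpen (connectedComponentIn U x) := hU.connectedComponentIn
  rw [hox.frontier_eq] at hy
  obtain ⟨z, hz1, hz2⟩ := mem_closure_iff.1 hy.1 _ ho (mem_connectedComponentIn hyU)
  have e1 := connectedComponentIn_eq hz1
  have e2 := connectedComponentIn_eq hz2
  rw [← e1] at e2
  exact hy.2 (e2 ▸ mem_connectedComponentIn hyU)

theorem unsep_iff {A : Set ℂ} {p q : ℂ} : Unsep A p q ↔ q ∈ connectedComponentIn Aᶜ p := by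
  constructor
  · rintro ⟨S, h1, h2, h3, h4⟩
    exact h1.subset_connectedComponentIn h3 h2 h4
  · intro h
    have hp : p ∈ Aᶜ := connectedComponentIn_nonempty_iff.1 ⟨q, h⟩
    exact ⟨_, isPreconnected_connectedComponentIn, connectedComponentIn_subset _ _,
      mem_connectedComponentIn hp, h⟩

theorem Unsep.of_not_bounded {A : Set ℂ} (hA : Bornology.IsBounded A) {p q : ℂ}
    (hp : ¬ Bornology.IsBounded (connectedComponentIn Aᶜ p))
    (hq : ¬ Bornology.IsBounded (connectedComponentIn Aᶜ q)) : Unsep A p q := by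
  obtain ⟨R, hR, hAR⟩ := hA.subset_closedBall_lt 0 (0 : ℂ)
  have hW := isPreconnected_norm_gt hR
  have hWA : {z : ℂ | R < ‖z‖} ⊆ Aᶜ := fun z hz hzA => by
    have := hAR hzA
    rw [mem_closedBall, dist_zero_right] at this
    exact absurd this (not_le.2 hz)
  have key : ∀ x, ¬ Bornology.IsBounded (connectedComponentIn Aᶜ x) →
      ∀ w : ℂ, R < ‖w‖ → Unsep A x w := by
    intro x hx w hw
    have : ∃ y ∈ connectedComponentIn Aᶜ x, R < ‖y‖ := by
      by_contra! hcon
      exact hx ((isBounded_closedBall (x := (0 : ℂ)) (r := R)).subset fun y hy => by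
        simpa using hcon y hy)
    obtain ⟨y, hy, hyR⟩ := this
    exact (unsep_iff.2 hy).trans ⟨_, hW, hWA, hyR, hw⟩
  have hw : R < ‖((R + 1 : ℝ) : ℂ)‖ := by
    rw [Complex.norm_real, Real.norm_of_nonneg (by linarith)]; linarith
  exact (key p hp _ hw).trans (key q hq _ hw).symm

theorem no_log_on_circle {p : ℂ} {R : ℝ} (hR : 0 < R) {L : ℂ → ℂ} (hL : Continuous L)
    (h : ∀ z, ‖z - p‖ = R → Complex.exp (L z) = z - p) : False := by
  let c : ℝ → ℂ := fun θ => p + R * Complex.exp (θ * Complex.I)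
  have hc : Continuous c := by fun_prop
  have hcn : ∀ θ, ‖c θ - p‖ = R := fun θ => by
    simp [c, Complex.norm_exp, abs_of_pos hR]
  have hR0 : (R : ℂ) ≠ 0 := by exact_mod_cast hR.ne'
  have := eq_of_exp_eq_one (S := (univ : Set ℝ)) isPreconnected_univ
    (h := fun θ => L (c θ) - θ * Complex.I - Complex.log R) (by fun_prop)
    (fun θ _ => by
      rw [Complex.exp_sub, Complex.exp_sub, h _ (hcn θ), Complex.exp_log hR0]
      simp only [c, add_sub_cancel_left]
      field_simp) (mem_univ 0) (mem_univ (2 * Real.pi))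
  have e : c (2 * Real.pi) = c 0 := by
    simp [c, Complex.exp_two_pi_mul_I]
  simp only [e] at this
  have h2 : (2 * Real.pi : ℂ) * Complex.I = 0 := by
    have := this
    push_cast at this
    linear_combination this
  simp [Real.pi_ne_zero] at h2

theorem not_hasLogOn_of_bounded {A : Set ℂ} (hA : IsClosed A) {p q : ℂ} (hp : p ∉ A) (hq : q ∉ A)
    (hb : Bornology.IsBounded (connectedComponentIn Aᶜ p)) (hs : ¬ Unsep A p q) :
    ¬ HasLogOn A (fun z => (z - p) / (z - q)) := by
  classical
  rintro ⟨l, hl, hle⟩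
  obtain ⟨m, hm⟩ := ContinuousMap.exists_restrict_eq hA ⟨A.domRestrict l, hl.domRestrict⟩
  have hml : ∀ z ∈ A, m z = l z := fun z hz => congrFun (congrArg DFunLike.coe hm) ⟨z, hz⟩
  set G := connectedComponentIn Aᶜ p with hG
  have hGo : IsOpen G := hA.isOpen_compl.connectedComponentIn
  have hfG : frontier G ⊆ A := by
    have := frontier_connectedComponentIn_subset hA.isOpen_compl p
    rwa [compl_compl] at this
  have hqG : q ∉ closure G := by
    intro hqc
    by_cases hqG : q ∈ G
    · exact hs (unsep_iff.2 hqG)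
    · exact hq (hfG (by rw [hGo.frontier_eq]; exact ⟨hqc, hqG⟩))
  have hpG : p ∈ G := mem_connectedComponentIn hp
  let H : ℂ → ℂ := fun z => if z ∈ closure G then Complex.exp (m z) * (z - q) else z - p
  have hH : Continuous H := by
    apply Continuous.if _ (by fun_prop) (by fun_prop)
    intro z hz
    have hzA : z ∈ A := hfG (frontier_closure_subset hz)
    have hzq : z - q ≠ 0 := fun h => hq (by rw [sub_eq_zero] at h; exact h ▸ hzA)
    rw [hml z hzA, hle z hzA]
    field_simp
  have hH0 : ∀ z, H z ≠ 0 := by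
    intro z
    by_cases hz : z ∈ closure G
    · simp only [H, hz, if_true]
      refine mul_ne_zero (Complex.exp_ne_zero _) fun h => hqG ?_
      rw [sub_eq_zero] at h; exact h ▸ hz
    · simp only [H, hz, if_false]
      refine fun h => hz ?_
      rw [sub_eq_zero] at h; exact h ▸ subset_closure hpG
  obtain ⟨L, hL, hLe⟩ := exists_continuous_log hH hH0
  obtain ⟨R, hR, hGR⟩ := hb.closure.subset_closedBall_lt 0 p
  refine no_log_on_circle (p := p) (R := R + 1) (by linarith) hL fun z hz => ?_
  have : z ∉ closure G := fun h => by
    have := hGR h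
    rw [mem_closedBall, dist_eq_norm] at this
    linarith
  rw [hLe]
  simp only [H, this, if_false]

theorem unsep_of_hasLogOn {A : Set ℂ} (hA : IsCompact A) {p q : ℂ} (hp : p ∉ A) (hq : q ∉ A)
    (h : HasLogOn A (fun z => (z - p) / (z - q))) : Unsep A p q := by
  by_contra hs
  by_cases hpb : Bornology.IsBounded (connectedComponentIn Aᶜ p)
  · exact not_hasLogOn_of_bounded hA.isClosed hp hq hpb hs h
  by_cases hqb : Bornology.IsBounded (connectedComponentIn Aᶜ q)
  · exact not_hasLogOn_of_bounded hA.isClosed hq hp hqb (fun h => hs h.symm) h.inv_chain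
  exact hs (Unsep.of_not_bounded hA.isBounded hpb hqb)

theorem Unsep.notMem_left {A : Set ℂ} {p q : ℂ} (h : Unsep A p q) : p ∉ A := by
  obtain ⟨S, h1, h2, h3, h4⟩ := h
  exact h2 h3

theorem HasLogOn.union {A B : Set ℂ} (hA : IsClosed A) (hB : IsClosed B)
    (hAB : IsPreconnected (A ∩ B)) {g : ℂ → ℂ} (h : HasLogOn A g)
    (h' : HasLogOn B g) : HasLogOn (A ∪ B) g := by
  classical
  obtain ⟨l, h1, h2⟩ := h
  obtain ⟨m, g1, g2⟩ := h'
  obtain ⟨c, hc1, hc2⟩ : ∃ c : ℂ, Complex.exp c = 1 ∧ ∀ z ∈ A ∩ B, l z = m z + c := by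
    have h1' : ∀ z ∈ A ∩ B, Complex.exp (l z - m z) = 1 := fun z hz => by
      rw [Complex.exp_sub, h2 z hz.1, ← g2 z hz.2, div_self (Complex.exp_ne_zero _)]
    rcases (A ∩ B).eq_empty_or_nonempty with he | ⟨w, hw⟩
    · exact ⟨0, Complex.exp_zero, fun z hz => by simp [he] at hz⟩
    · refine ⟨l w - m w, h1' w hw, fun z hz => ?_⟩
      have := eq_of_exp_eq_one hAB
        ((h1.mono inter_subset_left).sub (g1.mono inter_subset_right)) h1' hz hw
      simp only [Pi.sub_apply] at this
      rw [← this]; ring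
  let f : ℂ → ℂ := fun z => if z ∈ A then l z else m z + c
  have fA : ∀ z ∈ A, f z = l z := fun z hz => by simp [f, hz]
  have fB : ∀ z ∈ B, f z = m z + c := fun z hz => by
    by_cases hzA : z ∈ A
    · rw [fA z hzA, hc2 z ⟨hzA, hz⟩]
    · simp [f, hzA]
  refine ⟨f, ContinuousOn.union_of_isClosed (h1.congr fA) ((g1.add continuousOn_const).congr fB)
    hA hB, ?_⟩
  rintro z (hz | hz)
  · rw [fA z hz, h2 z hz]
  · rw [fB z hz, Complex.exp_add, hc1, g2 z hz, mul_one]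

/-- Janiszewski's theorem. -/
theorem Unsep.union {A B : Set ℂ} (hA : IsCompact A) (hB : IsCompact B)
    (hAB : IsPreconnected (A ∩ B)) {p q : ℂ} (h : Unsep A p q) (h' : Unsep B p q) :
    Unsep (A ∪ B) p q := by
  refine unsep_of_hasLogOn (hA.union hB) ?_ ?_
    ((hasLogOn_of_unsep hA.isClosed h).union hA.isClosed hB.isClosed hAB
      (hasLogOn_of_unsep hB.isClosed h'))
  · exact fun hp => hp.elim h.notMem_left h'.notMem_left
  · exact fun hp => hp.elim h.symm.notMem_left h'.symm.notMem_left


theorem continuousOn_leftInv_image {α β : Type*} [TopologicalSpace α] [TopologicalSpace β]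
    [T2Space β] {K : Set α} (hK : IsCompact K) {f : α → β} (hf : ContinuousOn f K)
    {g : β → α} (hg : LeftInvOn g f K) : ContinuousOn g (f '' K) := by
  rw [continuousOn_iff_isClosed]
  intro t ht
  refine ⟨f '' (K ∩ t), ((hK.inter_right ht).image_of_continuousOn
    (hf.mono inter_subset_left)).isClosed, ?_⟩
  ext y
  constructor
  · rintro ⟨hy, x, hx, rfl⟩
    rw [mem_preimage, hg hx] at hy
    exact ⟨⟨x, ⟨hx, hy⟩, rfl⟩, x, hx, rfl⟩
  · rintro ⟨⟨x, ⟨hx, hy⟩, rfl⟩, -⟩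
    refine ⟨?_, x, hx, rfl⟩
    rwa [mem_preimage, hg hx]

/-- `A` is an arc with endpoints `a` and `b`. -/
def IsArc (A : Set ℂ) (a b : ℂ) : Prop :=
  ∃ γ : ℝ → ℂ, Continuous γ ∧ InjOn γ (Icc 0 1) ∧ γ 0 = a ∧ γ 1 = b ∧ γ '' Icc 0 1 = A

namespace IsArc

variable {A B : Set ℂ} {a b c : ℂ}

theorem isCompact (h : IsArc A a b) : IsCompact A := by
  obtain ⟨γ, h1, -, -, -, rfl⟩ := h
  exact isCompact_Icc.image h1

theorem isConnected (h : IsArc A a b) : IsConnected A := by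
  obtain ⟨γ, h1, -, -, -, rfl⟩ := h
  exact (isConnected_Icc zero_le_one).image _ h1.continuousOn

theorem left_mem (h : IsArc A a b) : a ∈ A := by
  obtain ⟨γ, h1, -, rfl, -, rfl⟩ := h
  exact ⟨0, by simp, rfl⟩

theorem right_mem (h : IsArc A a b) : b ∈ A := by
  obtain ⟨γ, h1, -, -, rfl, rfl⟩ := h
  exact ⟨1, by simp, rfl⟩

theorem ne (h : IsArc A a b) : a ≠ b := by
  obtain ⟨γ, -, h1, rfl, rfl, -⟩ := h
  intro h
  exact zero_ne_one (h1 (by simp) (by simp) h)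

theorem symm (h : IsArc A a b) : IsArc A b a := by
  obtain ⟨γ, h1, h2, rfl, rfl, rfl⟩ := h
  refine ⟨fun t => γ (1 - t), by fun_prop, ?_, by simp, by simp, ?_⟩
  · intro s hs t ht hst
    have := h2 (x₁ := 1 - s) (x₂ := 1 - t) ⟨by linarith [hs.2], by linarith [hs.1]⟩
      ⟨by linarith [ht.2], by linarith [ht.1]⟩ hst
    linarith
  · ext z
    constructor
    · rintro ⟨t, ht, rfl⟩
      exact ⟨1 - t, ⟨by linarith [ht.2], by linarith [ht.1]⟩, rfl⟩
    · rintro ⟨t, ht, rfl⟩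
      exact ⟨1 - t, ⟨by linarith [ht.2], by linarith [ht.1]⟩, by simp⟩

/-- An arc has a continuous coordinate. -/
theorem exists_coord (h : IsArc A a b) : ∃ (γ : ℝ → ℂ) (f : ℂ → ℝ), Continuous γ ∧
    ContinuousOn f A ∧ γ 0 = a ∧ γ 1 = b ∧ (∀ t ∈ Icc (0 : ℝ) 1, γ t ∈ A ∧ f (γ t) = t) ∧
    (∀ z ∈ A, f z ∈ Icc (0 : ℝ) 1 ∧ γ (f z) = z) := by
  obtain ⟨γ, h1, h2, h3, h4, rfl⟩ := h
  have hl : LeftInvOn (Function.invFunOn γ (Icc (0 : ℝ) 1)) γ (Icc 0 1) := h2.leftInvOn_invFunOn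
  refine ⟨γ, Function.invFunOn γ (Icc (0 : ℝ) 1), h1,
    continuousOn_leftInv_image isCompact_Icc h1.continuousOn hl, h3, h4,
    fun t ht => ⟨⟨t, ht, rfl⟩, hl ht⟩, ?_⟩
  rintro _ ⟨t, ht, rfl⟩
  rw [hl ht]
  exact ⟨ht, rfl⟩

theorem of_param {γ : ℝ → ℂ} {s t : ℝ} (hst : s < t) (hγ : ContinuousOn γ (Icc s t))
    (hi : InjOn γ (Icc s t)) : IsArc (γ '' Icc s t) (γ s) (γ t) := by
  have hm : ∀ r : ℝ, s + (projIcc (0:ℝ) 1 zero_le_one r : ℝ) * (t - s) ∈ Icc s t := fun r => by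
    have h1 := (projIcc (0:ℝ) 1 zero_le_one r).2.1
    have h2 := (projIcc (0:ℝ) 1 zero_le_one r).2.2
    constructor <;> nlinarith
  have hp : ∀ r ∈ Icc (0 : ℝ) 1, (projIcc (0:ℝ) 1 zero_le_one r : ℝ) = r := fun r hr => by
    rw [projIcc_of_mem zero_le_one hr]
  refine ⟨fun r => γ (s + (projIcc (0:ℝ) 1 zero_le_one r : ℝ) * (t - s)), ?_, ?_, ?_, ?_, ?_⟩
  · refine hγ.comp_continuous ?_ hm
    have : Continuous fun r : ℝ => (projIcc (0:ℝ) 1 zero_le_one r : ℝ) :=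
      continuous_subtype_val.comp continuous_projIcc
    fun_prop
  · intro x hx y hy hxy
    have := hi (hm x) (hm y) hxy
    rw [hp x hx, hp y hy] at this
    have h3 : t - s ≠ 0 := by linarith
    exact mul_right_cancel₀ h3 (by linarith)
  · simp
  · simp
  · ext z
    constructor
    · rintro ⟨r, hr, rfl⟩
      exact ⟨_, hm r, rfl⟩
    · rintro ⟨r, hr, rfl⟩
      have h3 : 0 < t - s := by linarith
      have h4 : (r - s) / (t - s) ∈ Icc (0 : ℝ) 1 :=
        ⟨div_nonneg (by linarith [hr.1]) h3.le, by rw [div_le_one h3]; linarith [hr.2]⟩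
      refine ⟨_, h4, ?_⟩
      simp only [hp _ h4]
      congr 1
      field_simp
      ring

theorem union (hA : IsArc A a b) (hB : IsArc B b c) (hAB : A ∩ B ⊆ {b}) : IsArc (A ∪ B) a c := by
  obtain ⟨γ, h1, h2, h3, h4, hAe⟩ := hA
  obtain ⟨δ, g1, g2, g3, g4, hBe⟩ := hB
  let f : ℝ → ℂ := fun t => if t ≤ 0 then γ (t + 1) else δ t
  have hf : Continuous f := by
    refine Continuous.if_le (by fun_prop) g1 continuous_id continuous_const ?_
    rintro x rfl
    simp [h4, g3]
  have fneg : ∀ t ≤ 0, f t = γ (t + 1) := fun t ht => by simp [f, ht]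
  have fpos : ∀ t, 0 ≤ t → f t = δ t := fun t ht => by
    rcases ht.eq_or_lt with rfl | h
    · simp [f, h4, g3]
    · simp [f, not_le.2 h]
  have hfA : ∀ t ∈ Icc (-1 : ℝ) 0, f t ∈ A := fun t ht => by
    rw [fneg t ht.2, ← hAe]
    exact ⟨t + 1, ⟨by linarith [ht.1], by linarith [ht.2]⟩, rfl⟩
  have hfB : ∀ t ∈ Icc (0 : ℝ) 1, f t ∈ B := fun t ht => by
    rw [fpos t ht.1, ← hBe]
    exact ⟨t, ht, rfl⟩
  have hmix : ∀ s ∈ Icc (-1 : ℝ) 0, ∀ t ∈ Icc (0 : ℝ) 1, f s = f t → s = t := by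
    intro s hs t ht hst
    have hb : f t = b := hAB ⟨hst ▸ hfA s hs, hfB t ht⟩
    have e1 : t = 0 := g2 ht (by simp) (by rw [g3, ← fpos t ht.1, hb])
    have e2 : s + 1 = 1 := h2 ⟨by linarith [hs.1], by linarith [hs.2]⟩ (by simp)
      (by rw [h4, ← fneg s hs.2, hst, hb])
    linarith
  have hi : InjOn f (Icc (-1) 1) := by
    intro s hs t ht hst
    rcases le_total s 0 with h | h <;> rcases le_total t 0 with h' | h'
    · have := h2 (x₁ := s + 1) (x₂ := t + 1) ⟨by linarith [hs.1], by linarith⟩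
        ⟨by linarith [ht.1], by linarith⟩ (by rw [← fneg s h, ← fneg t h', hst])
      linarith
    · exact hmix s ⟨hs.1, h⟩ t ⟨h', ht.2⟩ hst
    · exact (hmix t ⟨ht.1, h'⟩ s ⟨h, hs.2⟩ hst.symm).symm
    · exact g2 ⟨h, hs.2⟩ ⟨h', ht.2⟩ (by rw [← fpos s h, ← fpos t h', hst])
  have := of_param (show (-1 : ℝ) < 1 by norm_num) hf.continuousOn hi
  rw [fneg (-1) (by norm_num), fpos 1 (by norm_num), g4] at this
  norm_num at this
  rw [h3] at this
  convert this
  ext z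
  constructor
  · rintro (hz | hz)
    · rw [← hAe] at hz
      obtain ⟨t, ht, rfl⟩ := hz
      refine ⟨t - 1, ⟨by linarith [ht.1], by linarith [ht.2]⟩, ?_⟩
      rw [fneg _ (by linarith [ht.2])]; simp
    · rw [← hBe] at hz
      obtain ⟨t, ht, rfl⟩ := hz
      exact ⟨t, ⟨by linarith [ht.1], ht.2⟩, fpos t ht.1⟩
  · rintro ⟨t, ht, rfl⟩
    rcases le_total t 0 with h | h
    · exact Or.inl (hfA t ⟨ht.1, h⟩)
    · exact Or.inr (hfB t ⟨h, ht.2⟩)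

/-- An arc does not separate the plane. -/
theorem unsep (h : IsArc A a b) {p q : ℂ} (hp : p ∉ A) (hq : q ∉ A) : Unsep A p q := by
  obtain ⟨γ, f, h1, h2, -, -, h3, h4⟩ := h.exists_coord
  have hne : ∀ r ∉ A, ∀ t : ℝ, γ (projIcc (0:ℝ) 1 zero_le_one t) - r ≠ 0 := fun r hr t h0 =>
    hr (by rw [sub_eq_zero] at h0; exact h0 ▸ (h3 _ (projIcc (0:ℝ) 1 zero_le_one t).2).1)
  have hcont : Continuous fun t : ℝ => γ (projIcc (0:ℝ) 1 zero_le_one t) :=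
    h1.comp (continuous_subtype_val.comp continuous_projIcc)
  obtain ⟨l, hl, hle⟩ := exists_continuous_log (E := ℝ)
    (g := fun t => (γ (projIcc (0:ℝ) 1 zero_le_one t) - p) / (γ (projIcc (0:ℝ) 1 zero_le_one t) - q))
    ((hcont.sub continuous_const).div (hcont.sub continuous_const) (hne q hq))
    (fun t => div_ne_zero (hne p hp t) (hne q hq t))
  refine unsep_of_hasLogOn h.isCompact hp hq ⟨l ∘ f, hl.comp_continuousOn h2, fun z hz => ?_⟩
  simp only [Function.comp_apply, hle, projIcc_of_mem zero_le_one (h4 z hz).1, (h4 z hz).2]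

end IsArc

end

section

theorem one_sub_div_mem_slitPlane {a z : ℂ} (ha : ‖a‖ = 1) (hz : ‖z‖ ≤ 1) (hza : z ≠ a) :
    1 - z / a ∈ Complex.slitPlane := by
  have ha0 : a ≠ 0 := fun h => by simp [h] at ha
  have hn : ‖z / a‖ ≤ 1 := by rw [norm_div, ha, div_one]; exact hz
  have hne : z / a ≠ 1 := fun h => hza (by rwa [div_eq_one_iff_eq ha0] at h)
  rw [Complex.mem_slitPlane_iff]
  by_contra! hcon
  have h1 : (z / a).re ≤ 1 := (Complex.re_le_norm _).trans hn
  have h2 := hcon.1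
  simp only [Complex.sub_re, Complex.one_re] at h2
  have h3 : (z / a).im = 0 := by simpa using hcon.2
  exact hne (Complex.ext (by simp; linarith) (by simpa using h3))

theorem log_one_sub_exp_im {θ : ℝ} (h0 : 0 < θ) (h1 : θ < 2 * Real.pi) :
    (Complex.log (1 - Complex.exp (θ * Complex.I))).im = (θ - Real.pi) / 2 := by
  have hs : 0 < Real.sin (θ / 2) := Real.sin_pos_of_pos_of_lt_pi (by linarith) (by linarith)
  have e : 1 - Complex.exp (θ * Complex.I) = ((2 * Real.sin (θ / 2) : ℝ) : ℂ) *
      (Complex.cos (((θ - Real.pi) / 2 : ℝ) : ℂ) +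
        Complex.sin (((θ - Real.pi) / 2 : ℝ) : ℂ) * Complex.I) := by
    have c1 : Real.cos ((θ - Real.pi) / 2) = Real.sin (θ / 2) := by
      rw [sub_div, Real.cos_sub_pi_div_two]
    have c2 : Real.sin ((θ - Real.pi) / 2) = - Real.cos (θ / 2) := by
      rw [sub_div, Real.sin_sub_pi_div_two]
    have c3 : Real.cos θ = 1 - 2 * Real.sin (θ / 2) ^ 2 := by
      have := Real.cos_two_mul (θ / 2)
      have h := Real.sin_sq_add_cos_sq (θ / 2)
      rw [show 2 * (θ / 2) = θ by ring] at this
      linarith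
    have c4 : Real.sin θ = 2 * Real.sin (θ / 2) * Real.cos (θ / 2) := by
      have := Real.sin_two_mul (θ / 2)
      rwa [show 2 * (θ / 2) = θ by ring] at this
    rw [← Complex.ofReal_cos, ← Complex.ofReal_sin, c1, c2, Complex.exp_mul_I,
      ← Complex.ofReal_cos, ← Complex.ofReal_sin, c3, c4]
    push_cast
    ring
  rw [Complex.log_im, e, Complex.arg_mul_cos_add_sin_mul_I (by positivity)
    ⟨by linarith, by linarith⟩]

theorem exp_log_one_sub {a z : ℂ} (ha : ‖a‖ = 1) (hz : ‖z‖ ≤ 1) (hza : z ≠ a) :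
    Complex.exp (Complex.log (1 - z / a)) = (a - z) / a := by
  have ha0 : a ≠ 0 := fun h => by simp [h] at ha
  rw [Complex.exp_log (Complex.slitPlane_ne_zero (one_sub_div_mem_slitPlane ha hz hza))]
  field_simp

theorem continuousOn_log_one_sub {a : ℂ} (ha : ‖a‖ = 1) {S : Set ℂ} (hS : S ⊆ closedBall 0 1)
    (haS : a ∉ S) : ContinuousOn (fun z => Complex.log (1 - z / a)) S :=
  ContinuousOn.clog (by fun_prop) fun z hz => one_sub_div_mem_slitPlane ha
    (by simpa using hS hz) fun h => haS (h ▸ hz)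

theorem log_relation {S T : Set ℂ} (hS : IsCompact S) (hSc : IsPreconnected S)
    (hTc : IsPreconnected T) (hSD : S ⊆ closedBall 0 1) (hTD : T ⊆ closedBall 0 1)
    (hd : Disjoint S T) {a b c d : ℂ} (ha : a ∈ S) (hb : b ∈ S) (hc : c ∈ T) (hdT : d ∈ T)
    (ha1 : ‖a‖ = 1) (hb1 : ‖b‖ = 1) (hc1 : ‖c‖ = 1) (hd1 : ‖d‖ = 1) :
    Complex.log (1 - d / b) - Complex.log (1 - d / a) - Complex.log (1 - c / b)
      + Complex.log (1 - c / a) =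
    Complex.log (1 - b / d) - Complex.log (1 - a / d) - Complex.log (1 - b / c)
      + Complex.log (1 - a / c) := by
  have hST : ∀ s ∈ S, ∀ t ∈ T, s ≠ t := fun s hs t ht h => disjoint_left.1 hd hs (h ▸ ht)
  have n0 : ∀ {z : ℂ}, ‖z‖ = 1 → z ≠ 0 := fun h h0 => by simp [h0] at h
  have hTn : ∀ t ∈ T, ‖t‖ ≤ 1 := fun t ht => by simpa using hTD ht
  have hSn : ∀ t ∈ S, ‖t‖ ≤ 1 := fun t ht => by simpa using hSD ht
  let E : ℂ → ℂ := fun w => Complex.log (1 - w / b) - Complex.log (1 - w / a)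
    - Complex.log (1 - c / b) + Complex.log (1 - c / a)
  let P : ℂ → Prop := fun w => ∃ h : ℂ → ℂ, ContinuousOn h S ∧
    (∀ z ∈ S, Complex.exp (h z) = (z - w) / (z - c)) ∧ h b - h a = E w
  have hstep : ∀ w₀ ∈ T, ∃ r > 0, ∀ w ∈ T, ∀ w' ∈ T, dist w w₀ < r → dist w' w₀ < r →
      P w → P w' := by
    intro w₀ hw₀
    have hw₀S : w₀ ∈ Sᶜ := fun h => disjoint_left.1 hd h hw₀
    obtain ⟨r, hr, hrS⟩ := Metric.isOpen_iff.1 hS.isClosed.isOpen_compl w₀ hw₀S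
    refine ⟨r / 4, by positivity, ?_⟩
    rintro w hw w' hw' hwr hw'r ⟨h, h1, h2, h3⟩
    have hsl : ∀ z ∈ S, ∀ v, dist v w₀ < r / 4 → (z - v) / (z - w) ∈ Complex.slitPlane := by
      intro z hz v hv
      have hzr : r ≤ dist z w₀ := not_lt.1 fun hlt => hrS hlt hz
      have hzw : r / 2 < dist z w := by
        have := dist_triangle z w w₀
        linarith
      have hvw : dist w v < r / 2 := by
        have := dist_triangle w w₀ v
        rw [dist_comm w₀ v] at this
        linarith
      rw [dist_eq_norm] at hzw hvw
      have hne : z - w ≠ 0 := norm_pos_iff.1 (by linarith)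
      have e : (z - v) / (z - w) = 1 + (w - v) / (z - w) := by field_simp; ring
      rw [e]
      apply Complex.mem_slitPlane_of_norm_lt_one
      rw [norm_div, div_lt_one (norm_pos_iff.2 hne)]
      linarith
    refine ⟨fun z => h z + Complex.log ((z - w') / (z - w)), ?_, ?_, ?_⟩
    · refine h1.add (ContinuousOn.clog ?_ fun z hz => hsl z hz w' hw'r)
      exact ContinuousOn.div (by fun_prop) (by fun_prop) fun z hz =>
        sub_ne_zero.2 (hST z hz w hw)
    · intro z hz
      have hne1 := sub_ne_zero.2 (hST z hz w hw)
      rw [Complex.exp_add, h2 z hz, Complex.exp_log (Complex.slitPlane_ne_zero (hsl z hz w' hw'r))]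
      field_simp
    · have hconv : IsPreconnected (ball w₀ (r / 4) ∩ closedBall (0 : ℂ) 1) :=
        ((convex_ball _ _).inter (convex_closedBall _ _)).isPreconnected
      have hnS : ∀ z ∈ S, z ∉ ball w₀ (r / 4) ∩ closedBall (0 : ℂ) 1 := fun z hz hz' =>
        hrS (ball_subset_ball (by linarith) hz'.1) hz
      have := eq_of_exp_eq_one (h := fun v => Complex.log (1 - v / b) - Complex.log (1 - v / a)
          - (Complex.log ((b - v) / (b - w)) - Complex.log ((a - v) / (a - w)))
          - (Complex.log (1 - w / b) - Complex.log (1 - w / a))) hconv ?_ ?_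
          (x := w) (y := w') ⟨hwr, hTD hw⟩ ⟨hw'r, hTD hw'⟩
      · have hbw := sub_ne_zero.2 (hST b hb w hw)
        have haw := sub_ne_zero.2 (hST a ha w hw)
        simp only [div_self hbw, div_self haw, Complex.log_one] at this
        simp only [E] at h3 ⊢
        linear_combination h3 + this
      · refine ((ContinuousOn.sub ?_ ?_).sub (ContinuousOn.sub ?_ ?_)).sub continuousOn_const
        · exact continuousOn_log_one_sub hb1 inter_subset_right (hnS b hb)
        · exact continuousOn_log_one_sub ha1 inter_subset_right (hnS a ha)
        · exact ContinuousOn.clog (by fun_prop) fun v hv => hsl b hb v hv.1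
        · exact ContinuousOn.clog (by fun_prop) fun v hv => hsl a ha v hv.1
      · intro v hv
        have hvn : ‖v‖ ≤ 1 := by simpa using hv.2
        have hvb : v ≠ b := fun h => hnS b hb (h ▸ hv)
        have hva : v ≠ a := fun h => hnS a ha (h ▸ hv)
        have hbw := sub_ne_zero.2 (hST b hb w hw)
        have haw := sub_ne_zero.2 (hST a ha w hw)
        have hbv := sub_ne_zero.2 hvb.symm
        have hav := sub_ne_zero.2 hva.symm
        have hb0 := n0 hb1
        have ha0 := n0 ha1
        simp only [Complex.exp_sub]
        rw [exp_log_one_sub hb1 hvn hvb, exp_log_one_sub ha1 hvn hva,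
          exp_log_one_sub hb1 (hTn w hw) (hST b hb w hw).symm,
          exp_log_one_sub ha1 (hTn w hw) (hST a ha w hw).symm,
          Complex.exp_log (Complex.slitPlane_ne_zero (hsl b hb v hv.1)),
          Complex.exp_log (Complex.slitPlane_ne_zero (hsl a ha v hv.1))]
        field_simp
  have hPcd : P c → P d := by
    have := hTc.induction₂ (fun x y => P x ↔ P y) (fun x hx => ?_)
      (fun x y z _ _ _ h h' => h.trans h') (fun x y _ _ h => h.symm) hc hdT
    · exact this.1
    · obtain ⟨r, hr, h⟩ := hstep x hx
      filter_upwards [inter_mem_nhdsWithin T (ball_mem_nhds x hr)] with y hy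
      exact ⟨h x hx y hy.1 (by simpa using hr) hy.2, h y hy.1 x hx hy.2 (by simpa using hr)⟩
  obtain ⟨h, h1, h2, h3⟩ := hPcd ⟨0, continuousOn_const, fun z hz => by
    simp [div_self (sub_ne_zero.2 (hST z hz c hc))], by simp [E]⟩
  have := eq_of_exp_eq_one (h := fun z => Complex.log (1 - z / d) - Complex.log (1 - z / c)
      - (h z - h a) - (Complex.log (1 - a / d) - Complex.log (1 - a / c))) hSc ?_ ?_ ha hb
  · simp only [E] at h3
    linear_combination this - h3
  · refine ((ContinuousOn.sub ?_ ?_).sub (h1.sub continuousOn_const)).sub continuousOn_const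
    · exact continuousOn_log_one_sub hd1 hSD fun h => hST d h d hdT rfl
    · exact continuousOn_log_one_sub hc1 hSD fun h => hST c h c hc rfl
  · intro z hz
    have e1 := sub_ne_zero.2 (hST z hz c hc)
    have e2 := sub_ne_zero.2 (hST z hz d hdT)
    have e3 := sub_ne_zero.2 (hST a ha c hc)
    have e4 := sub_ne_zero.2 (hST a ha d hdT)
    have e5 := sub_ne_zero.2 (hST z hz c hc).symm
    have e6 := sub_ne_zero.2 (hST z hz d hdT).symm
    have e7 := sub_ne_zero.2 (hST a ha c hc).symm
    have e8 := sub_ne_zero.2 (hST a ha d hdT).symm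
    have hc0 := n0 hc1
    have hd0 := n0 hd1
    simp only [Complex.exp_sub]
    rw [exp_log_one_sub hd1 (hSn z hz) (hST z hz d hdT), exp_log_one_sub hc1 (hSn z hz)
      (hST z hz c hc), exp_log_one_sub hd1 (hSn a ha) (hST a ha d hdT),
      exp_log_one_sub hc1 (hSn a ha) (hST a ha c hc), h2 z hz, h2 a ha]
    have f1 : d - z = -(z - d) := by ring
    have f2 : c - z = -(z - c) := by ring
    have f3 : d - a = -(a - d) := by ring
    have f4 : c - a = -(a - c) := by ring
    rw [f1, f2, f3, f4]
    field_simp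

theorem crossing_unit {S T : Set ℂ} (hS : IsCompact S) (hSc : IsPreconnected S)
    (hTc : IsPreconnected T) (hSD : S ⊆ closedBall 0 1) (hTD : T ⊆ closedBall 0 1)
    (hd : Disjoint S T) {α β γ δ : ℝ} (hαβ : α < β) (hβγ : β < γ) (hγδ : γ < δ)
    (hδα : δ < α + 2 * Real.pi) (ha : Complex.exp (α * Complex.I) ∈ S)
    (hc : Complex.exp (β * Complex.I) ∈ T) (hb : Complex.exp (γ * Complex.I) ∈ S)
    (hdT : Complex.exp (δ * Complex.I) ∈ T) : False := by
  have hn : ∀ θ : ℝ, ‖Complex.exp (θ * Complex.I)‖ = 1 := fun θ => Complex.norm_exp_ofReal_mul_I θ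
  have key := congrArg Complex.im (log_relation hS hSc hTc hSD hTD hd ha hb hc hdT (hn α) (hn γ)
    (hn β) (hn δ))
  have pos : ∀ s t : ℝ, s < t → t < s + 2 * Real.pi → (Complex.log (1 -
      Complex.exp (t * Complex.I) / Complex.exp (s * Complex.I))).im = (t - s - Real.pi) / 2 := by
    intro s t h h'
    rw [← Complex.exp_sub, ← sub_mul, ← Complex.ofReal_sub, log_one_sub_exp_im] <;> linarith
  have neg : ∀ s t : ℝ, s < t → t < s + 2 * Real.pi → (Complex.log (1 -
      Complex.exp (s * Complex.I) / Complex.exp (t * Complex.I))).im = -(t - s - Real.pi) / 2 := by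
    intro s t h h'
    have hsl : 1 - Complex.exp ((t - s : ℝ) * Complex.I) ∈ Complex.slitPlane := by
      have := one_sub_div_mem_slitPlane (a := Complex.exp (s * Complex.I))
        (z := Complex.exp (t * Complex.I)) (hn s) (hn t).le (fun he => by
          rw [Complex.exp_eq_exp_iff_exists_int] at he
          obtain ⟨n, hn⟩ := he
          have := congrArg Complex.im hn
          simp at this
          have hn0 : (0 : ℝ) < n := by nlinarith [Real.pi_pos]
          have hn1 : (n : ℝ) < 1 := by nlinarith [Real.pi_pos]
          have : 0 < n := by exact_mod_cast hn0
          have : n < 1 := by exact_mod_cast hn1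
          omega)
      rwa [← Complex.exp_sub, ← sub_mul, ← Complex.ofReal_sub] at this
    rw [← Complex.exp_sub, ← sub_mul, ← Complex.ofReal_sub,
      show 1 - Complex.exp ((s - t : ℝ) * Complex.I)
        = (starRingEnd ℂ) (1 - Complex.exp ((t - s : ℝ) * Complex.I)) by
        rw [map_sub, map_one, ← Complex.exp_conj, map_mul, Complex.conj_ofReal, Complex.conj_I]
        push_cast; ring_nf,
      Complex.log_conj _ (Complex.mem_slitPlane_iff_arg.1 hsl).1, Complex.conj_im,
      log_one_sub_exp_im (by linarith) (by linarith)]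
    ring
  simp only [Complex.sub_im, Complex.add_im] at key
  rw [pos γ δ hγδ (by linarith), pos α δ (by linarith) (by linarith),
    neg β γ hβγ (by linarith), pos α β hαβ (by linarith),
    neg γ δ hγδ (by linarith), neg α δ (by linarith) (by linarith),
    pos β γ hβγ (by linarith), neg α β hαβ (by linarith)] at key
  linarith [Real.pi_pos]

end

section

theorem crossing {z₀ : ℂ} {r : ℝ} (hr : 0 < r) {S T : Set ℂ} (hS : IsCompact S)
    (hSc : IsPreconnected S) (hTc : IsPreconnected T) (hSD : S ⊆ closedBall z₀ r)
    (hTD : T ⊆ closedBall z₀ r) (hd : Disjoint S T) {α β γ δ : ℝ} (hαβ : α < β) (hβγ : β < γ)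
    (hγδ : γ < δ) (hδα : δ < α + 2 * Real.pi) (ha : circleMap z₀ r α ∈ S)
    (hc : circleMap z₀ r β ∈ T) (hb : circleMap z₀ r γ ∈ S)
    (hdT : circleMap z₀ r δ ∈ T) : False := by
  let f : ℂ → ℂ := fun z => (z - z₀) / r
  have hr0 : (r : ℂ) ≠ 0 := by exact_mod_cast hr.ne'
  have hf : Continuous f := by fun_prop
  have hfi : Function.Injective f := fun x y h => by
    simpa [f, div_left_inj' hr0] using h
  have hfc : ∀ θ, f (circleMap z₀ r θ) = Complex.exp (θ * Complex.I) := fun θ => by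
    simp [f, circleMap, hr0]
  have hfD : ∀ {A : Set ℂ}, A ⊆ closedBall z₀ r → f '' A ⊆ closedBall 0 1 := by
    rintro A hA _ ⟨z, hz, rfl⟩
    have := hA hz
    rw [mem_closedBall, dist_eq_norm] at this
    simp only [f, mem_closedBall, dist_zero_right, norm_div, Complex.norm_real,
      Real.norm_of_nonneg hr.le]
    rwa [div_le_one hr]
  exact crossing_unit (hS.image hf) (hSc.image f hf.continuousOn) (hTc.image f hf.continuousOn)
    (hfD hSD) (hfD hTD) ((disjoint_image_iff hfi).2 hd) hαβ hβγ hγδ hδα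
    ⟨_, ha, hfc α⟩ ⟨_, hc, hfc β⟩ ⟨_, hb, hfc γ⟩ ⟨_, hdT, hfc δ⟩

/-- Every continuum of `L` in a closed rational disc of `Ω` meets the boundary circle in at most
two points. -/
def FewHits (Ω L : Set ℂ) : Prop :=
  ∀ x y r : ℚ, 0 < r → closedBall (⟨x, y⟩ : ℂ) r ⊆ Ω → ∀ S, IsCompact S → IsPreconnected S →
    S ⊆ L ∩ closedBall (⟨x, y⟩ : ℂ) r → ∀ a ∈ S ∩ sphere (⟨x, y⟩ : ℂ) r,
    ∀ b ∈ S ∩ sphere (⟨x, y⟩ : ℂ) r, ∀ c ∈ S ∩ sphere (⟨x, y⟩ : ℂ) r, a = b ∨ b = c ∨ a = c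

theorem exists_circleMap_eq {z₀ z : ℂ} {r : ℝ} (hz : z ∈ sphere z₀ r) :
    ∃ θ ∈ Ioc (-Real.pi) Real.pi, circleMap z₀ r θ = z := by
  refine ⟨(z - z₀).arg, Complex.arg_mem_Ioc _, ?_⟩
  rw [mem_sphere, dist_eq_norm] at hz
  rw [circleMap, ← hz, Complex.norm_mul_exp_arg_mul_I]
  ring

theorem exists_sorted_triple {P : ℝ → Prop} {x y z : ℝ} (hx : P x) (hy : P y) (hz : P z)
    (hxy : x ≠ y) (hyz : y ≠ z) (hxz : x ≠ z) : ∃ a b c, a < b ∧ b < c ∧ P a ∧ P b ∧ P c := by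
  rcases lt_or_gt_of_ne hxy with h1 | h1 <;> rcases lt_or_gt_of_ne hyz with h2 | h2 <;>
    rcases lt_or_gt_of_ne hxz with h3 | h3
  · exact ⟨x, y, z, h1, h2, hx, hy, hz⟩
  · linarith
  · exact ⟨x, z, y, h3, h2, hx, hz, hy⟩
  · exact ⟨z, x, y, h3, h1, hz, hx, hy⟩
  · exact ⟨y, x, z, h1, h3, hy, hx, hz⟩
  · exact ⟨y, z, x, h2, h3, hy, hz, hx⟩
  · linarith
  · exact ⟨z, y, x, h2, h1, hz, hy, hx⟩

/-- A continuum of `L` hits a rational circle three times, with two rational separating angles. -/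
def TripleHit (L : Set ℂ) (x y r q₁ q₂ : ℚ) : Prop :=
  0 < r ∧ ∃ S, IsCompact S ∧ IsPreconnected S ∧ S ⊆ L ∩ closedBall (⟨x, y⟩ : ℂ) r ∧
    ∃ θ : Fin 3 → ℝ, (∀ i, θ i ∈ Ioc (-Real.pi) Real.pi ∧ circleMap ⟨x, y⟩ r (θ i) ∈ S) ∧
      θ 0 < q₁ ∧ q₁ < θ 1 ∧ θ 1 < q₂ ∧ q₂ < θ 2

theorem exists_tripleHit {Ω L : Set ℂ} (h : ¬ FewHits Ω L) :
    ∃ d : ℚ × ℚ × ℚ × ℚ × ℚ, TripleHit L d.1 d.2.1 d.2.2.1 d.2.2.2.1 d.2.2.2.2 := by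
  unfold FewHits at h
  push Not at h
  obtain ⟨x, y, r, hr, -, S, hS, hSc, hSL, a, ha, b, hb, c, hc, hab, hbc, hac⟩ := h
  obtain ⟨θa, ha1, rfl⟩ := exists_circleMap_eq ha.2
  obtain ⟨θb, hb1, rfl⟩ := exists_circleMap_eq hb.2
  obtain ⟨θc, hc1, rfl⟩ := exists_circleMap_eq hc.2
  obtain ⟨t₁, t₂, t₃, h12, h23, h1, h2, h3⟩ := exists_sorted_triple
    (P := fun θ => θ ∈ Ioc (-Real.pi) Real.pi ∧ circleMap ⟨x, y⟩ r θ ∈ S) ⟨ha1, ha.1⟩ ⟨hb1, hb.1⟩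
    ⟨hc1, hc.1⟩ (fun h => hab (by rw [h])) (fun h => hbc (by rw [h])) (fun h => hac (by rw [h]))
  obtain ⟨q₁, hq1, hq1'⟩ := exists_rat_btwn h12
  obtain ⟨q₂, hq2, hq2'⟩ := exists_rat_btwn h23
  refine ⟨(x, y, r, q₁, q₂), hr, S, hS, hSc, hSL, ![t₁, t₂, t₃], ?_, hq1, hq1', hq2, hq2'⟩
  intro i
  fin_cases i
  exacts [h1, h2, h3]

theorem not_disjoint_of_tripleHit {L L' : Set ℂ} {x y r q₁ q₂ : ℚ} (h : TripleHit L x y r q₁ q₂)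
    (h' : TripleHit L' x y r q₁ q₂) : ¬ Disjoint L L' := by
  intro hd
  obtain ⟨hr, S, hS, hSc, hSL, θ, hθ, h1, h2, h3, h4⟩ := h
  obtain ⟨-, T, hT, hTc, hTL, φ, hφ, g1, g2, g3, g4⟩ := h'
  have hr' : (0 : ℝ) < r := by exact_mod_cast hr
  have hST : Disjoint S T := hd.mono (hSL.trans inter_subset_left) (hTL.trans inter_subset_left)
  have hSD := hSL.trans inter_subset_right
  have hTD := hTL.trans inter_subset_right
  have hne : ∀ i, θ i ≠ φ i := fun i h => disjoint_left.1 hST (hθ i).2 (h ▸ (hφ i).2)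
  have up : ∀ i j, θ i < φ i → φ i < θ j → θ j < φ j → False := fun i j a b c =>
    crossing hr' hS hSc hTc hSD hTD hST a b c (by linarith [(hθ i).1.1, (hφ j).1.2])
      (hθ i).2 (hφ i).2 (hθ j).2 (hφ j).2
  have dn : ∀ i j, φ i < θ i → θ i < φ j → φ j < θ j → False := fun i j a b c =>
    crossing hr' hT hTc hSc hTD hSD hST.symm a b c (by linarith [(hφ i).1.1, (hθ j).1.2])
      (hφ i).2 (hθ i).2 (hφ j).2 (hθ j).2
  rcases lt_or_gt_of_ne (hne 0) with a0 | a0 <;> rcases lt_or_gt_of_ne (hne 1) with a1 | a1 <;>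
    rcases lt_or_gt_of_ne (hne 2) with a2 | a2
  · exact up 0 1 a0 (by linarith) a1
  · exact up 0 1 a0 (by linarith) a1
  · exact up 0 2 a0 (by linarith) a2
  · exact dn 1 2 a1 (by linarith) a2
  · exact up 1 2 a1 (by linarith) a2
  · exact dn 0 2 a0 (by linarith) a2
  · exact dn 0 1 a0 (by linarith) a1
  · exact dn 0 1 a0 (by linarith) a1

theorem countable_not_fewHits (Ω : Set ℂ) (v : ℂ → ℝ) :
    {t : ℝ | ¬ FewHits Ω {z ∈ Ω | v z = t}}.Countable := by
  classical
  let F : ℝ → ℚ × ℚ × ℚ × ℚ × ℚ := fun t =>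
    if h : ¬ FewHits Ω {z ∈ Ω | v z = t} then (exists_tripleHit h).choose else default
  have hF : ∀ t, ¬ FewHits Ω {z ∈ Ω | v z = t} → TripleHit {z ∈ Ω | v z = t} (F t).1 (F t).2.1
      (F t).2.2.1 (F t).2.2.2.1 (F t).2.2.2.2 := fun t h => by
    simp only [F, dif_pos h]
    exact (exists_tripleHit h).choose_spec
  refine (mapsTo_univ F _).countable_of_injOn (fun s hs t ht hst => ?_) (to_countable _)
  by_contra hne
  have h2 := hF t ht
  rw [← hst] at h2
  refine not_disjoint_of_tripleHit (hF s hs) h2 (disjoint_left.2 ?_)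
  rintro z ⟨-, h⟩ ⟨-, h'⟩
  exact hne (h.symm.trans h')

/-- Only finitely many disjoint continua of `L` cross a given annulus. -/
def FinCross (Ω L : Set ℂ) : Prop :=
  ∀ p r₁ r₂, r₁ < r₂ → closedBall p r₂ ⊆ Ω → ∀ F : Set (Set ℂ),
    (∀ S ∈ F, IsCompact S ∧ IsPreconnected S ∧ S ⊆ L ∩ closedBall p r₂ ∧
      (S ∩ closedBall p r₁).Nonempty ∧ (S ∩ sphere p r₂).Nonempty) →
    F.PairwiseDisjoint id → F.Finite

theorem FinCross.mono {Ω Ω' L L' : Set ℂ} (h : FinCross Ω L) (hΩ : Ω' ⊆ Ω) (hL : L' ⊆ L) :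
    FinCross Ω' L' := fun p r₁ r₂ h12 hp F hF hd =>
  h p r₁ r₂ h12 (hp.trans hΩ) F (fun S hS => ⟨(hF S hS).1, (hF S hS).2.1,
    (hF S hS).2.2.1.trans (inter_subset_inter_left _ hL), (hF S hS).2.2.2⟩) hd

theorem FewHits.mono {Ω Ω' L L' : Set ℂ} (h : FewHits Ω L) (hΩ : Ω' ⊆ Ω) (hL : L' ⊆ L) :
    FewHits Ω' L' := fun x y r hr hp S hS hSc hSL =>
  h x y r hr (hp.trans hΩ) S hS hSc (hSL.trans (inter_subset_inter_left _ hL))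

theorem le_hausdorffMeasure_of_crossing {X : Type*} [MetricSpace X] [MeasurableSpace X]
    [BorelSpace X] {S K₁ : Set X} {η : ℝ} (hS : IsPreconnected S) {a b : X} (ha : a ∈ S)
    (hb : b ∈ S) (haK : a ∈ K₁) (hbK : η ≤ infDist b K₁) :
    ENNReal.ofReal η ≤ (Measure.hausdorffMeasure 1 : Measure X) S := by
  have hlip : LipschitzWith 1 (fun x => infDist x K₁) := lipschitz_infDist_pt K₁
  have hsub : Icc 0 η ⊆ (fun x => infDist x K₁) '' S := by
    intro y hy
    have := hS.intermediate_value ha hb hlip.continuous.continuousOn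
    apply this
    rw [infDist_zero_of_mem haK]
    exact ⟨hy.1, hy.2.trans hbK⟩
  have := hlip.hausdorffMeasure_image_le zero_le_one S
  rw [hausdorffMeasure_real] at this
  calc ENNReal.ofReal η = volume (Icc 0 η) := by rw [Real.volume_Icc, sub_zero]
    _ ≤ volume ((fun x => infDist x K₁) '' S) := measure_mono hsub
    _ ≤ _ := by simpa using this

theorem finCross_of_hausdorffMeasure {X : Type*} [MetricSpace X] [MeasurableSpace X]
    [BorelSpace X] (e : X ≃ₜ ℂ) {Ω L : Set X}
    (h : ∀ K : Set X, IsCompact K → K ⊆ Ω →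
      (Measure.hausdorffMeasure 1 : Measure X) (L ∩ K) < ⊤) : FinCross (e '' Ω) (e '' L) := by
  intro p r₁ r₂ h12 hp F hF hd
  rcases F.eq_empty_or_nonempty with rfl | ⟨S₀, hS₀⟩
  · exact finite_empty
  have hc : ∀ {A : Set ℂ}, IsCompact A → IsCompact (e.symm '' A) := fun hA =>
    hA.image e.symm.continuous
  have hK := hc (isCompact_closedBall p r₂)
  have hK₁ := hc (isCompact_closedBall p r₁)
  have hK₂ := hc (isCompact_sphere p r₂)
  have hn₁ : (e.symm '' closedBall p r₁).Nonempty := ((hF S₀ hS₀).2.2.2.1.mono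
    inter_subset_right).image _
  have hn₂ : (e.symm '' sphere p r₂).Nonempty := ((hF S₀ hS₀).2.2.2.2.mono
    inter_subset_right).image _
  have hdisj : Disjoint (e.symm '' closedBall p r₁) (e.symm '' sphere p r₂) := by
    rw [disjoint_image_iff e.symm.injective, disjoint_left]
    intro z hz hz'
    rw [mem_closedBall] at hz
    rw [mem_sphere] at hz'
    linarith
  obtain ⟨b₀, hb₀, hmin⟩ := hK₂.exists_isMinOn hn₂
    (continuous_infDist_pt (e.symm '' closedBall p r₁)).continuousOn
  set η := infDist b₀ (e.symm '' closedBall p r₁) with hη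
  have hη0 : 0 < η := (hK₁.isClosed.notMem_iff_infDist_pos hn₁).1
    fun hb => disjoint_left.1 hdisj hb hb₀
  have hfin := Measure.finite_const_le_meas_of_disjoint_iUnion
    (Measure.hausdorffMeasure 1 : Measure X) (ENNReal.ofReal_pos.2 hη0)
    (As := fun S : F => e.symm '' (S : Set ℂ)) (fun S => (hc (hF S S.2).1).measurableSet) ?_ ?_
  · have huniv : {S : F | ENNReal.ofReal η ≤ (Measure.hausdorffMeasure 1 : Measure X)
        (e.symm '' (S : Set ℂ))} = univ := by
      rw [eq_univ_iff_forall]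
      rintro ⟨S, hS⟩
      obtain ⟨h1, h2, h3, ⟨a, ha, ha'⟩, ⟨b, hb, hb'⟩⟩ := hF S hS
      exact le_hausdorffMeasure_of_crossing (h2.image _ e.symm.continuous.continuousOn)
        (mem_image_of_mem _ ha) (mem_image_of_mem _ hb) (mem_image_of_mem _ ha')
        (hmin (mem_image_of_mem _ hb'))
    rw [huniv, finite_univ_iff] at hfin
    exact hfin
  · rintro ⟨S, hS⟩ ⟨T, hT⟩ hne
    exact (disjoint_image_iff e.symm.injective).2 (hd hS hT fun h => hne (Subtype.ext h))
  · refine ne_top_of_le_ne_top (h _ hK ?_).ne (measure_mono (iUnion_subset ?_))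
    · rintro _ ⟨z, hz, rfl⟩
      obtain ⟨x, hx, hxz⟩ := hp hz
      rwa [← hxz, e.symm_apply_apply]
    · rintro ⟨S, hS⟩ _ ⟨z, hz, rfl⟩
      obtain ⟨hzL, hzB⟩ := (hF S hS).2.2.1 hz
      obtain ⟨x, hx, hxz⟩ := hzL
      exact ⟨by rwa [← hxz, e.symm_apply_apply], mem_image_of_mem _ hzB⟩

end

section

theorem isPreconnected_sInter_of_isChain {α : Type*} [TopologicalSpace α] [T2Space α]
    {c : Set (Set α)} (hc : IsChain (· ⊆ ·) c) (hne : c.Nonempty)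
    (h : ∀ s ∈ c, IsCompact s ∧ IsPreconnected s) : IsPreconnected (⋂₀ c) := by
  obtain ⟨s₀, hs₀⟩ := hne
  have hcl : IsClosed (⋂₀ c) := isClosed_sInter fun s hs => (h s hs).1.isClosed
  have hcp : IsCompact (⋂₀ c) := (h s₀ hs₀).1.of_isClosed_subset hcl (sInter_subset_of_mem hs₀)
  rw [isPreconnected_closed_iff]
  intro t t' ht ht' hsub ⟨x, hx, hxt⟩ ⟨y, hy, hyt⟩
  by_contra hcon
  have hd : Disjoint (⋂₀ c ∩ t) (⋂₀ c ∩ t') := disjoint_left.2 fun z hz hz' =>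
    hcon ⟨z, hz.1, hz.2, hz'.2⟩
  obtain ⟨U, V, hU, hV, hUt, hVt, hUV⟩ := SeparatedNhds.of_isCompact_isCompact
    (hcp.inter_right ht) (hcp.inter_right ht') hd
  have : Nonempty c := ⟨⟨s₀, hs₀⟩⟩
  obtain ⟨⟨s, hs⟩, hsUV⟩ := exists_subset_nhds_of_isCompact' (V := fun s : c => (s : Set α))
    (U := U ∪ V) (fun a b => by
      rcases hc.total a.2 b.2 with hab | hab
      · exact ⟨a, le_refl _, hab⟩
      · exact ⟨b, hab, le_refl _⟩)
    (fun s => (h s s.2).1) (fun s => (h s s.2).1.isClosed) (fun z hz => by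
      have hz' : z ∈ ⋂₀ c := by rwa [sInter_eq_iInter]
      refine (hU.union hV).mem_nhds ?_
      rcases hsub hz' with h1 | h1
      · exact Or.inl (hUt ⟨hz', h1⟩)
      · exact Or.inr (hVt ⟨hz', h1⟩))
  obtain ⟨z, -, hz1, hz2⟩ := (h s hs).2 U V hU hV hsUV ⟨x, hx s hs, hUt ⟨hx, hxt⟩⟩
    ⟨y, hy s hs, hVt ⟨hy, hyt⟩⟩
  exact disjoint_left.1 hUV hz1 hz2

theorem exists_separation_of_component {α : Type*} [TopologicalSpace α] [T2Space α] {Y T : Set α}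
    (hY : IsCompact Y) (hT : IsClosed T) {x : α} (hx : x ∈ Y)
    (hd : connectedComponentIn Y x ∩ T = ∅) :
    ∃ Z ⊆ Y, IsCompact Z ∧ IsCompact (Y \ Z) ∧ x ∈ Z ∧ Z ∩ T = ∅ := by
  have : CompactSpace Y := isCompact_iff_compactSpace.1 hY
  let x' : Y := ⟨x, hx⟩
  have : Nonempty {s : Set Y // IsClopen s ∧ x' ∈ s} := ⟨⟨univ, isClopen_univ, mem_univ _⟩⟩
  have key : ∃ i : {s : Set Y // IsClopen s ∧ x' ∈ s}, (Subtype.val ⁻¹' T) ∩ (i : Set Y) = ∅ := by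
    apply IsCompact.elim_directed_family_closed (hT.preimage continuous_subtype_val).isCompact
    · exact fun i => i.2.1.isClosed
    · rw [← connectedComponent_eq_iInter_isClopen]
      rw [connectedComponentIn_eq_image hx] at hd
      rw [eq_empty_iff_forall_notMem] at hd ⊢
      rintro y ⟨h1, h2⟩
      exact hd y ⟨⟨y, h2, rfl⟩, h1⟩
    · rintro ⟨s, hs, hs'⟩ ⟨t, ht, ht'⟩
      exact ⟨⟨s ∩ t, hs.inter ht, hs', ht'⟩, inter_subset_left, inter_subset_right⟩
  obtain ⟨⟨s, hs, hs'⟩, hsT⟩ := key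
  refine ⟨Subtype.val '' s, ?_, hs.isClosed.isCompact.image continuous_subtype_val, ?_,
    ⟨x', hs', rfl⟩, ?_⟩
  · rintro _ ⟨y, -, rfl⟩; exact y.2
  · have : Y \ Subtype.val '' s = Subtype.val '' sᶜ := by
      ext z
      constructor
      · rintro ⟨hz, hzs⟩
        exact ⟨⟨z, hz⟩, fun h => hzs ⟨_, h, rfl⟩, rfl⟩
      · rintro ⟨y, hy, rfl⟩
        refine ⟨y.2, ?_⟩
        rintro ⟨y', hy', h⟩
        exact hy (Subtype.ext h ▸ hy')
    rw [this]
    exact hs.compl.isClosed.isCompact.image continuous_subtype_val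
  · rw [eq_empty_iff_forall_notMem] at hsT ⊢
    rintro _ ⟨⟨y, hy, rfl⟩, h⟩
    exact hsT y ⟨h, hy⟩

/-- A relatively closed subset of an open set whose continua do not accumulate. -/
structure Nice (Ω E : Set ℂ) : Prop where
  isOpen : IsOpen Ω
  sub : E ⊆ Ω
  cpt : ∀ p r, closedBall p r ⊆ Ω → IsCompact (E ∩ closedBall p r)
  fin : FinCross Ω E

theorem isClosed_component_of_isClosed {α : Type*} [TopologicalSpace α] {Y : Set α}
    (hY : IsClosed Y) (x : α) : IsClosed (connectedComponentIn Y x) := by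
  by_cases hx : x ∈ Y
  · rw [connectedComponentIn_eq_image hx]
    exact hY.isClosedEmbedding_subtypeVal.isClosedMap _ isClosed_connectedComponent
  · rw [connectedComponentIn_eq_empty hx]; exact isClosed_empty

theorem isCompact_component {α : Type*} [TopologicalSpace α] [T2Space α] {Y : Set α}
    (hY : IsCompact Y) (x : α) : IsCompact (connectedComponentIn Y x) :=
  hY.of_isClosed_subset (isClosed_component_of_isClosed hY.isClosed x)
    (connectedComponentIn_subset _ _)

/-- Boundary bumping. -/
theorem component_meets_sphere {E : Set ℂ} {p : ℂ} {r : ℝ} (hc : IsCompact (E ∩ closedBall p r))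
    (hE : IsPreconnected E) (hEb : ¬ E ⊆ closedBall p r) {x : ℂ} (hx : x ∈ E ∩ closedBall p r) :
    (connectedComponentIn (E ∩ closedBall p r) x ∩ sphere p r).Nonempty := by
  by_contra hcon
  rw [not_nonempty_iff_eq_empty] at hcon
  obtain ⟨Z, hZY, hZ, hZ', hxZ, hZT⟩ := exists_separation_of_component hc isClosed_sphere hx hcon
  set O := ball p r ∩ ((E ∩ closedBall p r) \ Z)ᶜ
  have hO : IsOpen O := isOpen_ball.inter hZ'.isClosed.isOpen_compl
  have hZO : Z ⊆ O := fun z hz => by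
    refine ⟨?_, fun h => h.2 hz⟩
    have h1 := (hZY hz).2
    rw [mem_ball]
    refine lt_of_le_of_ne h1 fun h => ?_
    rw [eq_empty_iff_forall_notMem] at hZT
    exact hZT z ⟨hz, h⟩
  have hOZ : ∀ z ∈ E, z ∈ O → z ∈ Z := fun z hz hzO => by
    by_contra h
    exact hzO.2 ⟨⟨hz, ball_subset_closedBall hzO.1⟩, h⟩
  obtain ⟨y, hy, hyb⟩ := not_subset.1 hEb
  obtain ⟨z, hz, h1, h2⟩ := isPreconnected_closed_iff.1 hE Z Oᶜ hZ.isClosed hO.isClosed_compl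
    (fun z hz => by
      by_cases h : z ∈ O
      · exact Or.inl (hOZ z hz h)
      · exact Or.inr h) ⟨x, hx.1, hxZ⟩ ⟨y, hy, fun h => hyb (ball_subset_closedBall h.1)⟩
  exact h2 (hZO h1)

namespace Nice

variable {Ω E : Set ℂ}

theorem isOpen_diff (h : Nice Ω E) : IsOpen (Ω \ E) := by
  rw [Metric.isOpen_iff]
  intro x hx
  obtain ⟨r, hr, hrΩ⟩ := Metric.nhds_basis_closedBall.mem_iff.1 (h.isOpen.mem_nhds hx.1)
  have hc := (h.cpt x r hrΩ).isClosed.isOpen_compl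
  obtain ⟨δ, hδ, hδs⟩ := Metric.isOpen_iff.1 hc x fun h' => hx.2 h'.1
  refine ⟨min δ r, lt_min hδ hr, fun y hy => ?_⟩
  have h1 := hδs (ball_subset_ball (min_le_left _ _) hy)
  have h2 : y ∈ closedBall x r := ball_subset_closedBall (ball_subset_ball (min_le_right _ _) hy)
  exact ⟨hrΩ h2, fun h' => h1 ⟨h', h2⟩⟩

/-- Relatively closed subsets of nice sets are nice. -/
theorem of_subset (h : Nice Ω E) {F : Set ℂ} (hF : F ⊆ E) (hFo : IsOpen (Ω \ F)) : Nice Ω F where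
  isOpen := h.isOpen
  sub := hF.trans h.sub
  cpt p r hp := by
    have : F ∩ closedBall p r = closedBall p r \ (Ω \ F) := by
      ext z
      constructor
      · exact fun hz => ⟨hz.2, fun h' => h'.2 hz.1⟩
      · exact fun hz => ⟨by_contra fun h' => hz.2 ⟨hp hz.1, h'⟩, hz.1⟩
    rw [this]
    exact (isCompact_closedBall p r).diff hFo
  fin := h.fin.mono subset_rfl hF

theorem of_isCompact (h : Nice Ω E) {F : Set ℂ} (hF : F ⊆ E) (hFc : IsCompact F) : Nice Ω F :=
  h.of_subset hF (h.isOpen.sdiff hFc.isClosed)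

theorem diff_singleton (h : Nice Ω E) (p : ℂ) : Nice (Ω \ {p}) (E \ {p}) where
  isOpen := h.isOpen.sdiff isClosed_singleton
  sub := sdiff_subset_sdiff_left h.sub
  cpt q r hq := by
    have : (E \ {p}) ∩ closedBall q r = E ∩ closedBall q r := by
      ext z
      exact ⟨fun hz => ⟨hz.1.1, hz.2⟩, fun hz => ⟨⟨hz.1, (hq hz.2).2⟩, hz.2⟩⟩
    rw [this]
    exact h.cpt q r (hq.trans sdiff_subset)
  fin := h.fin.mono sdiff_subset sdiff_subset

theorem component (h : Nice Ω E) (x : ℂ) : Nice Ω (connectedComponentIn E x) := by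
  refine h.of_subset (connectedComponentIn_subset _ _) ?_
  have : Ω \ connectedComponentIn E x = Ω \ closure (connectedComponentIn E x) := by
    ext z
    refine ⟨fun hz => ⟨hz.1, fun hzc => hz.2 ?_⟩, fun hz => ⟨hz.1, fun h' => hz.2
      (subset_closure h')⟩⟩
    have hxE : x ∈ E := by
      rw [← connectedComponentIn_nonempty_iff]
      by_contra hne
      rw [not_nonempty_iff_eq_empty] at hne
      simp [hne] at hzc
    have hzE : z ∈ E := by
      by_contra hzE
      obtain ⟨w, hw1, hw2⟩ := mem_closure_iff.1 hzc _ h.isOpen_diff ⟨hz.1, hzE⟩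
      exact hw1.2 (connectedComponentIn_subset _ _ hw2)
    have hpc : IsPreconnected (insert z (connectedComponentIn E x)) :=
      isPreconnected_connectedComponentIn.subset_closure (subset_insert _ _)
        (insert_subset hzc subset_closure)
    exact hpc.subset_connectedComponentIn (mem_insert_of_mem _ (mem_connectedComponentIn hxE))
      (insert_subset hzE (connectedComponentIn_subset _ _)) (mem_insert _ _)
  rw [this]
  exact h.isOpen.sdiff isClosed_closure

theorem exists_ball_subset_component (h : Nice Ω E) {p : ℂ} (hp : p ∈ E) {r : ℝ}
    (hr : 0 < r) (hrΩ : closedBall p r ⊆ Ω)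
    (hmeet : ∀ x ∈ E ∩ closedBall p (r / 2),
      (connectedComponentIn (E ∩ closedBall p r) x ∩ sphere p r).Nonempty) :
    ∃ δ > 0, E ∩ ball p δ ⊆ connectedComponentIn (E ∩ closedBall p r) p := by
  have hc := h.cpt p r hrΩ
  have hpD : p ∈ E ∩ closedBall p r := ⟨hp, mem_closedBall_self hr.le⟩
  let κ : ℂ → Set ℂ := connectedComponentIn (E ∩ closedBall p r)
  let F : Set (Set ℂ) := κ '' (E ∩ closedBall p (r / 2))
  have hsub : closedBall p (r / 2) ⊆ closedBall p r := closedBall_subset_closedBall (by linarith)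
  have hF : F.Finite := by
    refine h.fin p (r / 2) r (by linarith) hrΩ F ?_ ?_
    · rintro _ ⟨x, hx, rfl⟩
      exact ⟨isCompact_component hc x, isPreconnected_connectedComponentIn,
        connectedComponentIn_subset _ _, ⟨x, mem_connectedComponentIn ⟨hx.1, hsub hx.2⟩, hx.2⟩,
        hmeet x hx⟩
    · rintro _ ⟨x, hx, rfl⟩ _ ⟨y, hy, rfl⟩ hne
      refine disjoint_left.2 fun z hz hz' => hne ?_
      rw [id] at hz hz'
      exact (connectedComponentIn_eq hz).trans (connectedComponentIn_eq hz').symm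
  have hO : IsOpen (⋃₀ (F \ {κ p}))ᶜ := by
    rw [isOpen_compl_iff, sUnion_eq_biUnion]
    refine (hF.subset sdiff_subset).isClosed_biUnion ?_
    rintro _ ⟨⟨x, hx, rfl⟩, -⟩
    exact (isCompact_component hc x).isClosed
  have hpO : p ∈ (⋃₀ (F \ {κ p}))ᶜ := by
    rintro ⟨_, ⟨⟨x, hx, rfl⟩, hne⟩, hpx⟩
    exact hne (connectedComponentIn_eq hpx)
  obtain ⟨δ, hδ, hδO⟩ := Metric.isOpen_iff.1 hO p hpO
  refine ⟨min δ (r / 2), lt_min hδ (by linarith), fun x hx => ?_⟩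
  have hx1 := hδO (ball_subset_ball (min_le_left _ _) hx.2)
  have hx2 : x ∈ closedBall p (r / 2) :=
    ball_subset_closedBall (ball_subset_ball (min_le_right _ _) hx.2)
  have hxx : x ∈ κ x := mem_connectedComponentIn ⟨hx.1, hsub hx2⟩
  by_contra hcon
  exact hx1 ⟨κ x, ⟨⟨x, ⟨hx.1, hx2⟩, rfl⟩, fun he => hcon (mem_singleton_iff.1 he ▸ hxx : x ∈ κ p)⟩, hxx⟩

/-- Continua are locally connected, quantitatively. -/
theorem exists_local (h : Nice Ω E) (hE : IsPreconnected E) {p : ℂ} (hp : p ∈ E) {r : ℝ}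
    (hr : 0 < r) (hrΩ : closedBall p r ⊆ Ω) :
    ∃ K, IsCompact K ∧ IsPreconnected K ∧ p ∈ K ∧ K ⊆ E ∩ closedBall p r ∧
      ∃ δ > 0, E ∩ ball p δ ⊆ K := by
  have hc := h.cpt p r hrΩ
  by_cases hEb : E ⊆ closedBall p r
  · rw [inter_eq_left.2 hEb] at hc ⊢
    exact ⟨E, hc, hE, hp, subset_rfl, 1, one_pos, inter_subset_left⟩
  exact ⟨_, isCompact_component hc p, isPreconnected_connectedComponentIn,
    mem_connectedComponentIn ⟨hp, mem_closedBall_self hr.le⟩, connectedComponentIn_subset _ _,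
    h.exists_ball_subset_component hp hr hrΩ fun x hx => component_meets_sphere hc hE hEb
      ⟨hx.1, closedBall_subset_closedBall (by linarith) hx.2⟩⟩

theorem exists_continuum (h : Nice Ω E) (hE : IsPreconnected E) {x y : ℂ} (hx : x ∈ E)
    (hy : y ∈ E) : ∃ K ⊆ E, IsCompact K ∧ IsPreconnected K ∧ x ∈ K ∧ y ∈ K := by
  refine hE.induction₂ (fun x y => ∃ K ⊆ E, IsCompact K ∧ IsPreconnected K ∧ x ∈ K ∧ y ∈ K)
    (fun x hx => ?_) (fun x y z _ _ _ => ?_) (fun x y _ _ => ?_) hx hy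
  · obtain ⟨r, hr, hrΩ⟩ := Metric.nhds_basis_closedBall.mem_iff.1 (h.isOpen.mem_nhds (h.sub hx))
    obtain ⟨K, h1, h2, h3, h4, δ, hδ, h5⟩ := h.exists_local hE hx hr hrΩ
    filter_upwards [inter_mem_nhdsWithin E (ball_mem_nhds x hδ)] with y hy
    exact ⟨K, h4.trans inter_subset_left, h1, h2, h3, h5 hy⟩
  · rintro ⟨K, h1, h2, h3, h4, h5⟩ ⟨K', g1, g2, g3, g4, g5⟩
    exact ⟨K ∪ K', union_subset h1 g1, h2.union g2, h3.union y h5 g4 g3, Or.inl h4, Or.inr g5⟩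
  · rintro ⟨K, h1, h2, h3, h4, h5⟩
    exact ⟨K, h1, h2, h3, h5, h4⟩

end Nice

end

section

/-- A size function for closed sets, strictly monotone for inclusion. -/
def size (S : Set ℂ) : ℝ :=
  -∑' n : ℕ, (1 / 2 : ℝ) ^ n * min 1 (infDist (TopologicalSpace.denseSeq ℂ n) S)

theorem summable_size (S : Set ℂ) : Summable fun n : ℕ =>
    (1 / 2 : ℝ) ^ n * min 1 (infDist (TopologicalSpace.denseSeq ℂ n) S) := by
  refine Summable.of_nonneg_of_le (fun n => ?_) (fun n => ?_) summable_geometric_two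
  · exact mul_nonneg (by positivity) (le_min zero_le_one infDist_nonneg)
  · exact mul_le_of_le_one_right (by positivity) (min_le_left _ _)

theorem size_mono {S T : Set ℂ} (hS : S.Nonempty) (h : S ⊆ T) : size S ≤ size T := by
  refine neg_le_neg ((summable_size T).tsum_le_tsum (fun n => ?_) (summable_size S))
  have := infDist_le_infDist_of_subset (x := TopologicalSpace.denseSeq ℂ n) h hS
  gcongr

theorem size_strict {S T : Set ℂ} (hS : S.Nonempty) (hSc : IsClosed S) (h : S ⊂ T) :
    size S < size T := by
  obtain ⟨z, hzT, hzS⟩ := exists_of_ssubset h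
  have hη := (hSc.notMem_iff_infDist_pos hS).1 hzS
  set η := infDist z S
  have hm : 0 < min η 1 / 3 := by positivity
  obtain ⟨n, hn⟩ := (TopologicalSpace.denseRange_denseSeq ℂ).exists_dist_lt z hm
  refine neg_lt_neg ((summable_size T).tsum_lt_tsum (i := n) (fun n => ?_) ?_ (summable_size S))
  · have := infDist_le_infDist_of_subset (x := TopologicalSpace.denseSeq ℂ n) h.1 hS
    gcongr
  · have h1 : infDist (TopologicalSpace.denseSeq ℂ n) T < min η 1 / 3 :=
      (infDist_le_dist_of_mem hzT).trans_lt (by rwa [dist_comm])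
    have h2 : η ≤ infDist (TopologicalSpace.denseSeq ℂ n) S + min η 1 / 3 := by
      have := infDist_le_infDist_add_dist (s := S) (x := z) (y := TopologicalSpace.denseSeq ℂ n)
      linarith
    have h3 := min_le_left η 1
    have h4 := min_le_right η 1
    refine mul_lt_mul_of_pos_left ?_ (by positivity)
    refine lt_min ((min_le_right _ _).trans_lt ?_) ((min_le_right _ _).trans_lt ?_) <;> linarith

theorem size_le_add {S T : Set ℂ} {ρ : ℝ} (hS : S.Nonempty)
    (h : ∀ z ∈ S, ∃ w ∈ T, dist z w ≤ ρ) : size S ≤ size T + 2 * ρ := by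
  obtain ⟨z₀, hz₀⟩ := hS
  have hρ : 0 ≤ ρ := by
    obtain ⟨w, -, hw⟩ := h z₀ hz₀
    exact dist_nonneg.trans hw
  have key : ∀ x, infDist x T ≤ infDist x S + ρ := by
    intro x
    refine le_of_forall_pos_lt_add fun ε hε => ?_
    obtain ⟨z, hz, hzx⟩ := (infDist_lt_iff (r := infDist x S + ε) ⟨z₀, hz₀⟩).1 (by linarith)
    obtain ⟨w, hw, hzw⟩ := h z hz
    have := infDist_le_dist_of_mem (x := x) hw
    have := dist_triangle x z w
    linarith
  have hs : Summable fun n : ℕ => (1 / 2 : ℝ) ^ n * ρ := summable_geometric_two.mul_right ρ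
  have : ∑' n : ℕ, (1 / 2 : ℝ) ^ n * min 1 (infDist (TopologicalSpace.denseSeq ℂ n) T) ≤
      ∑' n : ℕ, ((1 / 2 : ℝ) ^ n * min 1 (infDist (TopologicalSpace.denseSeq ℂ n) S)
        + (1 / 2 : ℝ) ^ n * ρ) := by
    refine (summable_size T).tsum_le_tsum (fun n => ?_) ((summable_size S).add hs)
    rw [← mul_add]
    refine mul_le_mul_of_nonneg_left ?_ (by positivity)
    have := key (TopologicalSpace.denseSeq ℂ n)
    rw [← min_add_add_right]
    exact min_le_min (by linarith) this
  rw [(summable_size S).tsum_add hs, tsum_mul_right, tsum_geometric_two] at this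
  unfold size
  linarith

theorem abs_size_sub_le {S T : Set ℂ} {ρ : ℝ} (hS : S.Nonempty) (hT : T.Nonempty)
    (h : ∀ z ∈ S, ∃ w ∈ T, dist z w ≤ ρ) (h' : ∀ z ∈ T, ∃ w ∈ S, dist z w ≤ ρ) :
    |size S - size T| ≤ 2 * ρ := by
  have := size_le_add hS h
  have := size_le_add hT h'
  rw [abs_le]
  constructor <;> linarith

/-- If the symmetric difference lies in a small ball centred in both sets' reach, the sizes are
close. -/
theorem abs_size_sub_le_of_subset {S T K : Set ℂ} {x y : ℂ} {r : ℝ} (hx : x ∈ S) (hy : y ∈ T)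
    (hyK : y ∈ closedBall x r) (hK : K ⊆ closedBall x r) (h : S \ T ⊆ K) (h' : T \ S ⊆ K) :
    |size S - size T| ≤ 4 * r := by
  have hr : 0 ≤ r := dist_nonneg.trans hyK
  have := abs_size_sub_le (S := S) (T := T) (ρ := 2 * r) ⟨x, hx⟩ ⟨y, hy⟩ (fun z hz => ?_)
    (fun z hz => ?_)
  · linarith
  · by_cases hzT : z ∈ T
    · exact ⟨z, hzT, by simpa using hr⟩
    · refine ⟨y, hy, ?_⟩
      have h1 := hK (h ⟨hz, hzT⟩)
      rw [mem_closedBall] at h1 hyK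
      have := dist_triangle_right z y x
      linarith
  · by_cases hzS : z ∈ S
    · exact ⟨z, hzS, by simpa using hr⟩
    · refine ⟨x, hx, ?_⟩
      have h1 := hK (h' ⟨hz, hzS⟩)
      rw [mem_closedBall] at h1
      linarith

namespace Nice

variable {Ω E : Set ℂ}

theorem exists_minimal_continuum (h : Nice Ω E) (hE : IsPreconnected E) {a b : ℂ} (ha : a ∈ E)
    (hb : b ∈ E) : ∃ A ⊆ E, IsCompact A ∧ IsPreconnected A ∧ a ∈ A ∧ b ∈ A ∧
      ∀ B ⊆ A, IsCompact B → IsPreconnected B → a ∈ B → b ∈ B → B = A := by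
  obtain ⟨K, hKE, hK, hKc, haK, hbK⟩ := h.exists_continuum hE ha hb
  obtain ⟨A, hAK, hA⟩ := zorn_superset_nonempty
    {A | IsCompact A ∧ IsPreconnected A ∧ a ∈ A ∧ b ∈ A} (fun c hc hch hne => by
      refine ⟨⋂₀ c, ⟨?_, isPreconnected_sInter_of_isChain hch hne fun s hs =>
        ⟨(hc hs).1, (hc hs).2.1⟩, fun s hs => (hc hs).2.2.1, fun s hs => (hc hs).2.2.2⟩,
        fun s hs => sInter_subset_of_mem hs⟩
      obtain ⟨s, hs⟩ := hne
      exact (hc hs).1.of_isClosed_subset (isClosed_sInter fun s hs => (hc hs).1.isClosed)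
        (sInter_subset_of_mem hs)) K ⟨hK, hKc, haK, hbK⟩
  refine ⟨A, hAK.trans hKE, hA.1.1, hA.1.2.1, hA.1.2.2.1, hA.1.2.2.2, fun B hBA h1 h2 h3 h4 => ?_⟩
  exact hBA.antisymm (hA.2 (show IsCompact B ∧ IsPreconnected B ∧ a ∈ B ∧ b ∈ B from
    ⟨h1, h2, h3, h4⟩) hBA)

theorem mem_nhdsWithin_component (h : Nice Ω E) (hE : IsPreconnected E) {x y : ℂ} (hy : y ∈ E)
    (hyx : y ≠ x) : ∃ δ > 0, E ∩ ball y δ ⊆ connectedComponentIn (E \ {x}) y := by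
  obtain ⟨r, hr, hrΩ⟩ := Metric.nhds_basis_closedBall.mem_iff.1
    ((h.isOpen.sdiff (isClosed_singleton (x := x))).mem_nhds ⟨h.sub hy, hyx⟩)
  obtain ⟨K, h1, h2, h3, h4, δ, hδ, h5⟩ := h.exists_local hE hy hr (hrΩ.trans sdiff_subset)
  refine ⟨δ, hδ, h5.trans (h2.subset_connectedComponentIn h3 fun z hz => ?_)⟩
  exact ⟨(h4 hz).1, (hrΩ (h4 hz).2).2⟩

/-- A component of the complement of a point in a compact nice continuum, together with the
point, is a continuum. -/
theorem insert_component (h : Nice Ω E) (hE : IsPreconnected E) (hc : IsCompact E) {x w : ℂ}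
    (hx : x ∈ E) : IsCompact (insert x (connectedComponentIn (E \ {x}) w)) ∧
      IsPreconnected (insert x (connectedComponentIn (E \ {x}) w)) := by
  set C := connectedComponentIn (E \ {x}) w with hC
  by_cases hw : w ∈ E \ {x}
  swap
  · rw [hC, connectedComponentIn_eq_empty hw]
    simpa using isPreconnected_singleton
  have hCE : C ⊆ E \ {x} := connectedComponentIn_subset _ _
  have hwC : w ∈ C := mem_connectedComponentIn hw
  have hcl : closure C ⊆ insert x C := by
    intro z hz
    by_cases hzx : z = x
    · exact Or.inl hzx
    have hzE : z ∈ E := closure_minimal (hCE.trans sdiff_subset) hc.isClosed hz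
    have hp : IsPreconnected (insert z C) :=
      isPreconnected_connectedComponentIn.subset_closure (subset_insert _ _)
        (insert_subset hz subset_closure)
    exact Or.inr (hp.subset_connectedComponentIn (mem_insert_of_mem _ hwC)
      (insert_subset (show z ∈ E \ {x} from ⟨hzE, hzx⟩) hCE) (mem_insert _ _))
  have hxC : x ∈ closure C := by
    by_contra hxC
    have hCc : IsClosed C := by
      rw [← closure_eq_iff_isClosed]
      refine subset_antisymm (fun z hz => ?_) subset_closure
      rcases hcl hz with rfl | h'
      · exact absurd hz hxC
      · exact h'
    have : ∀ z ∈ C, ∃ δ > 0, E ∩ ball z δ ⊆ C := fun z hz => by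
      obtain ⟨δ, hδ, hs⟩ := h.mem_nhdsWithin_component hE (hCE hz).1 (hCE hz).2
      exact ⟨δ, hδ, hs.trans_eq (connectedComponentIn_eq hz).symm⟩
    choose! δ hδ hδC using this
    let O := ⋃ z ∈ C, ball z (δ z)
    have hO : IsOpen O := isOpen_biUnion fun _ _ => isOpen_ball
    obtain ⟨z, hz, hz1, hz2⟩ := isPreconnected_closed_iff.1 hE C Oᶜ hCc hO.isClosed_compl
      (fun z hz => by
        by_cases hzO : z ∈ O
        · simp only [O, mem_iUnion] at hzO
          obtain ⟨y, hy, hzy⟩ := hzO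
          exact Or.inl (hδC y hy ⟨hz, hzy⟩)
        · exact Or.inr hzO) ⟨w, hw.1, hwC⟩ ⟨x, hx, fun hxO => by
          simp only [O, mem_iUnion] at hxO
          obtain ⟨y, hy, hxy⟩ := hxO
          exact hxC (subset_closure (hδC y hy ⟨hx, hxy⟩))⟩
    exact hz2 (mem_biUnion hz1 (mem_ball_self (hδ z hz1)))
  have he : insert x C = closure C :=
    subset_antisymm (insert_subset hxC subset_closure) hcl
  refine ⟨?_, ?_⟩
  · rw [he]
    exact hc.of_isClosed_subset isClosed_closure
      (closure_minimal (hCE.trans sdiff_subset) hc.isClosed)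
  · rw [he]
    exact isPreconnected_connectedComponentIn.closure

theorem isArc_of_minimal (h : Nice Ω E) (hE : IsPreconnected E) (hc : IsCompact E) {a b : ℂ}
    (ha : a ∈ E) (hb : b ∈ E) (hab : a ≠ b)
    (hmin : ∀ B ⊆ E, IsCompact B → IsPreconnected B → a ∈ B → b ∈ B → B = E) : IsArc E a b := by
  let C : ℂ → Set ℂ := fun x => connectedComponentIn (E \ {x}) a
  let R : ℂ → Set ℂ := fun x => connectedComponentIn (E \ {x}) b
  let l : ℂ → Set ℂ := fun x => insert x (C x)
  have hCE : ∀ x, C x ⊆ E \ {x} := fun x => connectedComponentIn_subset _ _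
  have hRE : ∀ x, R x ⊆ E \ {x} := fun x => connectedComponentIn_subset _ _
  have haC : ∀ x, x ≠ a → a ∈ C x := fun x hx => mem_connectedComponentIn ⟨ha, hx.symm⟩
  have hbR : ∀ x, x ≠ b → b ∈ R x := fun x hx => mem_connectedComponentIn ⟨hb, hx.symm⟩
  have hal : ∀ x, a ∈ l x := fun x => by
    by_cases hx : x = a
    · exact Or.inl hx.symm
    · exact Or.inr (haC x hx)
  have hlE : ∀ x ∈ E, l x ⊆ E := fun x hx => insert_subset hx ((hCE x).trans sdiff_subset)
  have hlc : ∀ x ∈ E, IsCompact (l x) ∧ IsPreconnected (l x) := fun x hx =>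
    h.insert_component hE hc hx
  have hrc : ∀ x ∈ E, IsCompact (insert x (R x)) ∧ IsPreconnected (insert x (R x)) := fun x hx =>
    h.insert_component hE hc hx
  have hbC : ∀ x ∈ E, b ∉ C x := by
    intro x hxE hbx
    have hn := (h.diff_singleton x).component a
    obtain ⟨K, hK, hKc, hKp, haK, hbK⟩ := hn.exists_continuum isPreconnected_connectedComponentIn
      (mem_connectedComponentIn (connectedComponentIn_nonempty_iff.1 ⟨b, hbx⟩)) hbx
    have := hmin K (hK.trans ((hCE x).trans sdiff_subset)) hKc hKp haK hbK
    rw [← this] at hxE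
    exact (hCE x (hK hxE)).2 rfl
  have hbins : ∀ x, b ∈ insert x (R x) := fun x => by
    by_cases hx : x = b
    · exact Or.inl hx.symm
    · exact Or.inr (hbR x hx)
  have hun : ∀ x ∈ E, l x ∪ insert x (R x) = E := fun x hx =>
    hmin _ (union_subset (hlE x hx) (insert_subset hx ((hRE x).trans sdiff_subset)))
      ((hlc x hx).1.union (hrc x hx).1)
      (IsPreconnected.union x (mem_insert _ _) (mem_insert _ _) (hlc x hx).2 (hrc x hx).2)
      (Or.inl (hal x)) (Or.inr (hbins x))
  have hdis : ∀ x ∈ E, Disjoint (C x) (R x) := by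
    intro x hx
    rw [Set.disjoint_left]
    intro z hz hz'
    apply hbC x hx
    have h1 := connectedComponentIn_eq hz
    have h2 := connectedComponentIn_eq hz'
    have h3 : C x = R x := h1.trans h2.symm
    rw [h3]
    refine mem_connectedComponentIn (connectedComponentIn_nonempty_iff.1 ⟨z, hz'⟩)
  have hself : ∀ x, x ∉ C x := fun x hx => (hCE x hx).2 rfl
  have hlt : ∀ x ∈ E, ∀ y ∈ C x, l y ⊆ C x := by
    intro x hx y hy
    have hyE : y ∈ E := (hCE x hy).1
    have hax : a ≠ x := fun hax => by
      have := connectedComponentIn_nonempty_iff.1 ⟨y, hy⟩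
      exact this.2 hax
    refine insert_subset hy fun z hz => ?_
    by_contra hzx
    have hzE : z ∈ E := (hCE y hz).1
    have hzr : z ∈ insert x (R x) := by
      have := hun x hx ▸ hzE
      rcases this with (h1 | h1) | h1
      · exact Or.inl h1
      · exact absurd h1 hzx
      · exact h1
    have hyr : y ∉ insert x (R x) := by
      rintro (h1 | h1)
      · exact hself x (h1 ▸ hy)
      · exact Set.disjoint_left.1 (hdis x hx) hy h1
    have h1 : insert x (R x) ⊆ C y := by
      rw [show C y = connectedComponentIn (E \ {y}) z from connectedComponentIn_eq hz]
      refine (hrc x hx).2.subset_connectedComponentIn hzr fun w hw => ⟨?_, ?_⟩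
      · exact insert_subset hx ((hRE x).trans sdiff_subset) hw
      · rintro rfl
        exact hyr hw
    exact hbC y hyE (h1 (hbins x))
  have htri : ∀ x ∈ E, ∀ y ∈ E, y ∉ C x → y ≠ x → x ∈ C y := by
    intro x hx y hy hyx hne
    have : l x ⊆ C y := (hlc x hx).2.subset_connectedComponentIn (hal x) fun w hw =>
      ⟨hlE x hx hw, by
        rintro rfl
        rcases hw with h1 | h1
        · exact hne h1
        · exact hyx h1⟩
    exact this (mem_insert _ _)
  have hss : ∀ x ∈ E, ∀ y ∈ C x, l y ⊂ l x := fun x hx y hy =>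
    ⟨(hlt x hx y hy).trans (subset_insert _ _), fun h1 =>
      hself x (hlt x hx y hy (h1 (mem_insert _ _)))⟩
  let f : ℂ → ℝ := fun x => size (l x)
  have hfinj : InjOn f E := by
    intro x hx y hy hxy
    by_contra hne
    by_cases hyx : y ∈ C x
    · exact absurd hxy (size_strict ⟨a, hal y⟩ (hlc y hy).1.isClosed (hss x hx y hyx)).ne'
    · exact absurd hxy (size_strict ⟨a, hal x⟩ (hlc x hx).1.isClosed
        (hss y hy x (htri x hx y hy hyx (Ne.symm hne)))).ne
  have hdiff : ∀ x ∈ E, ∀ y ∈ E, ∀ K ⊆ E, IsPreconnected K → x ∈ K → y ∈ K → l x \ l y ⊆ K := by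
    intro x hx y hy K hKE hK hxK hyK z hz
    by_contra hzK
    have hzE : z ∈ E := hlE x hx hz.1
    have hzx : z ≠ x := fun h1 => hzK (h1 ▸ hxK)
    have hzy : z ≠ y := fun h1 => hzK (h1 ▸ hyK)
    have hzC : z ∈ C x := hz.1.resolve_left hzx
    have hyz : y ∈ C z := htri y hy z hzE (fun h1 => hz.2 (Or.inr h1)) hzy
    have h1 : K ⊆ C z := by
      rw [show C z = connectedComponentIn (E \ {z}) y from connectedComponentIn_eq hyz]
      exact hK.subset_connectedComponentIn hyK fun w hw => ⟨hKE hw, by rintro rfl; exact hzK hw⟩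
    exact hself z (hlt z hzE x (h1 hxK) (Or.inr hzC))
  have hfc : ContinuousOn f E := by
    intro x hx
    rw [Metric.continuousWithinAt_iff]
    intro ε hε
    obtain ⟨r, hr, hrΩ⟩ := Metric.nhds_basis_closedBall.mem_iff.1 (h.isOpen.mem_nhds (h.sub hx))
    have hr' : 0 < min r (ε / 8) := lt_min hr (by linarith)
    obtain ⟨K, h1, h2, h3, h4, δ, hδ, h5⟩ := h.exists_local hE hx hr'
      ((closedBall_subset_closedBall (min_le_left _ _)).trans hrΩ)
    refine ⟨δ, hδ, fun y hy hyx => ?_⟩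
    have hyK : y ∈ K := h5 ⟨hy, hyx⟩
    have := abs_size_sub_le_of_subset (x := x) (y := y) (S := l x) (T := l y) (K := K)
      (mem_insert _ _) (mem_insert _ _) (h4 hyK).2 (fun w hw => (h4 hw).2)
      (hdiff x hx y hy K (fun w hw => (h4 hw).1) h2 h3 hyK)
      (hdiff y hy x hx K (fun w hw => (h4 hw).1) h2 hyK h3)
    rw [dist_comm, Real.dist_eq]
    have := min_le_right r (ε / 8)
    linarith
  have hla : l a = {a} := by
    simp only [l, C]
    rw [connectedComponentIn_eq_empty (by simp)]
    simp
  have hfa : ∀ x ∈ E, f a ≤ f x := fun x hx => by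
    refine size_mono ⟨a, hal a⟩ ?_
    rw [hla]
    simpa using hal x
  have hlb : l b = E := by
    refine hmin _ (hlE b hb) (hlc b hb).1 (hlc b hb).2 (hal b) (mem_insert _ _)
  have hfb : ∀ x ∈ E, f x ≤ f b := fun x hx => by
    refine size_mono ⟨a, hal x⟩ ?_
    rw [hlb]
    exact hlE x hx
  have hfE : f '' E = Icc (f a) (f b) := by
    apply subset_antisymm
    · rintro _ ⟨x, hx, rfl⟩
      exact ⟨hfa x hx, hfb x hx⟩
    · exact (hE.image f hfc).ordConnected.out ⟨a, ha, rfl⟩ ⟨b, hb, rfl⟩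
  have hfab : f a < f b := lt_of_le_of_ne (hfa b hb) fun h1 => hab (hfinj ha hb h1)
  have hli : LeftInvOn (Function.invFunOn f E) f E := hfinj.leftInvOn_invFunOn
  have hgc := continuousOn_leftInv_image hc hfc hli
  rw [hfE] at hgc
  have hg : InjOn (Function.invFunOn f E) (Icc (f a) (f b)) := by
    rw [← hfE]
    rintro _ ⟨x, hx, rfl⟩ _ ⟨y, hy, rfl⟩ hxy
    rw [hli hx, hli hy] at hxy
    rw [hxy]
  have := IsArc.of_param hfab hgc hg
  rw [hli ha, hli hb, ← hfE, hli.image_image] at this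
  exact this

/-- Nice connected sets are arcwise connected. -/
theorem exists_isArc (h : Nice Ω E) (hE : IsPreconnected E) {a b : ℂ} (ha : a ∈ E)
    (hb : b ∈ E) (hab : a ≠ b) : ∃ A ⊆ E, IsArc A a b := by
  obtain ⟨A, hAE, hA, hAp, haA, hbA, hmin⟩ := h.exists_minimal_continuum hE ha hb
  exact ⟨A, hAE, (h.of_isCompact hAE hA).isArc_of_minimal hAp hA haA hbA hab hmin⟩

end Nice

end

section

namespace IsArc

variable {A : Set ℂ} {a b : ℂ}

theorem split (h : IsArc A a b) {w : ℂ} (hw : w ∈ A) (hwa : w ≠ a) (hwb : w ≠ b) :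
    ∃ A₁ A₂, IsArc A₁ a w ∧ IsArc A₂ w b ∧ A₁ ∪ A₂ = A ∧ A₁ ∩ A₂ = {w} := by
  obtain ⟨γ, f, hγ, hf, rfl, rfl, h1, h2⟩ := h.exists_coord
  have hs := (h2 w hw).1
  set s := f w with hsdef
  have hγs : γ s = w := (h2 w hw).2
  have hinj : InjOn γ (Icc 0 1) := fun x hx y hy hxy => by
    rw [← (h1 x hx).2, ← (h1 y hy).2, hxy]
  have hs0 : 0 < s := lt_of_le_of_ne hs.1 fun h0 => hwa (by rw [← hγs, ← h0])
  have hs1 : s < 1 := lt_of_le_of_ne hs.2 fun h0 => hwb (by rw [← hγs, h0])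
  refine ⟨γ '' Icc 0 s, γ '' Icc s 1, ?_, ?_, ?_, ?_⟩
  · have := IsArc.of_param hs0 hγ.continuousOn (hinj.mono (Icc_subset_Icc_right hs.2))
    rwa [hγs] at this
  · have := IsArc.of_param hs1 hγ.continuousOn (hinj.mono (Icc_subset_Icc_left hs.1))
    rwa [hγs] at this
  · rw [← image_union, Icc_union_Icc_eq_Icc hs.1 hs.2]
    apply subset_antisymm
    · rintro _ ⟨t, ht, rfl⟩
      exact (h1 t ht).1
    · exact fun z hz => ⟨f z, h2 z hz⟩
  · rw [← hinj.image_inter (Icc_subset_Icc_right hs.2) (Icc_subset_Icc_left hs.1)]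
    rw [Icc_inter_Icc_eq_singleton hs.1 hs.2, image_singleton, hγs]

theorem subarc (h : IsArc A a b) {u v : ℂ} (hu : u ∈ A) (hv : v ∈ A) (huv : u ≠ v) :
    ∃ B ⊆ A, IsArc B u v := by
  obtain ⟨γ, f, hγ, hf, rfl, rfl, h1, h2⟩ := h.exists_coord
  have hinj : InjOn γ (Icc 0 1) := fun x hx y hy hxy => by
    rw [← (h1 x hx).2, ← (h1 y hy).2, hxy]
  wlog hlt : f u < f v generalizing u v
  · have hne : f u ≠ f v := fun h0 => huv (by rw [← (h2 u hu).2, h0, (h2 v hv).2])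
    obtain ⟨B, hB, hB'⟩ := this hv hu huv.symm (lt_of_le_of_ne (not_lt.1 hlt) hne.symm)
    exact ⟨B, hB, hB'.symm⟩
  have hsub : Icc (f u) (f v) ⊆ Icc 0 1 := Icc_subset_Icc (h2 u hu).1.1 (h2 v hv).1.2
  refine ⟨γ '' Icc (f u) (f v), ?_, ?_⟩
  · rintro _ ⟨t, ht, rfl⟩
    exact (h1 t (hsub ht)).1
  · have := IsArc.of_param hlt hγ.continuousOn (hinj.mono hsub)
    rwa [(h2 u hu).2, (h2 v hv).2] at this

theorem exists_first_hit_split (h : IsArc A a b) {T : Set ℂ} (hT : IsClosed T) (ha : a ∉ T)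
    (hb : b ∈ T) : ∃ w ∈ T, ∃ B D, IsArc B a w ∧ B ∩ T = {w} ∧ IsCompact D ∧ B ∪ D = A ∧
      B ∩ D = {w} := by
  obtain ⟨γ, f, hγ, hf, rfl, rfl, h1, h2⟩ := h.exists_coord
  have hinj : InjOn γ (Icc 0 1) := fun x hx y hy hxy => by
    rw [← (h1 x hx).2, ← (h1 y hy).2, hxy]
  obtain ⟨s, ⟨hs, hsT⟩, hmin⟩ := (isCompact_Icc.inter_right (hT.preimage hγ)).exists_isLeast
    (⟨1, ⟨zero_le_one, le_rfl⟩, hb⟩ : (Icc (0:ℝ) 1 ∩ γ ⁻¹' T).Nonempty)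
  have hs0 : 0 < s := lt_of_le_of_ne hs.1 fun h0 => ha (h0 ▸ hsT)
  have hsub : Icc 0 s ⊆ Icc 0 1 := Icc_subset_Icc_right hs.2
  refine ⟨γ s, hsT, γ '' Icc 0 s, γ '' Icc s 1,
    IsArc.of_param hs0 hγ.continuousOn (hinj.mono hsub), ?_, isCompact_Icc.image hγ, ?_, ?_⟩
  · apply subset_antisymm
    · rintro _ ⟨⟨t, ht, rfl⟩, htT⟩
      rw [ht.2.antisymm (hmin ⟨hsub ht, htT⟩)]; rfl
    · rintro _ rfl
      exact ⟨⟨s, ⟨hs.1, le_rfl⟩, rfl⟩, hsT⟩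
  · rw [← image_union, Icc_union_Icc_eq_Icc hs.1 hs.2]
    apply subset_antisymm
    · rintro _ ⟨t, ht, rfl⟩
      exact (h1 t ht).1
    · exact fun z hz => ⟨f z, h2 z hz⟩
  · rw [← hinj.image_inter hsub (Icc_subset_Icc_left hs.1), Icc_inter_Icc_eq_singleton hs.1 hs.2,
      image_singleton]

theorem exists_first_hit (h : IsArc A a b) {T : Set ℂ} (hT : IsClosed T) (ha : a ∉ T)
    (hb : b ∈ T) : ∃ w ∈ T, ∃ B ⊆ A, IsArc B a w ∧ B ∩ T = {w} := by
  obtain ⟨w, hw, B, D, hB, hBT, -, hU, -⟩ := h.exists_first_hit_split hT ha hb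
  exact ⟨w, hw, B, hU ▸ subset_union_left, hB, hBT⟩

end IsArc

theorem FewHits.no_triod {Ω E : Set ℂ} (h : FewHits Ω E) (hΩ : IsOpen Ω) (hE : E ⊆ Ω) {w : ℂ}
    {M : Fin 3 → Set ℂ} (hM : ∀ i, M i ⊆ E) (hc : ∀ i, IsCompact (M i))
    (hp : ∀ i, IsPreconnected (M i)) (hw : ∀ i, w ∈ M i) (hne : ∀ i, ∃ m ∈ M i, m ≠ w)
    (hd : ∀ i j, i ≠ j → M i ∩ M j ⊆ {w}) : False := by
  choose m hm hmw using hne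
  obtain ⟨r, hr, hrΩ⟩ := Metric.nhds_basis_closedBall.mem_iff.1
    (hΩ.mem_nhds (hE (hM 0 (hw 0))))
  obtain ⟨d, hd0, hdr, hdm⟩ : ∃ d > 0, d ≤ r ∧ ∀ i, d ≤ dist (m i) w := by
    refine ⟨min r (min (dist (m 0) w) (min (dist (m 1) w) (dist (m 2) w))), ?_, min_le_left _ _, ?_⟩
    · simp [hr, hmw]
    · intro i
      fin_cases i <;> simp
  obtain ⟨x, hx1, hx2⟩ := exists_rat_btwn (show w.re - d / 16 < w.re by linarith)
  obtain ⟨y, hy1, hy2⟩ := exists_rat_btwn (show w.im - d / 16 < w.im by linarith)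
  obtain ⟨s, hs1, hs2⟩ := exists_rat_btwn (show d / 4 < d / 2 by linarith)
  set c : ℂ := ⟨x, y⟩ with hcdef
  have hwc : dist w c ≤ d / 8 := by
    rw [Complex.dist_eq]
    refine (Complex.norm_le_abs_re_add_abs_im _).trans ?_
    have h1 : |(w - c).re| ≤ d / 16 := by
      rw [abs_le]; constructor <;> simp [hcdef] <;> linarith
    have h2 : |(w - c).im| ≤ d / 16 := by
      rw [abs_le]; constructor <;> simp [hcdef] <;> linarith
    linarith
  have hs0 : (0 : ℝ) < s := by linarith
  have hsub : closedBall c (s : ℝ) ⊆ Ω := by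
    intro z hz
    apply hrΩ
    rw [mem_closedBall] at hz ⊢
    have := dist_triangle_right z w c
    linarith
  have hwb : ∀ i, w ∈ M i ∩ closedBall c (s : ℝ) := fun i => ⟨hw i, by
    rw [mem_closedBall]; linarith⟩
  have key : ∀ i, (connectedComponentIn (M i ∩ closedBall c (s : ℝ)) w ∩ sphere c s).Nonempty :=
    fun i => component_meets_sphere ((hc i).inter_right isClosed_closedBall) (hp i)
      (fun hsub' => by
        have h1 := hsub' (hm i)
        rw [mem_closedBall] at h1
        have := dist_triangle_right (m i) w c
        have := hdm i
        linarith) (hwb i)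
  choose q hq using key
  set K : Fin 3 → Set ℂ := fun i => connectedComponentIn (M i ∩ closedBall c (s : ℝ)) w
  have hKs : ∀ i, K i ⊆ M i ∩ closedBall c (s : ℝ) := fun i => connectedComponentIn_subset _ _
  have hKc : ∀ i, IsCompact (K i) := fun i =>
    isCompact_component ((hc i).inter_right isClosed_closedBall) w
  have hKw : ∀ i, w ∈ K i := fun i => mem_connectedComponentIn (hwb i)
  have hne : ∀ i j, i ≠ j → q i ≠ q j := by
    intro i j hij hqq
    have h1 : q i = w := hd i j hij ⟨(hKs i (hq i).1).1, hqq ▸ (hKs j (hq j).1).1⟩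
    have h2 := (hq i).2
    rw [h1, mem_sphere] at h2
    linarith
  have hq' : ∀ i, q i ∈ (⋃ i, K i) ∩ sphere c (s : ℝ) := fun i =>
    ⟨mem_iUnion_of_mem i (hq i).1, (hq i).2⟩
  rcases h x y s (by exact_mod_cast hs0) hsub (⋃ i, K i) (isCompact_iUnion hKc)
    (isPreconnected_iUnion ⟨w, mem_iInter.2 hKw⟩ fun i => isPreconnected_connectedComponentIn)
    (iUnion_subset fun i => (hKs i).trans (inter_subset_inter_left _ (hM i)))
    (q 0) (hq' 0) (q 1) (hq' 1) (q 2) (hq' 2) with h1 | h1 | h1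
  · exact hne 0 1 (by decide) h1
  · exact hne 1 2 (by decide) h1
  · exact hne 0 2 (by decide) h1

theorem FewHits.no_arc_triod {Ω E : Set ℂ} (h : FewHits Ω E) (hΩ : IsOpen Ω) (hE : E ⊆ Ω)
    {w a b c : ℂ} {A B C : Set ℂ} (hA : A ⊆ E) (hB : B ⊆ E) (hC : C ⊆ E) (hA' : IsArc A a w)
    (hB' : IsArc B b w) (hC' : IsArc C c w) (hAB : A ∩ B ⊆ {w}) (hBC : B ∩ C ⊆ {w})
    (hAC : A ∩ C ⊆ {w}) : False := by
  refine h.no_triod (M := ![A, B, C]) hΩ hE (w := w) ?_ ?_ ?_ ?_ ?_ ?_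
  · intro i; fin_cases i <;> assumption
  · intro i; fin_cases i <;> simp [hA'.isCompact, hB'.isCompact, hC'.isCompact]
  · intro i
    fin_cases i
    exacts [hA'.isConnected.isPreconnected, hB'.isConnected.isPreconnected,
      hC'.isConnected.isPreconnected]
  · intro i
    fin_cases i
    exacts [hA'.right_mem, hB'.right_mem, hC'.right_mem]
  · intro i
    fin_cases i
    exacts [⟨a, hA'.left_mem, hA'.ne⟩, ⟨b, hB'.left_mem, hB'.ne⟩, ⟨c, hC'.left_mem, hC'.ne⟩]
  · intro i j hij
    fin_cases i <;> fin_cases j <;>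
      first | exact absurd rfl hij | assumption | (rw [inter_comm]; assumption)

namespace Nice

variable {Ω E : Set ℂ}

/-- Interior points of an arc are interior relative to the ambient nice set. -/
theorem arc_isOpen (h : Nice Ω E) (hE : IsPreconnected E) (hf : FewHits Ω E) {A : Set ℂ} {a b x : ℂ}
    (hA : IsArc A a b) (hAE : A ⊆ E) (hx : x ∈ A) (hxa : x ≠ a) (hxb : x ≠ b) :
    ∃ δ > 0, E ∩ ball x δ ⊆ A := by
  obtain ⟨r, hr, hrΩ⟩ := Metric.nhds_basis_closedBall.mem_iff.1
    ((h.isOpen.sdiff (Set.toFinite {a, b}).isClosed).mem_nhds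
      (show x ∈ Ω \ {a, b} from ⟨h.sub (hAE hx), by simp [hxa, hxb]⟩))
  obtain ⟨K, h1, h2, h3, h4, δ, hδ, h5⟩ := h.exists_local hE (hAE hx) hr (hrΩ.trans sdiff_subset)
  refine ⟨δ, hδ, fun z hz => ?_⟩
  by_contra hzA
  have hzK := h5 hz
  have hKE : K ⊆ E := fun w hw => (h4 hw).1
  obtain ⟨B, hBK, hB⟩ := (h.of_isCompact hKE h1).exists_isArc h2 hzK h3
    (fun h0 => hzA (h0 ▸ hx))
  obtain ⟨w, hw, B', hB'B, hB', hB'A⟩ := hB.exists_first_hit hA.isCompact.isClosed hzA hx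
  have hwΩ := hrΩ (h4 (hBK (hB'B hB'.right_mem))).2
  obtain ⟨A₁, A₂, hA₁, hA₂, hU, hI⟩ := hA.split hw (fun h0 => hwΩ.2 (by simp [h0]))
    (fun h0 => hwΩ.2 (by simp [h0]))
  have hs1 : A₁ ⊆ A := hU ▸ subset_union_left
  have hs2 : A₂ ⊆ A := hU ▸ subset_union_right
  refine hf.no_arc_triod h.isOpen h.sub (hs1.trans hAE) (hs2.trans hAE) (hB'B.trans (hBK.trans hKE))
    hA₁ hA₂.symm hB' hI.subset ?_ ?_
  · rw [← hB'A, inter_comm]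
    exact inter_subset_inter_right _ hs2
  · rw [← hB'A, inter_comm]
    exact inter_subset_inter_right _ hs1

end Nice

end

section

/-- Two arcs with exactly their endpoints in common form a Jordan curve. -/
theorem isJordanCurve_union {A B : Set ℂ} {a b : ℂ} (hA : IsArc A a b) (hB : IsArc B a b)
    (hAB : A ∩ B ⊆ {a, b}) : IsJordanCurve (A ∪ B) := by
  obtain ⟨γ, f, hγ, -, rfl, rfl, h1, h2⟩ := hA.exists_coord
  obtain ⟨η, g, hη, -, h30, h31, h3, h4⟩ := hB.exists_coord
  let k : ℝ × ℝ → ℝ := fun p => (1 + p.1 / (|p.1| + |p.2|)) / 2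
  have hsph : ∀ p ∈ sphere (0 : ℝ × ℝ) 1, max |p.1| |p.2| = 1 := fun p hp => by
    rw [mem_sphere_zero_iff_norm, Prod.norm_def] at hp
    simpa using hp
  have hpos : ∀ p ∈ sphere (0 : ℝ × ℝ) 1, 0 < |p.1| + |p.2| := fun p hp => by
    have h0 := hsph p hp
    rcases max_choice |p.1| |p.2| with h5 | h5 <;> rw [h5] at h0
    · have := abs_nonneg p.2; linarith
    · have := abs_nonneg p.1; linarith
  have hk : ∀ p ∈ sphere (0 : ℝ × ℝ) 1, k p ∈ Icc (0:ℝ) 1 := fun p hp => by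
    have h0 := hpos p hp
    have h5 : |p.1 / (|p.1| + |p.2|)| ≤ 1 := by
      rw [abs_div, abs_of_pos h0, div_le_one h0]
      have := abs_nonneg p.2; linarith
    rw [abs_le] at h5
    constructor <;> simp only [k] <;> linarith
  have hkc : ContinuousOn k (sphere (0 : ℝ × ℝ) 1) := by
    refine ContinuousOn.div_const (continuousOn_const.add (ContinuousOn.div (by fun_prop)
      (by fun_prop) fun p hp => (hpos p hp).ne')) _
  have h0k : ∀ p ∈ sphere (0 : ℝ × ℝ) 1, p.2 = 0 → γ (k p) = η (k p) := by
    intro p hp h0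
    have h5 := hsph p hp
    rw [h0, abs_zero, max_eq_left (abs_nonneg _)] at h5
    have h6 : k p = (1 + p.1) / 2 := by simp [k, h0, h5]
    rcases (abs_eq zero_le_one).1 h5 with h7 | h7 <;> rw [h6, h7]
    · norm_num [h31]
    · norm_num [h30]
  have hkeq : ∀ p ∈ sphere (0 : ℝ × ℝ) 1, ∀ q ∈ sphere (0 : ℝ × ℝ) 1, 0 ≤ p.2 * q.2 →
      k p = k q → (p.2 = 0 → q.2 = 0) → p = q := by
    intro p hp q hq hpq hk0 h00
    have hp0 := hpos p hp
    have hq0 := hpos q hq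
    have e1 : p.1 / (|p.1| + |p.2|) = q.1 / (|q.1| + |q.2|) := by
      simp only [k] at hk0; linarith
    set s := |p.1| + |p.2|
    set t := |q.1| + |q.2|
    have e2 : p.1 = (s / t) * q.1 := by
      field_simp at e1 ⊢; linarith
    have hst : 0 < s / t := div_pos hp0 hq0
    have e3 : |p.2| = (s / t) * |q.2| := by
      have : |p.1| = (s / t) * |q.1| := by rw [e2, abs_mul, abs_of_pos hst]
      have h6 : (s / t) * t = s := by field_simp
      have h7 : s = |p.1| + |p.2| := rfl
      have h8 : t = |q.1| + |q.2| := rfl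
      rw [h8, mul_add, ← this] at h6
      linarith
    have e4 : s / t = 1 := by
      have h9 := hsph p hp
      rw [e3, show |p.1| = (s / t) * |q.1| by rw [e2, abs_mul, abs_of_pos hst],
        ← mul_max_of_nonneg _ _ hst.le, hsph q hq, mul_one] at h9
      exact h9
    rw [e4, one_mul] at e2 e3
    refine Prod.ext e2 ?_
    rcases abs_eq_abs.1 e3 with h9 | h9
    · exact h9
    · have : q.2 = 0 := by nlinarith
      rw [h9, this, neg_zero]
  have hks : ∀ t ∈ Icc (0:ℝ) 1, ∃ p ∈ sphere (0 : ℝ × ℝ) 1, 0 ≤ p.2 ∧ k p = t := by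
    intro t ht
    set x := 2 * t - 1
    have hx : |x| ≤ 1 := abs_le.2 ⟨by simp only [x]; linarith [ht.1], by simp only [x]; linarith [ht.2]⟩
    set m := max |x| (1 - |x|)
    have hm : 0 < m := by
      rcases lt_or_ge 0 |x| with h0 | h0
      · exact lt_max_of_lt_left h0
      · refine lt_max_of_lt_right ?_; linarith
    have hy : 0 ≤ 1 - |x| := by linarith
    refine ⟨(x / m, (1 - |x|) / m), ?_, by positivity, ?_⟩
    · rw [mem_sphere_zero_iff_norm, Prod.norm_def]
      simp only [Real.norm_eq_abs, abs_div, abs_of_pos hm, abs_of_nonneg hy]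
      rw [max_div_div_right hm.le]
      exact div_self hm.ne'
    · simp only [k, abs_div, abs_of_pos hm, abs_of_nonneg hy]
      rw [← add_div, add_sub_cancel, div_div_div_cancel_right₀ hm.ne', div_one]
      simp only [x]; ring
  let F : ↥(sphere (0 : ℝ × ℝ) 1) → ↥(A ∪ B) := fun p =>
    if h : 0 ≤ p.1.2 then ⟨γ (k p), Or.inl (h1 _ (hk p p.2)).1⟩
    else ⟨η (k p), Or.inr (h3 _ (hk p p.2)).1⟩
  have hF1 : ∀ p : ↥(sphere (0 : ℝ × ℝ) 1), 0 ≤ p.1.2 → (F p : ℂ) = γ (k p) := fun p hp => by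
    simp only [F, dif_pos hp]
  have hF2 : ∀ p : ↥(sphere (0 : ℝ × ℝ) 1), p.1.2 ≤ 0 → (F p : ℂ) = η (k p) := fun p hp => by
    rcases hp.lt_or_eq with hp | hp
    · simp only [F, dif_neg (not_le.2 hp)]
    · rw [hF1 p hp.ge, h0k p p.2 hp]
  have hkc' : Continuous fun p : ↥(sphere (0 : ℝ × ℝ) 1) => k p := continuousOn_iff_continuous_domRestrict.1 hkc
  have hFc : Continuous F := by
    rw [Topology.IsInducing.subtypeVal.continuous_iff]
    have : (Subtype.val ∘ F) = fun p : ↥(sphere (0 : ℝ × ℝ) 1) =>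
        if 0 ≤ p.1.2 then γ (k p) else η (k p) := by
      funext p
      simp only [Function.comp]
      split_ifs with h0
      · exact hF1 p h0
      · exact hF2 p (not_le.1 h0).le
    rw [this]
    refine Continuous.if_le (hγ.comp hkc') (hη.comp hkc') continuous_const (by fun_prop) ?_
    intro p hp
    exact h0k p p.2 hp.symm
  have hFi : Function.Injective F := by
    have main : ∀ p q : ↥(sphere (0 : ℝ × ℝ) 1), F p = F q → 0 ≤ p.1.2 → p = q := by
      intro p q hpq hp
      have hpq' : (F p : ℂ) = F q := congrArg _ hpq
      have hpp := hk p p.2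
      have hqq := hk q q.2
      rcases le_total 0 q.1.2 with hq | hq
      · rw [hF1 p hp, hF1 q hq] at hpq'
        have hkk : k p = k q := by rw [← (h1 _ hpp).2, hpq', (h1 _ hqq).2]
        by_cases h0 : p.1.2 = 0 → q.1.2 = 0
        · exact Subtype.ext (hkeq p p.2 q q.2 (mul_nonneg hp hq) hkk h0)
        · push Not at h0
          exact (Subtype.ext (hkeq q q.2 p p.2 (mul_nonneg hq hp) hkk.symm
            (fun h => absurd h h0.2))).symm
      · rw [hF1 p hp, hF2 q hq] at hpq'
        have hkk : k p = k q := by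
          have hm := hAB ⟨(h1 _ hpp).1, hpq' ▸ (h3 _ hqq).1⟩
          rcases hm with hm | hm
          · have e1 : k p = 0 := by rw [← (h1 _ hpp).2, hm, (h1 0 (by simp)).2]
            have e2 : k q = 0 := by rw [← (h3 _ hqq).2, ← hpq', hm, ← h30, (h3 0 (by simp)).2]
            rw [e1, e2]
          · rw [mem_singleton_iff] at hm
            have e1 : k p = 1 := by rw [← (h1 _ hpp).2, hm, (h1 1 (by simp)).2]
            have e2 : k q = 1 := by rw [← (h3 _ hqq).2, ← hpq', hm, ← h31, (h3 1 (by simp)).2]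
            rw [e1, e2]
        have hend : k p = 0 ∨ k p = 1 := by
          rcases hAB ⟨(h1 _ hpp).1, hpq' ▸ (h3 _ hqq).1⟩ with hm | hm
          · left; rw [← (h1 _ hpp).2, hm, (h1 0 (by simp)).2]
          · right
            rw [mem_singleton_iff] at hm
            rw [← (h1 _ hpp).2, hm, (h1 1 (by simp)).2]
        have hz : ∀ p : ↥(sphere (0 : ℝ × ℝ) 1), k p = 0 ∨ k p = 1 → p.1.2 = 0 := by
          intro p hp
          have h5 := hpos p p.2
          have h6 : |p.1.1 / (|p.1.1| + |p.1.2|)| = 1 := by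
            rcases hp with hp | hp <;> simp only [k] at hp
            · rw [show p.1.1 / (|p.1.1| + |p.1.2|) = -1 by linarith]; simp
            · rw [show p.1.1 / (|p.1.1| + |p.1.2|) = 1 by linarith]; simp
          rw [abs_div, abs_of_pos h5, div_eq_one_iff_eq h5.ne'] at h6
          exact abs_eq_zero.1 (by linarith)
        have hp0 := hz p hend
        have hq0 := hz q (hkk ▸ hend)
        exact Subtype.ext (hkeq p p.2 q q.2 (by rw [hp0]; simp) hkk fun _ => hq0)
    intro p q hpq
    rcases le_total 0 p.1.2 with hp | hp
    · exact main p q hpq hp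
    rcases le_total 0 q.1.2 with hq | hq
    · exact (main q p hpq.symm hq).symm
    have hpq' : (F p : ℂ) = F q := congrArg _ hpq
    have hpp := hk p p.2
    have hqq := hk q q.2
    rw [hF2 p hp, hF2 q hq] at hpq'
    have hkk : k p = k q := by rw [← (h3 _ hpp).2, hpq', (h3 _ hqq).2]
    by_cases h0 : p.1.2 = 0 → q.1.2 = 0
    · exact Subtype.ext (hkeq p p.2 q q.2 (mul_nonneg_of_nonpos_of_nonpos hp hq) hkk h0)
    · push Not at h0
      exact (Subtype.ext (hkeq q q.2 p p.2 (mul_nonneg_of_nonpos_of_nonpos hq hp) hkk.symm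
        (fun h => absurd h h0.2))).symm
  have hFs : Function.Surjective F := by
    rintro ⟨z, hz | hz⟩
    · obtain ⟨p, hp, hp2, hpk⟩ := hks _ (h2 z hz).1
      refine ⟨⟨p, hp⟩, Subtype.ext ?_⟩
      rw [hF1 _ hp2]
      simp only [hpk, (h2 z hz).2]
    · obtain ⟨p, hp, hp2, hpk⟩ := hks _ (h4 z hz).1
      have hp' : (p.1, -p.2) ∈ sphere (0 : ℝ × ℝ) 1 := by
        rw [mem_sphere_zero_iff_norm, Prod.norm_def] at hp ⊢
        simpa using hp
      refine ⟨⟨(p.1, -p.2), hp'⟩, Subtype.ext ?_⟩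
      rw [hF2 _ (by simpa using hp2)]
      have : k (p.1, -p.2) = k p := by simp [k]
      simp only [this, hpk, (h4 z hz).2]
  exact ⟨(hFc.homeoOfEquivCompactToT2 (f := Equiv.ofBijective F ⟨hFi, hFs⟩))⟩

end

section

theorem homeoToInterval_of_injOn {E : Set ℂ} (hE : IsConnected E)
    (harc : ∀ a ∈ E, ∀ b ∈ E, a ≠ b → ∃ A ⊆ E, IsArc A a b) {F : ℂ → ℝ} (hF : ContinuousOn F E)
    (hi : InjOn F E) : HomeoToInterval E := by
  set G := Function.invFunOn F E with hG
  have hl : LeftInvOn G F E := hi.leftInvOn_invFunOn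
  have hoc : (F '' E).OrdConnected := (hE.isPreconnected.image F hF).ordConnected
  have hIcc : ∀ a ∈ E, ∀ b ∈ E, F a ≤ F b → ContinuousOn G (Icc (F a) (F b)) := by
    intro a ha b hb hab
    by_cases heq : a = b
    · rw [heq, Icc_self]; exact continuousOn_singleton _ _
    obtain ⟨A, hAE, hA⟩ := harc a ha b hb heq
    have h1 := continuousOn_leftInv_image hA.isCompact (hF.mono hAE) (hl.mono hAE)
    exact h1.mono ((hA.isConnected.isPreconnected.image F (hF.mono hAE)).ordConnected.out
      ⟨a, hA.left_mem, rfl⟩ ⟨b, hA.right_mem, rfl⟩)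
  have hGc : ContinuousOn G (F '' E) := by
    rintro _ ⟨x, hx, rfl⟩
    obtain ⟨a, ha, hax, ha'⟩ : ∃ a ∈ E, F a ≤ F x ∧ ∀ᶠ t in nhdsWithin (F x) (F '' E), F a ≤ t := by
      by_cases h : ∃ a ∈ E, F a < F x
      · obtain ⟨a, ha, hax⟩ := h
        exact ⟨a, ha, hax.le, nhdsWithin_le_nhds (eventually_ge_nhds hax)⟩
      · push Not at h
        refine ⟨x, hx, le_rfl, ?_⟩
        filter_upwards [self_mem_nhdsWithin]
        rintro _ ⟨y, hy, rfl⟩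
        exact h y hy
    obtain ⟨b, hb, hbx, hb'⟩ : ∃ b ∈ E, F x ≤ F b ∧ ∀ᶠ t in nhdsWithin (F x) (F '' E), t ≤ F b := by
      by_cases h : ∃ a ∈ E, F x < F a
      · obtain ⟨a, ha, hax⟩ := h
        exact ⟨a, ha, hax.le, nhdsWithin_le_nhds (eventually_le_nhds hax)⟩
      · push Not at h
        refine ⟨x, hx, le_rfl, ?_⟩
        filter_upwards [self_mem_nhdsWithin]
        rintro _ ⟨y, hy, rfl⟩
        exact h y hy
    refine (hIcc a ha b hb (hax.trans hbx) (F x) ⟨hax, hbx⟩).mono_of_mem_nhdsWithin ?_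
    filter_upwards [ha', hb'] with t h1 h2 using ⟨h1, h2⟩
  refine ⟨F '' E, hoc, hE.nonempty.image F, ⟨?_⟩⟩
  exact
    { toFun := fun t => ⟨G t, Function.invFunOn_mem t.2⟩
      invFun := fun x => ⟨F x, mem_image_of_mem F x.2⟩
      left_inv := fun t => Subtype.ext (Function.invFunOn_eq t.2)
      right_inv := fun x => Subtype.ext (hl x.2)
      continuous_toFun := (continuousOn_iff_continuous_domRestrict.1 hGc).subtype_mk _
      continuous_invFun := (continuousOn_iff_continuous_domRestrict.1 hF).subtype_mk _ }

namespace Nice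

variable {Ω E : Set ℂ}

theorem isJordanCurve_of_loop (h : Nice Ω E) (hE : IsPreconnected E) (hf : FewHits Ω E)
    {A : Set ℂ} {x y p : ℂ} (hA : IsArc A x y) (hAE : A ⊆ E) (hp : p ∈ A) (hpx : p ≠ x)
    (hpy : p ≠ y) (hy : y ∈ connectedComponentIn (E \ {p}) x) : IsJordanCurve E := by
  obtain ⟨B, hBD, hB⟩ := ((h.diff_singleton p).component x).exists_isArc
    isPreconnected_connectedComponentIn
    (mem_connectedComponentIn (connectedComponentIn_nonempty_iff.1 ⟨y, hy⟩)) hy hA.ne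
  have hBE : B ⊆ E \ {p} := hBD.trans (connectedComponentIn_subset _ _)
  have hpB : p ∉ B := fun h1 => (hBE h1).2 rfl
  obtain ⟨A₁, A₂, hA₁, hA₂, hU, hI⟩ := hA.split hp hpx hpy
  have hs1 : A₁ ⊆ A := hU ▸ subset_union_left
  have hs2 : A₂ ⊆ A := hU ▸ subset_union_right
  obtain ⟨u, hu, P₁, hP₁A, hP₁, hP₁B⟩ := hA₁.symm.exists_first_hit hB.isCompact.isClosed hpB
    hB.left_mem
  obtain ⟨v, hv, P₂, hP₂A, hP₂, hP₂B⟩ := hA₂.exists_first_hit hB.isCompact.isClosed hpB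
    hB.right_mem
  have hPP : P₁ ∩ P₂ ⊆ {p} := (inter_subset_inter hP₁A hP₂A).trans hI.subset
  have huv : u ≠ v := by
    rintro rfl
    have : u = p := hPP ⟨hP₁.right_mem, hP₂.right_mem⟩
    exact hpB (this ▸ hu)
  have hP : IsArc (P₁ ∪ P₂) u v := hP₁.symm.union hP₂ hPP
  obtain ⟨B', hB'B, hB'⟩ := hB.subarc hu hv huv
  have hPB : (P₁ ∪ P₂) ∩ B' ⊆ {u, v} := by
    rintro z ⟨hz | hz, hzB⟩
    · exact Or.inl (hP₁B.subset ⟨hz, hB'B hzB⟩)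
    · exact Or.inr (hP₂B.subset ⟨hz, hB'B hzB⟩)
  have hP₁E : P₁ ⊆ E := hP₁A.trans (hs1.trans hAE)
  have hP₂E : P₂ ⊆ E := hP₂A.trans (hs2.trans hAE)
  have hPE : P₁ ∪ P₂ ⊆ E := union_subset hP₁E hP₂E
  have hB'E : B' ⊆ E := hB'B.trans (hBE.trans sdiff_subset)
  set J := (P₁ ∪ P₂) ∪ B' with hJ
  have hJE : J ⊆ E := union_subset hPE hB'E
  have hJc : IsCompact J := hP.isCompact.union hB'.isCompact
  have hup : u ≠ p := hP₁.ne.symm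
  have hvp : v ≠ p := hP₂.ne.symm
  obtain ⟨b', hb', hb'u, hb'v⟩ : ∃ b ∈ B', b ≠ u ∧ b ≠ v := by
    obtain ⟨γ, f, -, -, h0, h1, h2, -⟩ := hB'.exists_coord
    have hm : (1/2 : ℝ) ∈ Icc (0:ℝ) 1 := by norm_num
    refine ⟨γ (1/2), (h2 _ hm).1, fun h3 => ?_, fun h3 => ?_⟩
    · have := (h2 _ hm).2
      rw [h3, ← h0, (h2 0 (by simp)).2] at this; norm_num at this
    · have := (h2 _ hm).2
      rw [h3, ← h1, (h2 1 (by simp)).2] at this; norm_num at this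
  obtain ⟨B₁, B₂, hB₁, hB₂, hBU, hBI⟩ := hB'.split hb' hb'u hb'v
  have hB₁' : B₁ ⊆ B' := hBU ▸ subset_union_left
  have hB₂' : B₂ ⊆ B' := hBU ▸ subset_union_right
  have hQ₁ : IsArc (P₁ ∪ B₁) p b' := hP₁.union hB₁ (by
    rw [← hP₁B]; exact inter_subset_inter_right _ (hB₁'.trans hB'B))
  have hQ₂ : IsArc (P₂ ∪ B₂) p b' := hP₂.union hB₂.symm (by
    rw [← hP₂B]; exact inter_subset_inter_right _ (hB₂'.trans hB'B))
  have hbp : b' ≠ p := fun h1 => hpB (h1 ▸ hB'B hb')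
  have hloc : ∀ z ∈ J, ∃ δ > 0, E ∩ ball z δ ⊆ J := by
    intro z hz
    by_cases hzu : z = u
    · obtain ⟨δ, hδ, hs⟩ := h.arc_isOpen hE hf hQ₁ (union_subset hP₁E (hB₁'.trans hB'E))
        (Or.inl hP₁.right_mem) hup hb'u.symm
      refine ⟨δ, hδ, hzu ▸ hs.trans (union_subset ?_ ?_)⟩
      · exact subset_union_left.trans subset_union_left
      · exact hB₁'.trans subset_union_right
    by_cases hzv : z = v
    · obtain ⟨δ, hδ, hs⟩ := h.arc_isOpen hE hf hQ₂ (union_subset hP₂E (hB₂'.trans hB'E))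
        (Or.inl hP₂.right_mem) hvp hb'v.symm
      refine ⟨δ, hδ, hzv ▸ hs.trans (union_subset ?_ ?_)⟩
      · exact subset_union_right.trans subset_union_left
      · exact hB₂'.trans subset_union_right
    rcases hz with hz | hz
    · obtain ⟨δ, hδ, hs⟩ := h.arc_isOpen hE hf hP hPE hz hzu hzv
      exact ⟨δ, hδ, hs.trans subset_union_left⟩
    · obtain ⟨δ, hδ, hs⟩ := h.arc_isOpen hE hf hB' hB'E hz hzu hzv
      exact ⟨δ, hδ, hs.trans subset_union_right⟩
  have hEJ : E = J := by
    refine subset_antisymm (fun e he => ?_) hJE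
    by_contra heJ
    choose! δ hδ hδJ using hloc
    obtain ⟨z, hz, hz1, hz2⟩ := hE (⋃ z ∈ J, ball z (δ z)) Jᶜ
      (isOpen_biUnion fun _ _ => isOpen_ball) hJc.isClosed.isOpen_compl
      (fun z hz => by
        by_cases hzJ : z ∈ J
        · exact Or.inl (mem_biUnion hzJ (mem_ball_self (hδ z hzJ)))
        · exact Or.inr hzJ)
      ⟨u, hJE (Or.inr hB'.left_mem), mem_biUnion (Or.inr hB'.left_mem)
        (mem_ball_self (hδ u (Or.inr hB'.left_mem)))⟩ ⟨e, he, heJ⟩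
    simp only [mem_iUnion] at hz1
    obtain ⟨w, hw, hzw⟩ := hz1
    exact hz2 (hδJ w hw ⟨hz, hzw⟩)
  rw [hEJ]
  exact isJordanCurve_union hP hB' hPB

end Nice

end

section

namespace IsArc

theorem exists_interior {A : Set ℂ} {a b : ℂ} (h : IsArc A a b) : ∃ p ∈ A, p ≠ a ∧ p ≠ b := by
  obtain ⟨γ, f, -, -, h0, h1, h2, -⟩ := h.exists_coord
  have hm : (1/2 : ℝ) ∈ Icc (0:ℝ) 1 := by norm_num
  refine ⟨γ (1/2), (h2 _ hm).1, fun h3 => ?_, fun h3 => ?_⟩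
  · have := (h2 _ hm).2
    rw [h3, ← h0, (h2 0 (by simp)).2] at this; norm_num at this
  · have := (h2 _ hm).2
    rw [h3, ← h1, (h2 1 (by simp)).2] at this; norm_num at this

end IsArc

namespace Nice

variable {Ω E : Set ℂ}

theorem homeoToInterval_of_cut (h : Nice Ω E) (hE : IsConnected E) (hf : FewHits Ω E)
    (hcut : ∀ A ⊆ E, ∀ x y, IsArc A x y → ∀ p ∈ A, p ≠ x → p ≠ y →
      y ∉ connectedComponentIn (E \ {p}) x) {A₀ : Set ℂ} {a₀ b₀ : ℂ} (hA₀E : A₀ ⊆ E)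
    (hA₀ : IsArc A₀ a₀ b₀) : HomeoToInterval E := by
  have hEp := hE.isPreconnected
  have harc : ∀ a ∈ E, ∀ b ∈ E, a ≠ b → ∃ A ⊆ E, IsArc A a b := fun a ha b hb hab =>
    h.exists_isArc hEp ha hb hab
  obtain ⟨p, hp, hpa, hpb⟩ := hA₀.exists_interior
  have hpE := hA₀E hp
  let C : ℂ → Set ℂ := fun z => connectedComponentIn (E \ {z}) p
  let l : ℂ → Set ℂ := fun x => {z ∈ E | x ∉ C z}
  have hself : ∀ x, x ∉ C x := fun x hx => (connectedComponentIn_subset _ _ hx).2 rfl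
  have hCp : C p = ∅ := connectedComponentIn_eq_empty (by simp)
  have hxl : ∀ x ∈ E, x ∈ l x := fun x hx => ⟨hx, hself x⟩
  have hpl : ∀ x, p ∈ l x := fun x => ⟨hpE, by rw [hCp]; simp⟩
  have hlP : ∀ x P, P ⊆ E → IsArc P p x → l x = P := by
    intro x P hPE hP
    apply subset_antisymm
    · rintro z ⟨hzE, hz⟩
      by_contra hzP
      have h1 : P ⊆ E \ {z} := fun w hw => ⟨hPE hw, by rintro rfl; exact hzP hw⟩
      exact hz (hP.isConnected.isPreconnected.subset_connectedComponentIn hP.left_mem h1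
        hP.right_mem)
    · intro z hz
      by_cases hzx : z = x
      · rw [hzx]; exact hxl x (hPE hP.right_mem)
      by_cases hzp : z = p
      · rw [hzp]; exact hpl x
      exact ⟨hPE hz, hcut P hPE p x hP z hz hzp hzx⟩
  have hlp : l p = {p} := by
    apply subset_antisymm
    · rintro z ⟨hzE, hz⟩
      by_contra hzp
      exact hz (mem_connectedComponentIn ⟨hpE, fun h1 => hzp h1.symm⟩)
    · rw [singleton_subset_iff]
      exact hxl p hpE
  have hlc : ∀ x ∈ E, IsClosed (l x) := by
    intro x hx
    by_cases hxp : x = p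
    · rw [hxp, hlp]; exact isClosed_singleton
    · obtain ⟨P, hPE, hP⟩ := harc p hpE x hx (Ne.symm hxp)
      rw [hlP x P hPE hP]
      exact hP.isCompact.isClosed
  let f : ℂ → ℝ := fun x => size (l x)
  have hfp : ∀ x ∈ E, x ≠ p → f p < f x := fun x hx hxp =>
    size_strict ⟨p, hpl p⟩ (hlc p hpE) ⟨by rw [hlp]; simpa using hpl x, fun h1 => by
      have := h1 (hxl x hx)
      rw [hlp] at this
      exact hxp this⟩
  have hdiff : ∀ x y, ∀ K ⊆ E, IsPreconnected K → x ∈ K → y ∈ K → l x \ l y ⊆ K := by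
    rintro x y K hKE hK hxK hyK z ⟨hz, hz'⟩
    by_contra hzK
    have hyC : y ∈ C z := by
      by_contra h1
      exact hz' ⟨hz.1, h1⟩
    apply hz.2
    rw [show C z = connectedComponentIn (E \ {z}) y from connectedComponentIn_eq hyC]
    have h1 : K ⊆ E \ {z} := fun w hw => ⟨hKE hw, by rintro rfl; exact hzK hw⟩
    exact hK.subset_connectedComponentIn hyK h1 hxK
  have hfc : ∀ x ∈ E, ∀ ε > 0, ∃ δ > 0, ∀ y ∈ E, dist y x < δ → |f y - f x| < ε := by
    intro x hx ε hε
    obtain ⟨r, hr, hrΩ⟩ := Metric.nhds_basis_closedBall.mem_iff.1 (h.isOpen.mem_nhds (h.sub hx))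
    have hr' : 0 < min r (ε / 8) := lt_min hr (by linarith)
    obtain ⟨K, h1, h2, h3, h4, δ, hδ, h5⟩ := h.exists_local hEp hx hr'
      ((closedBall_subset_closedBall (min_le_left _ _)).trans hrΩ)
    refine ⟨δ, hδ, fun y hy hyx => ?_⟩
    have hyK : y ∈ K := h5 ⟨hy, hyx⟩
    have := abs_size_sub_le_of_subset (x := x) (y := y) (S := l x) (T := l y) (K := K)
      (hxl x hx) (hxl y hy) (h4 hyK).2 (fun w hw => (h4 hw).2)
      (hdiff x y K (fun w hw => (h4 hw).1) h2 h3 hyK)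
      (hdiff y x K (fun w hw => (h4 hw).1) h2 hyK h3)
    rw [abs_sub_comm]
    have := min_le_right r (ε / 8)
    simp only [f]
    linarith
  have hlt : ∀ x ∈ E, ∀ y ∈ l x, y ≠ x → y ≠ p → f y < f x := by
    intro x hx y hy hyx hyp
    have hxp : x ≠ p := by
      rintro rfl
      rw [hlp] at hy
      exact hyx hy
    obtain ⟨P, hPE, hP⟩ := harc p hpE x hx (Ne.symm hxp)
    have hyP : y ∈ P := (hlP x P hPE hP) ▸ hy
    obtain ⟨P₁, P₂, hP₁, hP₂, hU, hI⟩ := hP.split hyP hyp hyx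
    have hs1 : P₁ ⊆ P := hU ▸ subset_union_left
    have e1 := hlP y P₁ (hs1.trans hPE) hP₁
    refine size_strict ⟨p, hpl y⟩ (hlc y (hPE hyP)) ⟨?_, fun h1 => ?_⟩
    · rw [e1, hlP x P hPE hP]; exact hs1
    · have h2 := h1 (hxl x hx)
      rw [e1] at h2
      exact hyx (hI.subset ⟨h2, hP₂.right_mem⟩).symm
  have hinj : ∀ x ∈ E, ∀ y ∈ E, x ≠ y → y ∈ connectedComponentIn (E \ {p}) x → f x ≠ f y := by
    intro x hx y hy hxy hyx
    have hyp : y ≠ p := (connectedComponentIn_subset _ _ hyx).2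
    have hxp : x ≠ p := (connectedComponentIn_nonempty_iff.1 ⟨y, hyx⟩).2
    by_cases h1 : y ∈ l x
    · exact (hlt x hx y h1 hxy.symm hyp).ne'
    by_cases h2 : x ∈ l y
    · exact (hlt y hy x h2 hxy hxp).ne
    exfalso
    obtain ⟨P, hPE, hP⟩ := harc p hpE x hx (Ne.symm hxp)
    obtain ⟨Q, hQE, hQ⟩ := harc p hpE y hy (Ne.symm hyp)
    rw [hlP x P hPE hP] at h1
    rw [hlP y Q hQE hQ] at h2
    obtain ⟨w, hw, B, hBQ, hB, hBP⟩ := hQ.symm.exists_first_hit hP.isCompact.isClosed h1 hP.left_mem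
    have hwx : w ≠ x := fun h3 => h2 (h3 ▸ hBQ hB.right_mem)
    by_cases hwp : w = p
    · rw [hwp] at hB hBP
      exact hcut (P ∪ B) (union_subset hPE (hBQ.trans hQE)) x y
        (hP.symm.union hB.symm (by rw [inter_comm, hBP])) p (Or.inl hP.left_mem) hxp.symm hyp.symm hyx
    · obtain ⟨P₁, P₂, hP₁, hP₂, hU, hI⟩ := hP.split hw hwp hwx
      have hs1 : P₁ ⊆ P := hU ▸ subset_union_left
      have hs2 : P₂ ⊆ P := hU ▸ subset_union_right
      refine hf.no_arc_triod h.isOpen h.sub (hs1.trans hPE) (hs2.trans hPE) (hBQ.trans hQE)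
        hP₁ hP₂.symm hB hI.subset ?_ ?_
      · rw [inter_comm, ← hBP]; exact inter_subset_inter_right _ hs2
      · rw [inter_comm, ← hBP]; exact inter_subset_inter_right _ hs1
  have hA₀side : ∀ x ∈ A₀, x ≠ p → x ∈ connectedComponentIn (E \ {p}) b₀ ∨
      x ∈ connectedComponentIn (E \ {p}) a₀ := by
    intro x hx hxp
    obtain ⟨A₁, A₂, hA₁, hA₂, hU, hI⟩ := hA₀.split hp hpa hpb
    have hs1 : A₁ ⊆ E := (hU ▸ subset_union_left : A₁ ⊆ A₀).trans hA₀E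
    have hs2 : A₂ ⊆ E := (hU ▸ subset_union_right : A₂ ⊆ A₀).trans hA₀E
    have aux : ∀ A c, A ⊆ E → IsArc A c p → x ∈ A → x ∈ connectedComponentIn (E \ {p}) c := by
      intro A c hAE hA hxA
      by_cases hxc : x = c
      · rw [hxc]; exact mem_connectedComponentIn ⟨hAE hA.left_mem, hA.ne⟩
      · obtain ⟨B₁, B₂, hB₁, hB₂, hBU, hBI⟩ := hA.split hxA hxc hxp
        have h1 : B₁ ⊆ E \ {p} := fun w hw => ⟨hAE (hBU ▸ Or.inl hw), by
          rintro rfl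
          exact hxp (hBI.subset ⟨hw, hB₂.right_mem⟩).symm⟩
        exact hB₁.isConnected.isPreconnected.subset_connectedComponentIn hB₁.left_mem h1
          hB₁.right_mem
    rw [← hU] at hx
    rcases hx with hx | hx
    · exact Or.inr (aux A₁ a₀ hs1 hA₁ hx)
    · exact Or.inl (aux A₂ b₀ hs2 hA₂.symm hx)
  have hside : ∀ x ∈ E, x ≠ p → x ∈ connectedComponentIn (E \ {p}) b₀ ∨
      x ∈ connectedComponentIn (E \ {p}) a₀ := by
    intro x hx hxp
    by_cases hxA : x ∈ A₀
    · exact hA₀side x hxA hxp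
    obtain ⟨P, hPE, hP⟩ := harc x hx p hpE hxp
    obtain ⟨w, hw, B, hBP, hB, hBA⟩ := hP.exists_first_hit hA₀.isCompact.isClosed hxA hp
    by_cases hwp : w = p
    · exfalso
      rw [hwp] at hB hBA
      obtain ⟨A₁, A₂, hA₁, hA₂, hU, hI⟩ := hA₀.split hp hpa hpb
      have hs1 : A₁ ⊆ A₀ := hU ▸ subset_union_left
      have hs2 : A₂ ⊆ A₀ := hU ▸ subset_union_right
      refine hf.no_arc_triod h.isOpen h.sub (hs1.trans hA₀E) (hs2.trans hA₀E) (hBP.trans hPE)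
        hA₁ hA₂.symm hB hI.subset ?_ ?_
      · rw [inter_comm, ← hBA]; exact inter_subset_inter_right _ hs2
      · rw [inter_comm, ← hBA]; exact inter_subset_inter_right _ hs1
    · have h1 : B ⊆ connectedComponentIn (E \ {p}) w :=
        hB.isConnected.isPreconnected.subset_connectedComponentIn hB.right_mem fun z hz =>
          ⟨hPE (hBP hz), by
            rintro rfl
            exact hwp (hBA.subset ⟨hz, hp⟩).symm⟩
      have h2 := h1 hB.left_mem
      rcases hA₀side w hw hwp with h3 | h3
      · left; rwa [connectedComponentIn_eq h3]
      · right; rwa [connectedComponentIn_eq h3]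
  classical
  set R := connectedComponentIn (E \ {p}) b₀ with hR
  let s : ℂ → ℝ := fun x => if x ∈ R then 1 else -1
  have hs : ∀ x, |s x| = 1 := fun x => by simp only [s]; split_ifs <;> simp
  have hpR : p ∉ R := fun h1 => (connectedComponentIn_subset _ _ h1).2 rfl
  let F : ℂ → ℝ := fun x => s x * (f x - f p)
  refine homeoToInterval_of_injOn hE harc (F := F) ?_ ?_
  · intro x hx
    rw [Metric.continuousWithinAt_iff]
    intro ε hε
    obtain ⟨δ, hδ, hs'⟩ := hfc x hx ε hε
    by_cases hxp : x = p
    · refine ⟨δ, hδ, fun y hy hyx => ?_⟩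
      have := hs' y hy hyx
      rw [hxp] at this ⊢
      rw [Real.dist_eq]
      simp only [F, sub_self, mul_zero, sub_zero]
      rwa [abs_mul, hs, one_mul]
    · obtain ⟨δ', hδ', hc⟩ := h.mem_nhdsWithin_component hEp hx hxp
      refine ⟨min δ δ', lt_min hδ hδ', fun y hy hyx => ?_⟩
      have h1 := hs' y hy (hyx.trans_le (min_le_left _ _))
      have h2 := hc ⟨hy, hyx.trans_le (min_le_right _ _)⟩
      have h3 : s y = s x := by
        have : y ∈ R ↔ x ∈ R := by
          constructor <;> intro h4 <;> rw [hR, connectedComponentIn_eq h4]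
          · rw [← connectedComponentIn_eq h2]
            exact mem_connectedComponentIn ⟨hx, hxp⟩
          · exact h2
        simp only [s, this]
      rw [Real.dist_eq]
      simp only [F, h3]
      rw [← mul_sub, abs_mul, hs, one_mul]
      simpa using h1
  · have hF1 : ∀ x ∈ E, x ∈ R → 0 < F x := fun x hx hxR => by
      have := hfp x hx (fun h1 => hpR (h1 ▸ hxR))
      simp only [F, s, if_pos hxR]
      linarith
    have hF2 : ∀ x ∈ E, x ∉ R → x ≠ p → F x < 0 := fun x hx hxR hxp => by
      have := hfp x hx hxp
      simp only [F, s, if_neg hxR]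
      linarith
    have hF3 : F p = 0 := by simp [F]
    intro x hx y hy hxy
    by_contra hne
    by_cases hxR : x ∈ R
    · have hyR : y ∈ R := by
        by_contra hyR
        have h1 := hF1 x hx hxR
        by_cases hyp : y = p
        · rw [hyp, hF3] at hxy; linarith
        · have := hF2 y hy hyR hyp
          linarith
      refine hinj x hx y hy hne (by rw [← connectedComponentIn_eq hxR]; exact hyR) ?_
      simp only [F, s, if_pos hxR, if_pos hyR] at hxy
      linarith
    · have hyR : y ∉ R := by
        intro hyR
        have h1 := hF1 y hy hyR
        by_cases hxp : x = p
        · rw [hxp, hF3] at hxy; linarith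
        · have := hF2 x hx hxR hxp
          linarith
      by_cases hxp : x = p
      · have := hF2 y hy hyR (fun h1 => hne (hxp.trans h1.symm))
        rw [← hxy, hxp, hF3] at this
        exact lt_irrefl _ this
      by_cases hyp : y = p
      · have := hF2 x hx hxR hxp
        rw [hxy, hyp, hF3] at this
        exact lt_irrefl _ this
      have h1 := (hside x hx hxp).resolve_left hxR
      have h2 := (hside y hy hyp).resolve_left hyR
      refine hinj x hx y hy hne (by rw [← connectedComponentIn_eq h1]; exact h2) ?_
      simp only [F, s, if_neg hxR, if_neg hyR] at hxy
      linarith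

theorem classification (h : Nice Ω E) (hE : IsConnected E) (hf : FewHits Ω E) :
    (∃ p, E = {p}) ∨ IsJordanCurve E ∨ HomeoToInterval E := by
  obtain ⟨a, ha⟩ := hE.nonempty
  by_cases hne : ∃ b ∈ E, a ≠ b
  swap
  · left
    push Not at hne
    exact ⟨a, Subset.antisymm (fun b hb => (hne b hb).symm) (by simpa using ha)⟩
  right
  obtain ⟨b, hb, hab⟩ := hne
  obtain ⟨A, hAE, hA⟩ := h.exists_isArc hE.isPreconnected ha hb hab
  by_cases hcut : ∀ A ⊆ E, ∀ x y, IsArc A x y → ∀ p ∈ A, p ≠ x → p ≠ y →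
      y ∉ connectedComponentIn (E \ {p}) x
  · exact Or.inr (h.homeoToInterval_of_cut hE hf hcut hAE hA)
  · push Not at hcut
    obtain ⟨A, hAE, x, y, hA, p, hp, hpx, hpy, hy⟩ := hcut
    exact Or.inl (h.isJordanCurve_of_loop hE.isPreconnected hf hA hAE hp hpx hpy hy)

end Nice

end

section

open Filter Topology

theorem exists_mem_ball_ne (x : ℂ) {r : ℝ} (hr : 0 < r) : ∃ y ∈ ball x r, y ≠ x := by
  have hd : dist (x + (r / 2 : ℝ)) x = r / 2 := by
    rw [dist_eq_norm, add_sub_cancel_left, Complex.norm_real, Real.norm_of_nonneg (by positivity)]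
  refine ⟨x + (r / 2 : ℝ), by rw [mem_ball, hd]; linarith, fun h => ?_⟩
  rw [h, dist_self] at hd
  linarith

theorem continuousOn_leftInvOn_of_isOpen_image {α β : Type*} [TopologicalSpace α]
    [TopologicalSpace β] {V : Set α} (hVo : IsOpen V) {f : α → β} {g : β → α}
    (hg : LeftInvOn g f V) (hop : ∀ U ⊆ V, IsOpen U → IsOpen (f '' U)) :
    ContinuousOn g (f '' V) := by
  rw [_root_.continuousOn_iff']
  intro t ht
  refine ⟨f '' (V ∩ t), hop _ inter_subset_left (hVo.inter ht), ?_⟩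
  ext w
  constructor
  · rintro ⟨hw, z, hz, rfl⟩
    rw [mem_preimage, hg hz] at hw
    exact ⟨⟨z, ⟨hz, hw⟩, rfl⟩, ⟨z, hz, rfl⟩⟩
  · rintro ⟨⟨z, hz, rfl⟩, -⟩
    exact ⟨by rw [mem_preimage, hg hz.1]; exact hz.2, ⟨z, hz.1, rfl⟩⟩

theorem exists_preconnected_of_compl {V C : Set ℂ} (hVo : IsOpen V) (hVc : IsPreconnected V)
    (hVb : Bornology.IsBounded V) (hC : IsCompact C) (hCV : C ⊆ V) {p q : ℂ} (hp : p ∈ V)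
    (hq : q ∈ V) (h : Unsep C p q) :
    ∃ S, IsPreconnected S ∧ S ⊆ V \ C ∧ p ∈ S ∧ q ∈ S := by
  obtain ⟨R, hR⟩ := hVb.subset_ball (0 : ℂ)
  have hE : IsCompact (Vᶜ ∩ closedBall (0 : ℂ) R) :=
    (isCompact_closedBall _ _).inter_left hVo.isClosed_compl
  have hE' : Unsep (Vᶜ ∩ closedBall (0 : ℂ) R) p q :=
    ⟨V, hVc, fun z hz hz' => hz'.1 hz, hp, hq⟩
  have hemp : C ∩ (Vᶜ ∩ closedBall (0 : ℂ) R) = ∅ := by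
    ext z; simp only [mem_inter_iff, mem_compl_iff, mem_empty_iff_false, iff_false]
    exact fun hz => hz.2.1 (hCV hz.1)
  obtain ⟨S, hS, hSs, hpS, hqS⟩ := h.union hC hE (by rw [hemp]; exact isPreconnected_empty) hE'
  refine ⟨S, hS, ?_, hpS, hqS⟩
  have hSV : S ⊆ V := by
    refine hS.subset_left_of_subset_union hVo isClosed_closedBall.isOpen_compl
      (v := (closedBall (0 : ℂ) R)ᶜ) ?_ ?_ ⟨p, hpS, hp⟩
    · exact disjoint_left.2 fun z hz hz' => hz' (ball_subset_closedBall (hR hz))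
    · intro z hz
      by_cases hzV : z ∈ V
      · exact Or.inl hzV
      · exact Or.inr fun hzb => hSs hz (Or.inr ⟨hzV, hzb⟩)
  exact fun z hz => ⟨hSV hz, fun hzC => hSs hz (Or.inl hzC)⟩

theorem unsep_of_image {V C : Set ℂ} (hVo : IsOpen V) (hVc : IsPreconnected V)
    (hVb : Bornology.IsBounded V) (hE : IsPreconnected Vᶜ) {f : ℂ → ℂ} (hf : ContinuousOn f V)
    (hi : InjOn f V) (hop : ∀ U ⊆ V, IsOpen U → IsOpen (f '' U)) {a b : ℂ} (ha : a ∉ f '' V)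
    (hb : b ∉ f '' V) (hC : IsCompact C) (hCV : C ⊆ f '' V) : Unsep C a b := by
  classical
  rcases C.eq_empty_or_nonempty with rfl | ⟨c, hc⟩
  · exact ⟨univ, isPreconnected_univ, by simp, mem_univ _, mem_univ _⟩
  obtain ⟨c₁, hc₁, hc₁'⟩ := hCV hc
  set g := Function.invFunOn f V
  have hg : LeftInvOn g f V := hi.leftInvOn_invFunOn
  have hgc := continuousOn_leftInvOn_of_isOpen_image hVo hg hop
  set C₁ := g '' C
  have hC₁ : IsCompact C₁ := hC.image_of_continuousOn (hgc.mono hCV)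
  have hC₁V : C₁ ⊆ V := by
    rintro _ ⟨w, hw, rfl⟩
    obtain ⟨z, hz, rfl⟩ := hCV hw
    rwa [hg hz]
  have hfC : ∀ z ∈ V, f z ∈ C → z ∈ C₁ := fun z hz hzC => ⟨f z, hzC, hg hz⟩
  obtain ⟨e, he⟩ : Vᶜ.Nonempty := by
    rw [nonempty_compl]
    rintro rfl
    exact NormedSpace.unbounded_univ ℝ ℂ hVb
  set H := connectedComponentIn C₁ᶜ e
  have hHo : IsOpen H := hC₁.isClosed.isOpen_compl.connectedComponentIn
  have hEH : Vᶜ ⊆ H := hE.subset_connectedComponentIn he (compl_subset_compl.2 hC₁V)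
  have hHV : Hᶜ ⊆ V := compl_subset_comm.1 hEH
  have hHc : IsCompact Hᶜ :=
    Metric.isCompact_of_isClosed_isBounded hHo.isClosed_compl (hVb.subset hHV)
  have key : ∀ x ∉ f '' V, ∃ z ∈ V, z ∈ H ∧ Unsep C (f z) x := by
    intro x hx
    by_contra! hcon
    set P := connectedComponentIn Cᶜ x
    have hxC : x ∈ Cᶜ := fun h => hx (hCV h)
    have hPo : IsOpen P := hC.isClosed.isOpen_compl.connectedComponentIn
    have hPp : IsPreconnected P := isPreconnected_connectedComponentIn
    have hsub : f '' V ∩ P ⊆ f '' Hᶜ := by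
      rintro _ ⟨⟨z, hz, rfl⟩, hzP⟩
      exact ⟨z, fun hzH => hcon z hz hzH (unsep_iff.2 hzP).symm, rfl⟩
    have hcl : IsClosed (f '' Hᶜ) := (hHc.image_of_continuousOn (hf.mono hHV)).isClosed
    have hne : (P ∩ f '' V).Nonempty := by
      have hfr : (frontier P).Nonempty := by
        rw [nonempty_frontier_iff]
        exact ⟨⟨x, mem_connectedComponentIn hxC⟩, fun h =>
          connectedComponentIn_subset Cᶜ x (h ▸ mem_univ c : c ∈ P) hc⟩
      obtain ⟨y, hy⟩ := hfr
      have hyC : y ∈ C := by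
        have := frontier_connectedComponentIn_subset hC.isClosed.isOpen_compl x hy
        rwa [compl_compl] at this
      rw [inter_comm]
      exact mem_closure_iff.1 (frontier_subset_closure hy) _ (hop V Subset.rfl hVo) (hCV hyC)
    have hPV : P ⊆ f '' V := by
      refine hPp.subset_of_closure_inter_subset (hop V Subset.rfl hVo) hne ?_
      rintro y ⟨hy, hyP⟩
      have h1 : y ∈ closure (f '' V ∩ P) := by
        rw [inter_comm]; exact hPo.inter_closure ⟨hyP, hy⟩
      exact image_mono hHV (hcl.closure_subset_iff.2 hsub h1)
    exact hx (hPV (mem_connectedComponentIn hxC))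
  obtain ⟨p, hp, hpH, hpa⟩ := key a ha
  obtain ⟨q, hq, hqH, hqb⟩ := key b hb
  have hpq : Unsep C₁ p q := ⟨H, isPreconnected_connectedComponentIn,
    connectedComponentIn_subset _ _, hpH, hqH⟩
  obtain ⟨S, hS, hSV, hpS, hqS⟩ := exists_preconnected_of_compl hVo hVc hVb hC₁ hC₁V hp hq hpq
  have : Unsep C (f p) (f q) := by
    refine ⟨f '' S, hS.image f (hf.mono fun z hz => (hSV hz).1), ?_, ⟨p, hpS, rfl⟩, ⟨q, hqS, rfl⟩⟩
    rintro _ ⟨z, hz, rfl⟩ hzC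
    exact (hSV hz).2 (hfC z (hSV hz).1 hzC)
  exact hpa.symm.trans (this.trans hqb)

theorem hasLogOn_of_compact {V : Set ℂ} (hVo : IsOpen V) (hVc : IsConnected V) {F : ℂ → ℂ}
    (h0 : ∀ z ∈ V, F z ≠ 0)
    (h : ∀ K ⊆ V, IsCompact K → HasLogOn K F) : HasLogOn V F := by
  classical
  obtain ⟨z₀, hz₀⟩ := hVc.nonempty
  have hnorm : ∀ K ⊆ V, IsCompact K → z₀ ∈ K → ∃ l : ℂ → ℂ, ContinuousOn l K ∧
      (∀ z ∈ K, Complex.exp (l z) = F z) ∧ l z₀ = Complex.log (F z₀) := by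
    intro K hK hKc hzK
    obtain ⟨l, hl, hl'⟩ := h K hK hKc
    refine ⟨fun z => l z - l z₀ + Complex.log (F z₀), by fun_prop, fun z hz => ?_, by ring⟩
    rw [Complex.exp_add, Complex.exp_sub, hl' z hz, hl' z₀ hzK, Complex.exp_log (h0 _ hz₀)]
    have := h0 _ hz₀
    field_simp
  have hK : ∀ z ∈ V, ∃ K ⊆ V, IsCompact K ∧ IsPreconnected K ∧ z₀ ∈ K ∧ z ∈ K := by
    intro z hz
    obtain ⟨γ, hγ⟩ := (hVo.isConnected_iff_isPathConnected.1 hVc).joinedIn z₀ hz₀ z hz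
    refine ⟨range γ, range_subset_iff.2 hγ, isCompact_range γ.continuous,
      isPreconnected_range γ.continuous, ⟨0, γ.source⟩, ⟨1, γ.target⟩⟩
  have huniq : ∀ (K : Set ℂ) (l m : ℂ → ℂ), IsPreconnected K → z₀ ∈ K → ContinuousOn l K →
      ContinuousOn m K → (∀ z ∈ K, Complex.exp (l z) = F z) → (∀ z ∈ K, Complex.exp (m z) = F z) →
      K ⊆ V → l z₀ = m z₀ → ∀ z ∈ K, l z = m z := by
    intro K l m hKp hzK hl hm hl' hm' hKV h₀ z hz
    have := eq_of_exp_eq_one hKp (hl.sub hm) (fun x hx => by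
      rw [Pi.sub_apply, Complex.exp_sub, hl' x hx, hm' x hx, div_self (h0 x (hKV hx))]) hz hzK
    simpa [h₀, sub_eq_zero] using this
  choose! K hKV hKc hKp hKz₀ hKz using hK
  choose! l hlc hle hl0 using hnorm
  refine ⟨fun z => l (K z) z, ?_, fun z hz => hle (K z) (hKV z hz) (hKc z hz) (hKz₀ z hz) z
    (hKz z hz)⟩
  intro z hz
  obtain ⟨r, hr, hrV⟩ := Metric.nhds_basis_closedBall.mem_iff.1 (hVo.mem_nhds hz)
  set M := K z ∪ closedBall z r
  have hMV : M ⊆ V := union_subset (hKV z hz) hrV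
  have hMc : IsCompact M := (hKc z hz).union (isCompact_closedBall _ _)
  have hM0 : z₀ ∈ M := Or.inl (hKz₀ z hz)
  have hMp : IsPreconnected M := (hKp z hz).union z (hKz z hz) (mem_closedBall_self hr.le)
    (convex_closedBall z r).isPreconnected
  have heq : ∀ w ∈ closedBall z r, l (K w) w = l M w := by
    intro w hw
    have hwV := hrV hw
    have hNV : K w ∪ M ⊆ V := union_subset (hKV w hwV) hMV
    have hNc := (hKc w hwV).union hMc
    have hN0 : z₀ ∈ K w ∪ M := Or.inr hM0
    have h1 := huniq (K w) (l (K w)) (l (K w ∪ M)) (hKp w hwV) (hKz₀ w hwV)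
      (hlc _ (hKV w hwV) (hKc w hwV) (hKz₀ w hwV)) ((hlc _ hNV hNc hN0).mono subset_union_left)
      (hle _ (hKV w hwV) (hKc w hwV) (hKz₀ w hwV))
      (fun x hx => hle _ hNV hNc hN0 x (Or.inl hx)) (hKV w hwV)
      (by rw [hl0 _ (hKV w hwV) (hKc w hwV) (hKz₀ w hwV), hl0 _ hNV hNc hN0]) w (hKz w hwV)
    have h2 := huniq M (l M) (l (K w ∪ M)) hMp hM0
      (hlc _ hMV hMc hM0) ((hlc _ hNV hNc hN0).mono subset_union_right)
      (hle _ hMV hMc hM0)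
      (fun x hx => hle _ hNV hNc hN0 x (Or.inr hx)) hMV
      (by rw [hl0 _ hMV hMc hM0, hl0 _ hNV hNc hN0]) w (Or.inr hw)
    rw [h1, h2]
  have hcont : ContinuousAt (l M) z := ((hlc M hMV hMc hM0).mono subset_union_right).continuousAt
    (closedBall_mem_nhds z hr)
  refine (hcont.congr ?_).continuousWithinAt
  filter_upwards [closedBall_mem_nhds z hr] with w hw using (heq w hw).symm

theorem hasLogOn_of_injOn {V : Set ℂ} (hVo : IsOpen V) (hVc : IsConnected V)
    (hVb : Bornology.IsBounded V) (hE : IsPreconnected Vᶜ) {f : ℂ → ℂ} (hf : ContinuousOn f V)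
    (hi : InjOn f V) (hop : ∀ U ⊆ V, IsOpen U → IsOpen (f '' U)) {a b : ℂ} (ha : a ∉ f '' V)
    (hb : b ∉ f '' V) : HasLogOn V (fun z => (f z - a) / (f z - b)) := by
  have ha' : ∀ z ∈ V, f z - a ≠ 0 := fun z hz h => ha ⟨z, hz, sub_eq_zero.1 h⟩
  have hb' : ∀ z ∈ V, f z - b ≠ 0 := fun z hz h => hb ⟨z, hz, sub_eq_zero.1 h⟩
  refine hasLogOn_of_compact hVo hVc
    (fun z hz => div_ne_zero (ha' z hz) (hb' z hz)) fun K hK hKc => ?_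
  have hC : IsCompact (f '' K) := hKc.image_of_continuousOn (hf.mono hK)
  obtain ⟨l, hl, hl'⟩ := hasLogOn_of_unsep hC.isClosed
    (unsep_of_image hVo hVc.isPreconnected hVb hE hf hi hop ha hb hC (image_mono hK))
  exact ⟨fun z => l (f z), hl.comp (hf.mono hK) (mapsTo_image f K),
    fun z hz => hl' _ ⟨z, hz, rfl⟩⟩

end

section

open Filter Topology

theorem exists_ultrafilter_limit {V : Set ℂ} (hVo : IsOpen V) {f : ℕ → ℂ → ℂ}
    (hd : ∀ n, DifferentiableOn ℂ (f n) V) (hm : ∀ n, MapsTo (f n) V (ball 0 1)) :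
    ∃ F : ℂ → ℂ, TendstoLocallyUniformlyOn f F (hyperfilter ℕ : Filter ℕ) V := by
  have hlim : ∀ z ∈ V, ∃ w, Tendsto (fun n => f n z) (hyperfilter ℕ : Filter ℕ) (𝓝 w) := by
    intro z hz
    obtain ⟨w, -, hw⟩ := (isCompact_closedBall (0 : ℂ) 1).ultrafilter_le_nhds
      ((hyperfilter ℕ).map fun n => f n z)
      (by
        rw [le_principal_iff, Ultrafilter.mem_coe, Ultrafilter.mem_map]
        exact Filter.univ_mem' fun n => ball_subset_closedBall (hm n hz))
    exact ⟨w, by rwa [Ultrafilter.coe_map] at hw⟩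
  choose! F hF using hlim
  refine ⟨F, ?_⟩
  have hlip : ∀ n, ∀ w r, 0 < r → ball w r ⊆ V → ∀ z ∈ ball w r,
      dist (f n z) (f n w) ≤ 2 / r * dist z w := by
    intro n w r hr hw z hz
    refine Complex.dist_le_div_mul_dist_of_mapsTo_ball ((hd n).mono hw) (fun y hy => ?_) hz
    have h1 := hm n (hw hy)
    have h2 := hm n (hw (mem_ball_self hr))
    rw [mem_ball_zero_iff] at h1 h2
    rw [mem_closedBall, dist_eq_norm]
    linarith [norm_sub_le (f n y) (f n w)]
  rw [Metric.tendstoLocallyUniformlyOn_iff]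
  intro ε hε x hx
  obtain ⟨r, hr, hrV⟩ := Metric.isOpen_iff.1 hVo x hx
  set s := r / 2 with hs
  have hs0 : 0 < s := by positivity
  have hsV : ∀ c ∈ closedBall x s, ball c s ⊆ V := fun c hc =>
    (ball_subset_ball' (by rw [mem_closedBall] at hc; linarith)).trans hrV
  obtain ⟨t, htb, htf, ht⟩ := (isCompact_closedBall x s).finite_cover_balls
    (e := min s (ε * s / 8)) (by positivity)
  refine ⟨closedBall x s, mem_nhdsWithin_of_mem_nhds (closedBall_mem_nhds x hs0), ?_⟩
  have hev : ∀ᶠ n in (hyperfilter ℕ : Filter ℕ), ∀ c ∈ t, dist (f n c) (F c) < ε / 4 := by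
    rw [eventually_all_finite htf]
    intro c hc
    exact (hF c (hsV c (htb hc) (mem_ball_self hs0))).eventually (ball_mem_nhds _ (by positivity))
  filter_upwards [hev] with n hn y hy
  obtain ⟨c, hc, hyc⟩ := mem_iUnion₂.1 (ht hy)
  rw [mem_ball, lt_min_iff] at hyc
  have hb : ∀ m, dist (f m y) (f m c) ≤ ε / 4 := by
    intro m
    refine (hlip m c s hs0 (hsV c (htb hc)) y hyc.1).trans ?_
    rw [div_mul_eq_mul_div, div_le_iff₀ hs0]
    nlinarith [hyc.2]
  have hyV : y ∈ V := hsV y hy (mem_ball_self hs0)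
  have hcV : c ∈ V := hsV c (htb hc) (mem_ball_self hs0)
  have hFb : dist (F y) (F c) ≤ ε / 4 :=
    le_of_tendsto ((hF y hyV).dist (hF c hcV)) (Eventually.of_forall hb)
  have h1 := hn c hc
  have h2 := hb n
  have := dist_triangle4 (F y) (F c) (f n c) (f n y)
  rw [dist_comm (f n y)] at h2
  rw [dist_comm (f n c)] at h1
  linarith

theorem injOn_limit {V : Set ℂ} (hVo : IsOpen V) (hVc : IsPreconnected V) {p : Filter ℕ} [p.NeBot]
    {f : ℕ → ℂ → ℂ} {F : ℂ → ℂ} (hF : TendstoLocallyUniformlyOn f F p V)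
    (hd : ∀ n, DifferentiableOn ℂ (f n) V) (hi : ∀ n, InjOn (f n) V)
    {z₀ z₁ : ℂ} (hz₀ : z₀ ∈ V) (hz₁ : z₁ ∈ V) (hne : F z₀ ≠ F z₁) : InjOn F V := by
  have hFd : DifferentiableOn ℂ F V :=
    hF.differentiableOn (Eventually.of_forall hd) hVo
  have hFa : AnalyticOnNhd ℂ F V := hFd.analyticOnNhd hVo
  intro x hx y hy hxy
  by_contra hxy'
  have hiso : ∀ z ∈ V, F z = F x → ∀ᶠ w in 𝓝[≠] z, F w ≠ F x := by
    intro z hz hzx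
    rcases ((hFa z hz).sub (analyticAt_const (v := F x))).eventually_eq_zero_or_eventually_ne_zero
      with h | h
    · exfalso
      have h' : F =ᶠ[𝓝 z] fun _ => F x := by
        filter_upwards [h] with w hw using sub_eq_zero.1 hw
      have := hFa.eqOn_of_preconnected_of_eventuallyEq analyticOnNhd_const hVc hz h'
      exact hne ((this hz₀).trans (this hz₁).symm)
    · filter_upwards [h] with w hw using sub_ne_zero.1 hw
  have hrad : ∀ z ∈ V, F z = F x → ∃ R > 0, ∀ r ∈ Ioc 0 R, closedBall z r ⊆ V ∧
      ∀ w ∈ sphere z r, F w ≠ F x := by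
    intro z hz hzx
    obtain ⟨R, hR, h⟩ := Metric.nhds_basis_closedBall.mem_iff.1
      (eventually_nhdsWithin_iff.1 (hiso z hz hzx))
    obtain ⟨R', hR', h'⟩ := Metric.nhds_basis_closedBall.mem_iff.1 (hVo.mem_nhds hz)
    refine ⟨min R R', lt_min hR hR', fun r hr => ⟨(closedBall_subset_closedBall
      (hr.2.trans (min_le_right _ _))).trans h', fun w hw => h (closedBall_subset_closedBall
      (hr.2.trans (min_le_left _ _)) (sphere_subset_closedBall hw)) ?_⟩⟩
    rintro rfl
    simp at hw
    exact hr.1.ne hw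
  obtain ⟨R₁, hR₁, h₁⟩ := hrad x hx rfl
  obtain ⟨R₂, hR₂, h₂⟩ := hrad y hy hxy.symm
  set r := min (min R₁ R₂) (dist x y / 3) with hrdef
  have hr : 0 < r := by
    have := dist_pos.2 hxy'
    positivity
  have hr3 : r ≤ dist x y / 3 := min_le_right _ _
  have key : ∀ z ∈ V, F z = F x → closedBall z r ⊆ V → (∀ w ∈ sphere z r, F w ≠ F x) →
      ∀ᶠ n in p, F x ∈ f n '' closedBall z r := by
    intro z hz hzx hzV hzs
    have hc : ContinuousOn (fun w => ‖F w - F x‖) (sphere z r) :=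
      ((hFd.continuousOn.mono (sphere_subset_closedBall.trans hzV)).sub continuousOn_const).norm
    obtain ⟨w₀, hw₀, hmin⟩ := (isCompact_sphere z r).exists_isMinOn
      ((NormedSpace.sphere_nonempty (E := ℂ)).2 hr.le) hc
    set ε := ‖F w₀ - F x‖ / 4 with hε
    have hε0 : 0 < ε := by
      have := norm_pos_iff.2 (sub_ne_zero.2 (hzs w₀ hw₀))
      positivity
    have hu := (tendstoLocallyUniformlyOn_iff_forall_isCompact hVo).1 hF _ hzV
      (isCompact_closedBall z r)
    filter_upwards [Metric.tendstoUniformlyOn_iff.1 hu ε hε0] with n hn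
    have hzn := hn z (mem_closedBall_self hr.le)
    have hdc : DiffContOnCl ℂ (f n) (ball z r) :=
      ((hd n).mono hzV).diffContOnCl_ball Subset.rfl
    refine hdc.ball_subset_image_closedBall hr (ε := 2 * ε) (fun w hw => ?_) ?_ ?_
    · have h1 := hn w (sphere_subset_closedBall hw)
      have h2 : ‖F w₀ - F x‖ ≤ ‖F w - F x‖ := hmin hw
      rw [dist_eq_norm] at h1 hzn
      rw [hzx] at hzn
      have h3 : F w - F x = (F w - f n w) + (f n w - f n z) - (F x - f n z) := by ring
      have h4 := norm_sub_le ((F w - f n w) + (f n w - f n z)) (F x - f n z)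
      have h5 := norm_add_le (F w - f n w) (f n w - f n z)
      rw [← h3] at h4
      linarith
    · by_contra! hcon
      have hev : ∀ᶠ w in 𝓝 z, f n w = f n z := by
        have := hcon
        simpa using this
      obtain ⟨ρ, hρ, h⟩ := Metric.eventually_nhds_iff.1 hev
      obtain ⟨y, hy, hyz⟩ := exists_mem_ball_ne z (lt_min hρ hr)
      rw [mem_ball, lt_min_iff] at hy
      exact hyz (hi n (hzV (mem_closedBall.2 hy.2.le)) hz (h hy.1))
    · rw [mem_ball, ← hzx]
      linarith
  have hk₁ := key x hx rfl (h₁ r ⟨hr, (min_le_left _ _).trans (min_le_left _ _)⟩).1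
    (h₁ r ⟨hr, (min_le_left _ _).trans (min_le_left _ _)⟩).2
  have hk₂ := key y hy hxy.symm (h₂ r ⟨hr, (min_le_left _ _).trans (min_le_right _ _)⟩).1
    (h₂ r ⟨hr, (min_le_left _ _).trans (min_le_right _ _)⟩).2
  obtain ⟨n, ⟨a, ha, ha'⟩, b, hb, hb'⟩ := (hk₁.and hk₂).exists
  have hab : a = b := hi n
    ((h₁ r ⟨hr, (min_le_left _ _).trans (min_le_left _ _)⟩).1 ha)
    ((h₂ r ⟨hr, (min_le_left _ _).trans (min_le_right _ _)⟩).1 hb) (ha'.trans hb'.symm)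
  subst hab
  rw [mem_closedBall] at ha hb
  have := dist_triangle x a y
  rw [dist_comm x a] at this
  linarith [dist_pos.2 hxy']

theorem norm_sub_lt_norm_one_sub {a w : ℂ} (ha : ‖a‖ < 1) (hw : ‖w‖ < 1) :
    ‖w - a‖ < ‖1 - starRingEnd ℂ a * w‖ := by
  have ha' : ‖a‖ ^ 2 < 1 := by nlinarith [norm_nonneg a]
  have hw' : ‖w‖ ^ 2 < 1 := by nlinarith [norm_nonneg w]
  rw [← sq_lt_sq₀ (norm_nonneg _) (norm_nonneg _)]
  rw [← Complex.normSq_eq_norm_sq, Complex.normSq_apply] at *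
  rw [← Complex.normSq_eq_norm_sq, Complex.normSq_apply] at *
  simp at *
  nlinarith [mul_pos (sub_pos.2 ha') (sub_pos.2 hw')]

theorem one_sub_conj_mul_ne_zero {a w : ℂ} (ha : ‖a‖ < 1) (hw : ‖w‖ < 1) :
    1 - starRingEnd ℂ a * w ≠ 0 :=
  norm_pos_iff.1 ((norm_nonneg _).trans_lt (norm_sub_lt_norm_one_sub ha hw))

/-- The disc automorphism sending `a` to `0`. -/
def mob (a w : ℂ) : ℂ := (w - a) / (1 - starRingEnd ℂ a * w)

theorem norm_mob_lt {a w : ℂ} (ha : ‖a‖ < 1) (hw : ‖w‖ < 1) : ‖mob a w‖ < 1 := by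
  rw [mob, norm_div, div_lt_one (norm_pos_iff.2 (one_sub_conj_mul_ne_zero ha hw))]
  exact norm_sub_lt_norm_one_sub ha hw

theorem mob_neg_mob {a w : ℂ} (ha : ‖a‖ < 1) (hw : ‖w‖ < 1) : mob (-a) (mob a w) = w := by
  have h1 := one_sub_conj_mul_ne_zero ha hw
  have h2 := one_sub_conj_mul_ne_zero ha ha
  have h3 : (1 - starRingEnd ℂ a * w) + starRingEnd ℂ a * (w - a) ≠ 0 := by
    intro h; exact h2 (by linear_combination h)
  have h4 : 1 - starRingEnd ℂ (-a) * ((w - a) / (1 - starRingEnd ℂ a * w)) =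
    ((1 - starRingEnd ℂ a * w) + starRingEnd ℂ a * (w - a)) / (1 - starRingEnd ℂ a * w) := by
    rw [map_neg]; field_simp; ring
  rw [mob, mob, h4, div_eq_iff (div_ne_zero h3 h1), sub_neg_eq_add, ← mul_div_assoc,
    div_add' _ _ _ h1, div_left_inj' h1]
  ring

theorem norm_mob_sq_lt {a w : ℂ} (ha : ‖a‖ < 1) (hw : ‖w‖ < 1) (haw : w ≠ a) :
    ‖mob (a ^ 2) (w ^ 2)‖ < ‖mob a w‖ := by
  have ha2 : ‖a ^ 2‖ < 1 := by rw [norm_pow]; nlinarith [norm_nonneg a]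
  have hw2 : ‖w ^ 2‖ < 1 := by rw [norm_pow]; nlinarith [norm_nonneg w]
  have h1 : 0 < ‖1 - starRingEnd ℂ a * w‖ := norm_pos_iff.2 (one_sub_conj_mul_ne_zero ha hw)
  have h2 := norm_sub_lt_norm_one_sub (a := -a) (by simpa using ha) hw
  have h3 : 0 < ‖w - a‖ := norm_pos_iff.2 (sub_ne_zero.2 haw)
  rw [map_neg, sub_neg_eq_add, neg_mul, sub_neg_eq_add] at h2
  have h4 : 0 < ‖1 + starRingEnd ℂ a * w‖ := (norm_nonneg _).trans_lt h2
  have e1 : mob (a ^ 2) (w ^ 2) =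
      ((w - a) * (w + a)) / ((1 - starRingEnd ℂ a * w) * (1 + starRingEnd ℂ a * w)) := by
    rw [mob, map_pow]; congr 1 <;> ring
  rw [e1, mob, norm_div, norm_div, norm_mul, norm_mul,
    div_lt_div_iff₀ (mul_pos h1 h4) h1]
  have : 0 < ‖w - a‖ * ‖1 - starRingEnd ℂ a * w‖ := mul_pos h3 h1
  nlinarith

theorem differentiableOn_mob_comp {V : Set ℂ} {f : ℂ → ℂ} (hf : DifferentiableOn ℂ f V)
    (hm : MapsTo f V (ball 0 1)) {a : ℂ} (ha : ‖a‖ < 1) :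
    DifferentiableOn ℂ (fun z => mob a (f z)) V := by
  unfold mob
  refine DifferentiableOn.div (by fun_prop) (by fun_prop) fun z hz => ?_
  exact one_sub_conj_mul_ne_zero ha (mem_ball_zero_iff.1 (hm hz))

theorem injOn_mob_comp {V : Set ℂ} {f : ℂ → ℂ} (hi : InjOn f V)
    (hm : MapsTo f V (ball 0 1)) {a : ℂ} (ha : ‖a‖ < 1) :
    InjOn (fun z => mob a (f z)) V := by
  intro x hx y hy hxy
  have := congrArg (mob (-a)) hxy
  simp only at this
  rw [mob_neg_mob ha (mem_ball_zero_iff.1 (hm hx)), mob_neg_mob ha (mem_ball_zero_iff.1 (hm hy))]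
    at this
  exact hi hx hy this

theorem differentiableOn_of_sq {V : Set ℂ} (hVo : IsOpen V) {s φ : ℂ → ℂ} (hs : ContinuousOn s V)
    (hφ : DifferentiableOn ℂ φ V) (h : ∀ z ∈ V, s z ^ 2 = φ z) (h0 : ∀ z ∈ V, s z ≠ 0) :
    DifferentiableOn ℂ s V := by
  intro z hz
  have hsz : ContinuousAt s z := hs.continuousAt (hVo.mem_nhds hz)
  have hd := ((hφ.differentiableAt (hVo.mem_nhds hz)).hasDerivAt)
  rw [hasDerivAt_iff_tendsto_slope] at hd
  have h2 : s z + s z ≠ 0 := by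
    rw [← two_mul]; exact mul_ne_zero two_ne_zero (h0 z hz)
  have hsum : Tendsto (fun w => s w + s z) (𝓝[≠] z) (𝓝 (s z + s z)) :=
    (hsz.add continuousAt_const).mono_left nhdsWithin_le_nhds
  have key : HasDerivAt s (deriv φ z / (s z + s z)) z := by
    rw [hasDerivAt_iff_tendsto_slope]
    refine (hd.div hsum h2).congr' ?_
    filter_upwards [hsum.eventually_ne h2, mem_nhdsWithin_of_mem_nhds (hVo.mem_nhds hz)] with w hw hwV
    rw [Pi.div_apply, slope_def_field, slope_def_field, ← h w hwV, ← h z hz, div_right_comm]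
    congr 1
    rw [div_eq_iff hw]; ring
  exact key.differentiableAt.differentiableWithinAt

end

section

open Filter Topology

theorem isOpen_image_of_injOn {V : Set ℂ} (hVo : IsOpen V) (hVc : IsPreconnected V) {f : ℂ → ℂ}
    (hd : DifferentiableOn ℂ f V) (hi : InjOn f V) : ∀ U ⊆ V, IsOpen U → IsOpen (f '' U) := by
  rcases (hd.analyticOnNhd hVo).is_constant_or_isOpen hVc with ⟨w, hw⟩ | h
  · intro U hUV hU
    rcases U.eq_empty_or_nonempty with rfl | ⟨x, hx⟩
    · simp
    exfalso
    obtain ⟨r, hr, hrU⟩ := Metric.isOpen_iff.1 hU x hx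
    obtain ⟨y, hy, hyx⟩ := exists_mem_ball_ne x hr
    exact hyx (hi (hUV (hrU hy)) (hUV hx) ((hw _ (hUV (hrU hy))).trans (hw _ (hUV hx)).symm))
  · exact h

theorem exists_improvement {V : Set ℂ} (hVo : IsOpen V) (hVc : IsConnected V)
    (hVb : Bornology.IsBounded V) (hE : IsPreconnected Vᶜ) {z₀ z₁ : ℂ} (hz₀ : z₀ ∈ V)
    (hz₁ : z₁ ∈ V) (hne : z₁ ≠ z₀) {f : ℂ → ℂ}
    (hd : DifferentiableOn ℂ f V) (hi : InjOn f V) (hm : MapsTo f V (ball 0 1)) (hf₀ : f z₀ = 0)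
    {a : ℂ} (ha : ‖a‖ < 1) (haf : a ∉ f '' V) :
    ∃ h : ℂ → ℂ, DifferentiableOn ℂ h V ∧ InjOn h V ∧ MapsTo h V (ball 0 1) ∧ h z₀ = 0 ∧
      ‖f z₁‖ < ‖h z₁‖ := by
  have ha0 : a ≠ 0 := fun h => haf ⟨z₀, hz₀, by rw [hf₀, h]⟩
  have hca : starRingEnd ℂ a ≠ 0 := (map_ne_zero _).2 ha0
  set b := (starRingEnd ℂ a)⁻¹ with hb
  have hbf : b ∉ f '' V := by
    rintro ⟨z, hz, hzb⟩
    have := hm hz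
    rw [hzb, mem_ball_zero_iff, hb, norm_inv, RCLike.norm_conj] at this
    exact (one_lt_inv₀ (norm_pos_iff.2 ha0)).2 ha |>.not_gt this
  obtain ⟨l, hl, hl'⟩ := hasLogOn_of_injOn hVo hVc hVb hE hd.continuousOn hi
    (isOpen_image_of_injOn hVo hVc.isPreconnected hd hi) haf hbf
  set φ : ℂ → ℂ := fun z => mob a (f z) with hφ
  have hφd : DifferentiableOn ℂ φ V := differentiableOn_mob_comp hd hm ha
  have hφi : InjOn φ V := injOn_mob_comp hi hm ha
  have hφm : ∀ z ∈ V, ‖φ z‖ < 1 := fun z hz => norm_mob_lt ha (mem_ball_zero_iff.1 (hm hz))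
  set s : ℂ → ℂ := fun z => Complex.exp ((l z + Complex.log (-b)) / 2) with hs
  have hb0 : -b ≠ 0 := neg_ne_zero.2 (inv_ne_zero hca)
  have hsφ : ∀ z ∈ V, s z ^ 2 = φ z := by
    intro z hz
    have h1 := one_sub_conj_mul_ne_zero ha (mem_ball_zero_iff.1 (hm hz))
    have h2 : f z - b ≠ 0 := fun h => hbf ⟨z, hz, sub_eq_zero.1 h⟩
    rw [hs, hφ, ← Complex.exp_nat_mul]
    simp only [Nat.cast_ofNat]
    rw [mul_div_cancel₀ _ two_ne_zero, Complex.exp_add, hl' z hz, Complex.exp_log hb0, mob]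
    rw [div_mul_eq_mul_div, div_eq_div_iff h2 h1]
    have : starRingEnd ℂ a * b = 1 := mul_inv_cancel₀ hca
    linear_combination (f z - a) * (f z) * this
  have hs0 : ∀ z ∈ V, s z ≠ 0 := fun z _ => Complex.exp_ne_zero _
  have hsc : ContinuousOn s V := by fun_prop
  have hsd := differentiableOn_of_sq hVo hsc hφd hsφ hs0
  have hsm : MapsTo s V (ball 0 1) := by
    intro z hz
    rw [mem_ball_zero_iff]
    have := hφm z hz
    rw [← hsφ z hz, norm_pow] at this
    exact (pow_lt_one_iff_of_nonneg (norm_nonneg _) two_ne_zero).1 this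
  have hsi : InjOn s V := fun x hx y hy hxy => hφi hx hy (by rw [← hsφ x hx, ← hsφ y hy, hxy])
  have hs₀ : ‖s z₀‖ < 1 := mem_ball_zero_iff.1 (hsm hz₀)
  refine ⟨fun z => mob (s z₀) (s z), differentiableOn_mob_comp hsd hsm hs₀,
    injOn_mob_comp hsi hsm hs₀, fun z hz => ?_, by simp [mob], ?_⟩
  · rw [mem_ball_zero_iff]
    exact norm_mob_lt hs₀ (mem_ball_zero_iff.1 (hsm hz))
  · have h1 := norm_mob_sq_lt hs₀ (mem_ball_zero_iff.1 (hsm hz₁))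
      (fun h => hne (hsi hz₁ hz₀ h))
    rw [hsφ z₀ hz₀, hsφ z₁ hz₁] at h1
    have h2 : φ z₀ = -a := by simp [hφ, mob, hf₀]
    have h3 : mob (-a) (φ z₁) = f z₁ := mob_neg_mob ha (mem_ball_zero_iff.1 (hm hz₁))
    rwa [h2, h3] at h1

theorem exists_biholomorphism {V : Set ℂ} (hVo : IsOpen V) (hVc : IsConnected V)
    (hVb : Bornology.IsBounded V) (hE : IsPreconnected Vᶜ) :
    ∃ f : ℂ → ℂ, DifferentiableOn ℂ f V ∧ InjOn f V ∧ f '' V = ball 0 1 := by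
  obtain ⟨z₀, hz₀⟩ := hVc.nonempty
  obtain ⟨z₁, hz₁, hne⟩ : ∃ z₁ ∈ V, z₁ ≠ z₀ := by
    obtain ⟨r, hr, hrU⟩ := Metric.isOpen_iff.1 hVo z₀ hz₀
    obtain ⟨y, hy, hyx⟩ := exists_mem_ball_ne z₀ hr
    exact ⟨y, hrU hy, hyx⟩
  set 𝓕 : Set (ℂ → ℂ) := {f | DifferentiableOn ℂ f V ∧ InjOn f V ∧ MapsTo f V (ball 0 1) ∧
    f z₀ = 0} with h𝓕
  have hne𝓕 : 𝓕.Nonempty := by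
    obtain ⟨R, hR, hVR⟩ := hVb.subset_ball_lt 0 z₀
    refine ⟨fun z => (z - z₀) / R, by fun_prop, fun x _ y _ hxy => ?_, fun z hz => ?_, by simp⟩
    · have hR' : (R : ℂ) ≠ 0 := by exact_mod_cast hR.ne'
      simpa [div_left_inj' hR'] using hxy
    · rw [mem_ball_zero_iff, norm_div, Complex.norm_real, Real.norm_of_nonneg hR.le, div_lt_one hR,
        ← dist_eq_norm]
      exact hVR hz
  set T := (fun f : ℂ → ℂ => ‖f z₁‖) '' 𝓕
  have hTb : BddAbove T := by
    refine ⟨1, ?_⟩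
    rintro _ ⟨f, hf, rfl⟩
    exact (mem_ball_zero_iff.1 (hf.2.2.1 hz₁)).le
  obtain ⟨u, -, hu, huT⟩ := exists_seq_tendsto_sSup (hne𝓕.image _ : T.Nonempty) hTb
  choose f hf𝓕 hfu using huT
  obtain ⟨F, hF⟩ := exists_ultrafilter_limit hVo (fun n => (hf𝓕 n).1) fun n => (hf𝓕 n).2.2.1
  have hFz : ∀ z ∈ V, Tendsto (fun n => f n z) (hyperfilter ℕ : Filter ℕ) (𝓝 (F z)) :=
    fun z hz => hF.tendsto_at hz
  have hF₀ : F z₀ = 0 := by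
    refine tendsto_nhds_unique (hFz z₀ hz₀) ?_
    simp only [(hf𝓕 _).2.2.2, tendsto_const_nhds_iff]
  have hF₁ : ‖F z₁‖ = sSup T := by
    refine tendsto_nhds_unique (hFz z₁ hz₁).norm ?_
    have h1 : (fun n => ‖f n z₁‖) = u := funext hfu
    rw [h1]
    exact hu.mono_left (Nat.hyperfilter_le_atTop)
  obtain ⟨f₀, hf₀⟩ := hne𝓕
  have hpos : 0 < ‖F z₁‖ := by
    rw [hF₁]
    refine lt_of_lt_of_le ?_ (le_csSup hTb ⟨f₀, hf₀, rfl⟩)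
    rw [norm_pos_iff]
    intro h
    exact hne (hf₀.2.1 hz₁ hz₀ (h.trans hf₀.2.2.2.symm))
  have hFd : DifferentiableOn ℂ F V :=
    hF.differentiableOn (Eventually.of_forall fun n => (hf𝓕 n).1) hVo
  have hFi : InjOn F V := injOn_limit hVo hVc.isPreconnected hF (fun n => (hf𝓕 n).1)
    (fun n => (hf𝓕 n).2.1) hz₀ hz₁ (fun h => by rw [← h, hF₀, norm_zero] at hpos; exact lt_irrefl _ hpos)
  have hFo := isOpen_image_of_injOn hVo hVc.isPreconnected hFd hFi
  have hFm : MapsTo F V (ball 0 1) := by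
    have h1 : F '' V ⊆ closedBall 0 1 := by
      rintro _ ⟨z, hz, rfl⟩
      refine isClosed_closedBall.mem_of_tendsto (hFz z hz)
        (Eventually.of_forall fun n => ball_subset_closedBall ((hf𝓕 n).2.2.1 hz))
    have h2 : F '' V ⊆ ball 0 1 := by
      rw [← interior_closedBall (0 : ℂ) one_ne_zero]
      exact interior_maximal h1 (hFo V Subset.rfl hVo)
    exact mapsTo_iff_image_subset.2 h2
  refine ⟨F, hFd, hFi, Subset.antisymm (mapsTo_iff_image_subset.1 hFm) fun a ha => ?_⟩
  by_contra haF
  obtain ⟨h, h1, h2, h3, h4, h5⟩ := exists_improvement hVo hVc hVb hE hz₀ hz₁ hne hFd hFi hFm hF₀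
    (mem_ball_zero_iff.1 ha) haF
  have := le_csSup hTb ⟨h, ⟨h1, h2, h3, h4⟩, rfl⟩
  rw [← hF₁] at this
  exact absurd h5 (not_lt.2 this)

/-- Riemann mapping theorem for bounded domains with connected complement, in terms of the map
from the disc. -/
theorem exists_riemann_map {V : Set ℂ} (hVo : IsOpen V) (hVc : IsConnected V)
    (hVb : Bornology.IsBounded V) (hE : IsPreconnected Vᶜ) :
    ∃ g f : ℂ → ℂ, DifferentiableOn ℂ g (ball 0 1) ∧ InjOn g (ball 0 1) ∧ g '' ball 0 1 = V ∧
      ContinuousOn f V ∧ (∀ z ∈ V, f z ∈ ball 0 1 ∧ g (f z) = z) ∧ ∀ w ∈ ball 0 1, f (g w) = w := by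
  classical
  obtain ⟨f, hd, hi, him⟩ := exists_biholomorphism hVo hVc hVb hE
  have hop := isOpen_image_of_injOn hVo hVc.isPreconnected hd hi
  set g := Function.invFunOn f V
  have hg : LeftInvOn g f V := hi.leftInvOn_invFunOn
  have hgc : ContinuousOn g (ball 0 1) :=
    him ▸ continuousOn_leftInvOn_of_isOpen_image hVo hg hop
  have hfm : ∀ z ∈ V, f z ∈ ball (0 : ℂ) 1 := fun z hz => him ▸ ⟨z, hz, rfl⟩
  have hfg : ∀ w ∈ ball (0 : ℂ) 1, f (g w) = w := by
    intro w hw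
    rw [← him] at hw
    obtain ⟨z, hz, rfl⟩ := hw
    rw [hg hz]
  have hgV : ∀ w ∈ ball (0 : ℂ) 1, g w ∈ V := by
    intro w hw
    rw [← him] at hw
    obtain ⟨z, hz, rfl⟩ := hw
    rwa [hg hz]
  have hgi : InjOn g (ball 0 1) := fun x hx y hy hxy => by
    rw [← hfg x hx, ← hfg y hy, hxy]
  refine ⟨g, f, ?_, hgi, ?_, hd.continuousOn, fun z hz => ⟨hfm z hz, hg hz⟩, hfg⟩
  · have hgood : ∀ w ∈ ball (0 : ℂ) 1, deriv f (g w) ≠ 0 → DifferentiableAt ℂ g w := by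
      intro w hw h0
      have h1 : HasDerivAt f (deriv f (g w)) (g w) :=
        (hd.differentiableAt (hVo.mem_nhds (hgV w hw))).hasDerivAt
      refine (HasDerivAt.of_local_left_inverse (hgc.continuousAt (isOpen_ball.mem_nhds hw)) h1 h0
        ?_).differentiableAt
      filter_upwards [isOpen_ball.mem_nhds hw] with y hy using hfg y hy
    intro w hw
    refine (Complex.analyticAt_of_differentiable_on_punctured_nhds_of_continuousAt ?_
      (hgc.continuousAt (isOpen_ball.mem_nhds hw))).differentiableAt.differentiableWithinAt
    have hz := hgV w hw
    have ha : AnalyticAt ℂ (deriv f) (g w) := ((hd.analyticOnNhd hVo) _ hz).deriv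
    have hev : ∀ᶠ z in 𝓝[≠] (g w), deriv f z ≠ 0 := by
      rcases ha.eventually_eq_zero_or_eventually_ne_zero with h | h
      · exfalso
        obtain ⟨r, hr, hrs⟩ := Metric.nhds_basis_ball.mem_iff.1 (h.and (hVo.mem_nhds hz))
        obtain ⟨y, hy, hyx⟩ := exists_mem_ball_ne (g w) hr
        exact hyx (hi (hrs hy).2 hz ((isOpen_ball (x := g w) (ε := r)).is_const_of_deriv_eq_zero
          (convex_ball (g w) r).isPreconnected (hd.mono fun z hz' => (hrs hz').2)
          (fun z hz' => (hrs hz').1) hy (mem_ball_self hr)))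
      · exact h
    have htend : Tendsto g (𝓝[≠] w) (𝓝[≠] (g w)) := by
      refine tendsto_nhdsWithin_iff.2 ⟨(hgc.continuousAt (isOpen_ball.mem_nhds hw)).mono_left
        nhdsWithin_le_nhds, ?_⟩
      filter_upwards [self_mem_nhdsWithin, mem_nhdsWithin_of_mem_nhds (isOpen_ball.mem_nhds hw)]
        with y hy hyb h
      exact hy (hgi hyb hw h)
    filter_upwards [htend.eventually hev, mem_nhdsWithin_of_mem_nhds (isOpen_ball.mem_nhds hw)]
      with y hy hyb using hgood y hyb hy
  · exact Subset.antisymm (image_subset_iff.2 hgV) fun z hz => ⟨f z, hfm z hz, hg hz⟩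

end

section

open Filter Topology

theorem lintegral_sq_norm_deriv {V : Set ℂ} (hVo : IsOpen V) {G : ℂ → ℂ}
    (hd : DifferentiableOn ℂ G V) (hi : InjOn G V) :
    ∫⁻ w in V, ENNReal.ofReal (‖deriv G w‖ ^ 2) = volume (G '' V) := by
  rw [← lintegral_abs_det_fderiv_eq_addHaar_image volume hVo.measurableSet
    (f' := fun w => (fderiv ℂ G w).restrictScalars ℝ) (fun x hx => ?_) hi]
  · congr 1; ext w
    congr 1
    rw [ContinuousLinearMap.det, ContinuousLinearMap.coe_restrictScalars,
      LinearMap.det_restrictScalars, Algebra.norm_complex_apply]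
    have : LinearMap.det (fderiv ℂ G w : ℂ →ₗ[ℂ] ℂ) = deriv G w := by
      rw [LinearMap.det_ring]; simp
    rw [this, Complex.normSq_eq_norm_sq, abs_of_nonneg (by positivity)]
  · exact ((hd.differentiableAt (hVo.mem_nhds hx)).hasFDerivAt.restrictScalars ℝ).hasFDerivWithinAt

/-- Points of a small circle about `0` inside the disc `ball 1 1`, in terms of the angle. -/
theorem mem_ball_one_iff {r θ : ℝ} (hr : 0 < r) :
    Complex.polarCoord.symm (r, θ) ∈ ball (1 : ℂ) 1 ↔ r / 2 < Real.cos θ := by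
  rw [Complex.polarCoord_symm_apply, mem_ball, dist_eq_norm, ← sq_lt_sq₀ (norm_nonneg _) zero_le_one,
    ← Complex.normSq_eq_norm_sq, Complex.normSq_apply]
  have h1 := Real.sin_sq_add_cos_sq θ
  simp [Complex.cos_ofReal_re, Complex.sin_ofReal_re, Complex.cos_ofReal_im, Complex.sin_ofReal_im]
  have h2 : (r * Real.cos θ - 1) * (r * Real.cos θ - 1) + r * Real.sin θ * (r * Real.sin θ)
      = r * r - 2 * r * Real.cos θ + 1 := by linear_combination r * r * h1
  rw [h2]
  constructor
  · intro h; by_contra! h'; nlinarith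
  · intro h; nlinarith

theorem cos_gt_of_mem_Icc {c θ₁ θ₂ θ : ℝ} (h₁ : θ₁ ∈ Ioc (-Real.pi) Real.pi)
    (h₂ : θ₂ ∈ Ioc (-Real.pi) Real.pi) (hc₁ : c < Real.cos θ₁) (hc₂ : c < Real.cos θ₂)
    (h : θ ∈ Icc θ₁ θ₂) : c < Real.cos θ := by
  have hpi := Real.pi_pos
  rw [← Real.cos_abs] at hc₁ hc₂ ⊢
  have ha₁ : |θ₁| ≤ Real.pi := abs_le.2 ⟨h₁.1.le, h₁.2⟩
  have ha₂ : |θ₂| ≤ Real.pi := abs_le.2 ⟨h₂.1.le, h₂.2⟩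
  rcases le_total 0 θ with h0 | h0
  · refine hc₂.trans_le (Real.cos_le_cos_of_nonneg_of_le_pi (abs_nonneg _) ha₂ ?_)
    rw [abs_of_nonneg h0]; exact h.2.trans (le_abs_self _)
  · refine hc₁.trans_le (Real.cos_le_cos_of_nonneg_of_le_pi (abs_nonneg _) ha₁ ?_)
    rw [abs_of_nonpos h0]; exact (neg_le_neg h.1).trans (neg_le_abs _)

theorem exists_small_energy {A : ℝ → ℝ≥0∞} (hA : ∫⁻ r in Ioi (0 : ℝ), A r < ⊤) {η r₀ : ℝ}
    (hη : 0 < η) (hr₀ : 0 < r₀) : ∃ r ∈ Ioo 0 r₀, A r < ENNReal.ofReal (η / r) := by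
  by_contra! hcon
  have h1 : ∫⁻ r in Ioo (0 : ℝ) r₀, ENNReal.ofReal (η / r) < ⊤ := by
    refine lt_of_le_of_lt ?_ hA
    refine (setLIntegral_mono' measurableSet_Ioo hcon).trans
      (lintegral_mono_set fun r hr => hr.1)
  have h2 : IntegrableOn (fun r : ℝ => η / r) (Ioo 0 r₀) := by
    refine ⟨by fun_prop, ?_⟩
    rw [hasFiniteIntegral_iff_ofReal]
    · exact h1
    · filter_upwards [ae_restrict_mem measurableSet_Ioo] with r hr
      exact (div_pos hη hr.1).le
  have h3 : IntervalIntegrable (fun r : ℝ => r⁻¹) volume 0 r₀ := by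
    rw [intervalIntegrable_iff_integrableOn_Ioo_of_le hr₀.le]
    refine (h2.const_mul η⁻¹).congr (Eventually.of_forall fun r => ?_)
    simp only [div_eq_mul_inv]
    rw [inv_mul_cancel_left₀ hη.ne']
  rw [intervalIntegrable_inv_iff] at h3
  rcases h3 with h3 | h3
  · exact hr₀.ne h3
  · exact h3 left_mem_uIcc

/-- Length–area estimate: a bounded univalent function on a disc has small oscillation on
arbitrarily small circular crosscuts about a boundary point. -/
theorem exists_small_crosscut {G : ℂ → ℂ} (hd : DifferentiableOn ℂ G (ball 1 1))
    (hi : InjOn G (ball 1 1)) (hb : Bornology.IsBounded (G '' ball 1 1)) {ε r₀ : ℝ} (hε : 0 < ε)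
    (hr₀ : 0 < r₀) : ∃ r ∈ Ioo 0 r₀, ∀ w ∈ ball (1 : ℂ) 1, ∀ w' ∈ ball (1 : ℂ) 1, ‖w‖ = r →
      ‖w'‖ = r → dist (G w) (G w') ≤ ε := by
  set f : ℂ → ℝ≥0∞ := (ball (1 : ℂ) 1).indicator fun w => ENNReal.ofReal (‖deriv G w‖ ^ 2) with hf
  have hfm : Measurable f := by
    refine Measurable.indicator ?_ measurableSet_ball
    exact ((measurable_deriv G).norm.pow_const 2).ennreal_ofReal
  have htot : ∫⁻ w, f w < ⊤ := by
    rw [hf, lintegral_indicator measurableSet_ball, lintegral_sq_norm_deriv isOpen_ball hd hi]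
    exact hb.measure_lt_top
  set P : ℝ → ℝ → ℂ := fun r θ => Complex.polarCoord.symm (r, θ) with hP
  have hPe : ∀ r θ, P r θ = circleMap 0 r θ := by
    intro r θ
    rw [hP, circleMap_zero, Complex.exp_mul_I]
    simp only
    rw [Complex.polarCoord_symm_apply]; simp
  set A : ℝ → ℝ≥0∞ := fun r => ∫⁻ θ in Ioo (-Real.pi) Real.pi, ENNReal.ofReal r * f (P r θ)
    with hAdef
  have hA : ∫⁻ r in Ioi (0 : ℝ), A r < ⊤ := by
    rw [← Complex.lintegral_comp_polarCoord_symm, polarCoord_target] at htot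
    rw [Measure.volume_eq_prod, ← Measure.prod_restrict] at htot
    refine lt_of_eq_of_lt ?_ htot
    rw [lintegral_prod]
    · rfl
    · refine Measurable.aemeasurable ?_
      refine Measurable.mul (by fun_prop) (hfm.comp ?_)
      have : ⇑Complex.polarCoord.symm = fun p : ℝ × ℝ => circleMap 0 p.1 p.2 :=
        funext fun p => hPe p.1 p.2
      rw [this]
      unfold circleMap
      fun_prop
  have hpi := Real.pi_pos
  set c := ε / (2 * Real.pi) with hc
  have hc0 : 0 < c := by positivity
  obtain ⟨r, hr, hAr⟩ := exists_small_energy hA (η := c * ε) (by positivity) hr₀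
  refine ⟨r, hr, ?_⟩
  have hr0 := hr.1
  have key : ∀ θ₁ ∈ Ioc (-Real.pi) Real.pi, ∀ θ₂ ∈ Ioc (-Real.pi) Real.pi, θ₁ ≤ θ₂ →
      P r θ₁ ∈ ball (1 : ℂ) 1 → P r θ₂ ∈ ball (1 : ℂ) 1 →
      dist (G (P r θ₂)) (G (P r θ₁)) ≤ ε := by
    intro θ₁ h₁ θ₂ h₂ h₁₂ hb₁ hb₂
    have hsub : ∀ θ ∈ Icc θ₁ θ₂, P r θ ∈ ball (1 : ℂ) 1 := by
      intro θ hθ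
      rw [mem_ball_one_iff hr0] at hb₁ hb₂ ⊢
      exact cos_gt_of_mem_Icc h₁ h₂ hb₁ hb₂ hθ
    have hPd : ∀ θ, HasDerivAt (P r) (circleMap 0 r θ * Complex.I) θ := by
      intro θ
      have : P r = circleMap 0 r := funext (hPe r)
      rw [this]; exact hasDerivAt_circleMap 0 r θ
    have hPc : Continuous (P r) := continuous_iff_continuousAt.2 fun θ => (hPd θ).continuousAt
    have hG : ∀ θ ∈ Icc θ₁ θ₂, HasDerivAt (fun θ => G (P r θ))
        (deriv G (P r θ) * (circleMap 0 r θ * Complex.I)) θ := by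
      intro θ hθ
      exact (hd.differentiableAt (isOpen_ball.mem_nhds (hsub θ hθ))).hasDerivAt.comp θ (hPd θ)
    have hdc : ContinuousOn (fun θ => deriv G (P r θ)) (Icc θ₁ θ₂) :=
      ((hd.deriv isOpen_ball).continuousOn).comp hPc.continuousOn hsub
    have hcm : Continuous (circleMap 0 r) := continuous_circleMap 0 r
    have hint := intervalIntegral.integral_eq_sub_of_hasDerivAt (a := θ₁) (b := θ₂)
      (f := fun θ => G (P r θ)) (by rw [uIcc_of_le h₁₂]; exact hG)
      (ContinuousOn.intervalIntegrable (by rw [uIcc_of_le h₁₂]; fun_prop))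
    set q : ℝ → ℝ := fun θ => r * ‖deriv G (P r θ)‖ ^ 2 with hq
    have hqc : ContinuousOn q (Icc θ₁ θ₂) := by fun_prop
    have hqi : IntervalIntegrable q volume θ₁ θ₂ :=
      ContinuousOn.intervalIntegrable (by rwa [uIcc_of_le h₁₂])
    have hqint : ∫ θ in θ₁..θ₂, q θ ≤ c * ε / r := by
      rw [intervalIntegral.integral_of_le h₁₂, integral_Ioc_eq_integral_Ioo,
        integral_eq_lintegral_of_nonneg_ae (Eventually.of_forall fun θ => by positivity)
        ((hqc.mono Ioo_subset_Icc_self).aestronglyMeasurable measurableSet_Ioo)]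
      refine ENNReal.toReal_le_of_le_ofReal (by positivity) (le_trans ?_ hAr.le)
      rw [hAdef]
      refine le_trans (setLIntegral_mono' measurableSet_Ioo (g := fun θ => ENNReal.ofReal r * f (P r θ))
        fun θ hθ => ?_)
        (lintegral_mono_set (Ioo_subset_Ioo h₁.1.le h₂.2))
      rw [hf, indicator_of_mem (hsub θ (Ioo_subset_Icc_self hθ)), ← ENNReal.ofReal_mul hr0.le]
    rw [dist_eq_norm, ← hint]
    have hbound : ∀ θ, ‖deriv G (P r θ) * (circleMap 0 r θ * Complex.I)‖ ≤
        r / (2 * c) * q θ + c / 2 := by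
      intro θ
      rw [norm_mul, norm_mul, Complex.norm_I, norm_circleMap_zero, mul_one, abs_of_pos hr0, hq]
      have h3 : r / (2 * c) * (r * ‖deriv G (P r θ)‖ ^ 2) + c / 2
          - ‖deriv G (P r θ)‖ * r = (‖deriv G (P r θ)‖ * r - c) ^ 2 / (2 * c) := by
        field_simp; ring
      have h4 : 0 ≤ (‖deriv G (P r θ)‖ * r - c) ^ 2 / (2 * c) := by positivity
      linarith
    have hstep := intervalIntegral.norm_integral_le_of_norm_le h₁₂
      (g := fun θ => r / (2 * c) * q θ + c / 2) (μ := volume)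
      (Eventually.of_forall fun θ _ => hbound θ)
      ((hqi.const_mul _).add intervalIntegrable_const)
    refine hstep.trans ?_
    rw [intervalIntegral.integral_add (hqi.const_mul _) intervalIntegrable_const,
      intervalIntegral.integral_const_mul, intervalIntegral.integral_const, smul_eq_mul]
    have h5 : r / (2 * c) * ∫ θ in θ₁..θ₂, q θ ≤ r / (2 * c) * (c * ε / r) :=
      mul_le_mul_of_nonneg_left hqint (by positivity)
    have h6 : r / (2 * c) * (c * ε / r) = ε / 2 := by field_simp
    have h7 : (θ₂ - θ₁) * (c / 2) ≤ 2 * Real.pi * (c / 2) :=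
      mul_le_mul_of_nonneg_right (by linarith [h₁.1, h₂.2]) (by positivity)
    have h8 : 2 * Real.pi * (c / 2) = ε / 2 := by rw [hc]; field_simp
    linarith
  have harg : ∀ w : ℂ, ‖w‖ = r → ∃ θ ∈ Ioc (-Real.pi) Real.pi, P r θ = w := by
    intro w hw
    refine ⟨w.arg, Complex.arg_mem_Ioc w, ?_⟩
    rw [hPe, circleMap_zero, ← hw, Complex.norm_mul_exp_arg_mul_I]
  intro w hw w' hw' hwr hwr'
  obtain ⟨θ₁, h₁, rfl⟩ := harg w hwr
  obtain ⟨θ₂, h₂, rfl⟩ := harg w' hwr'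
  rcases le_total θ₁ θ₂ with h | h
  · rw [dist_comm]; exact key θ₁ h₁ θ₂ h₂ h hw hw'
  · exact key θ₂ h₂ θ₁ h₁ h hw' hw

end

section

open Filter Topology

theorem exists_small_crosscut_at {g : ℂ → ℂ} (hd : DifferentiableOn ℂ g (ball 0 1))
    (hi : InjOn g (ball 0 1)) (hb : Bornology.IsBounded (g '' ball 0 1)) {ζ : ℂ} (hζ : ‖ζ‖ = 1)
    {ε r₀ : ℝ} (hε : 0 < ε) (hr₀ : 0 < r₀) : ∃ r ∈ Ioo 0 r₀, ∀ z ∈ ball (0 : ℂ) 1,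
      ∀ z' ∈ ball (0 : ℂ) 1, dist z ζ = r → dist z' ζ = r → dist (g z) (g z') ≤ ε := by
  have hζ0 : ζ ≠ 0 := norm_pos_iff.1 (by rw [hζ]; exact one_pos)
  have hm : MapsTo (fun w => ζ * (1 - w)) (ball (1 : ℂ) 1) (ball 0 1) := by
    intro w hw
    rw [mem_ball_zero_iff, norm_mul, hζ, one_mul, ← dist_eq_norm, dist_comm]
    exact hw
  have hinv : ∀ z ∈ ball (0 : ℂ) 1, 1 - z / ζ ∈ ball (1 : ℂ) 1 := by
    intro z hz
    rw [mem_ball, dist_eq_norm, sub_sub_cancel_left, norm_neg, norm_div, hζ, div_one]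
    exact mem_ball_zero_iff.1 hz
  have heq : ∀ z, ζ * (1 - (1 - z / ζ)) = z := fun z => by field_simp; ring
  have hnorm : ∀ z, ‖1 - z / ζ‖ = dist z ζ := by
    intro z
    have : 1 - z / ζ = (ζ - z) / ζ := by field_simp
    rw [this, norm_div, hζ, div_one, dist_comm, dist_eq_norm]
  obtain ⟨r, hr, h⟩ := exists_small_crosscut (G := fun w => g (ζ * (1 - w)))
    (hd.comp (by fun_prop) hm) (fun w hw w' hw' h => by
      have := hi (hm hw) (hm hw') h
      simpa [hζ0] using this) (hb.subset (by
      rintro _ ⟨w, hw, rfl⟩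
      exact ⟨_, hm hw, rfl⟩)) hε hr₀
  refine ⟨r, hr, fun z hz z' hz' hzr hzr' => ?_⟩
  have := h _ (hinv z hz) _ (hinv z' hz') (by rw [hnorm, hzr]) (by rw [hnorm, hzr'])
  simpa only [heq] using this

theorem exists_norm_eq_on_sphere {ζ : ℂ} (hζ : ‖ζ‖ = 1) {r c : ℝ} (hr : r ∈ Ioo (0 : ℝ) 1)
    (hc : c ∈ Icc (1 - r) (1 + r)) : ∃ z, dist z ζ = r ∧ ‖z‖ = c := by
  have hp : IsPreconnected (sphere ζ r) :=
    isPreconnected_sphere (by rw [Complex.rank_real_complex]; norm_num) ζ r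
  have h1 : (1 - r : ℝ) • ζ ∈ sphere ζ r := by
    rw [mem_sphere, dist_eq_norm, sub_smul, one_smul, sub_sub_cancel_left, norm_neg, norm_smul, hζ,
      mul_one, Real.norm_of_nonneg hr.1.le]
  have h2 : (1 + r : ℝ) • ζ ∈ sphere ζ r := by
    rw [mem_sphere, dist_eq_norm, add_smul, one_smul, add_sub_cancel_left, norm_smul, hζ,
      mul_one, Real.norm_of_nonneg hr.1.le]
  have h3 : ‖(1 - r : ℝ) • ζ‖ = 1 - r := by
    rw [norm_smul, hζ, mul_one, Real.norm_of_nonneg (by linarith [hr.2])]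
  have h4 : ‖(1 + r : ℝ) • ζ‖ = 1 + r := by
    rw [norm_smul, hζ, mul_one, Real.norm_of_nonneg (by linarith [hr.1])]
  obtain ⟨z, hz, hzc⟩ := hp.intermediate_value h1 h2 (f := fun z => ‖z‖) continuous_norm.continuousOn
    (show c ∈ Icc ‖(1 - r : ℝ) • ζ‖ ‖(1 + r : ℝ) • ζ‖ by rwa [h3, h4])
  exact ⟨z, hz, hzc⟩

/-- The frontier of `V` is the union of an arbitrarily small continuum about `p` and a continuum
missing `p`, for each of its points `p`. -/
def CurveLike (J : Set ℂ) : Prop :=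
  ∀ p ∈ J, ∀ ε > 0, ∃ M N : Set ℂ, IsCompact M ∧ IsCompact N ∧ IsPreconnected M ∧
    IsPreconnected N ∧ M ∪ N = J ∧ p ∉ N ∧ M ⊆ closedBall p ε

theorem isPreconnected_compl_closedBall (p : ℂ) {r : ℝ} (hr : 0 < r) :
    IsPreconnected (closedBall p r)ᶜ := by
  have := (isPreconnected_norm_gt hr).image (fun z => z + p) (by fun_prop)
  convert this using 1
  ext z
  simp only [mem_compl_iff, mem_closedBall, not_le, mem_image, mem_ofPred_eq]
  exact ⟨fun h => ⟨z - p, by rwa [← dist_eq_norm], by ring⟩, by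
    rintro ⟨w, hw, rfl⟩; simpa [dist_eq_norm] using hw⟩

section
variable {V : Set ℂ} {g f : ℂ → ℂ}

theorem exists_boundary_limit (hVo : IsOpen V) (hVb : Bornology.IsBounded V)
    (hJ : CurveLike (frontier V)) (hd : DifferentiableOn ℂ g (ball 0 1)) (hi : InjOn g (ball 0 1))
    (hgV : g '' ball 0 1 = V) (hfc : ContinuousOn f V)
    (hgf : ∀ z ∈ V, f z ∈ ball (0 : ℂ) 1 ∧ g (f z) = z) (hfg : ∀ w ∈ ball (0 : ℂ) 1, f (g w) = w)
    {ζ : ℂ} (hζ : ‖ζ‖ = 1) : ∃ p ∈ frontier V, Tendsto g (𝓝[ball 0 1] ζ) (𝓝 p) := by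
  have hmem : ∀ w ∈ ball (0 : ℂ) 1, g w ∈ V := fun w hw => hgV ▸ ⟨w, hw, rfl⟩
  have hVp : IsPreconnected V := by
    rw [← hgV]; exact (convex_ball (0 : ℂ) 1).isPreconnected.image g hd.continuousOn
  have hJV : frontier V ⊆ Vᶜ := fun p hp hpV => by
    rw [hVo.frontier_eq] at hp; exact hp.2 hpV
  have hJc : IsCompact (frontier V) :=
    Metric.isCompact_of_isClosed_isBounded isClosed_frontier
      (hVb.closure.subset frontier_subset_closure)
  have hstep : ∀ n : ℕ, ∃ r ∈ Ioo (0 : ℝ) 1, ∃ p ∈ frontier V, ∀ z ∈ ball (0 : ℂ) 1,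
      dist z ζ = r → dist (g z) p ≤ 1 / (n + 1 : ℝ) := by
    intro n
    obtain ⟨r, hr, h⟩ := exists_small_crosscut_at hd hi (by rwa [hgV]) hζ
      (ε := 1 / (n + 1 : ℝ)) (by positivity) one_pos
    refine ⟨r, hr, ?_⟩
    set Q := g '' (ball 0 1 ∩ sphere ζ r)
    have hQV : Q ⊆ V := by
      rintro _ ⟨z, hz, rfl⟩; exact hmem z hz.1
    have hne : (closure Q ∩ frontier V).Nonempty := by
      by_contra hcon
      have hclV : closure Q ⊆ V := by
        intro q hq
        by_contra hqV
        exact hcon ⟨q, hq, by rw [hVo.frontier_eq]; exact ⟨closure_mono hQV hq, hqV⟩⟩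
      have hcpt : IsCompact (closure Q) :=
        Metric.isCompact_of_isClosed_isBounded isClosed_closure (hVb.subset hclV)
      obtain ⟨ρ, hρ, hsub⟩ : ∃ ρ < (1 : ℝ), f '' closure Q ⊆ closedBall 0 ρ := by
        have hfcl := (hcpt.image_of_continuousOn (hfc.mono hclV))
        rcases (f '' closure Q).eq_empty_or_nonempty with he | hne
        · exact ⟨0, one_pos, by rw [he]; exact empty_subset _⟩
        obtain ⟨w, ⟨q, hq, hqw⟩, hmax⟩ := hfcl.exists_isMaxOn hne continuous_norm.continuousOn
        refine ⟨‖w‖, by rw [← hqw]; exact mem_ball_zero_iff.1 (hgf q (hclV hq)).1, fun w' hw' => ?_⟩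
        rw [mem_closedBall_zero_iff]; exact hmax hw'
      obtain ⟨z, hz, hzc⟩ := exists_norm_eq_on_sphere hζ hr (c := (max ρ (1 - r) + 1) / 2)
        ⟨by linarith [le_max_right ρ (1 - r), hr.1], by
          have : max ρ (1 - r) < 1 := max_lt hρ (by linarith [hr.1])
          linarith [hr.1]⟩
      have hlt : max ρ (1 - r) < 1 := max_lt hρ (by linarith [hr.1])
      have hzb : z ∈ ball (0 : ℂ) 1 := by rw [mem_ball_zero_iff, hzc]; linarith
      have := hsub ⟨g z, subset_closure ⟨z, ⟨hzb, hz⟩, rfl⟩, hfg z hzb⟩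
      rw [mem_closedBall_zero_iff, hzc] at this
      linarith [le_max_left ρ (1 - r)]
    obtain ⟨p, hpQ, hpJ⟩ := hne
    refine ⟨p, hpJ, fun z hz hzr => ?_⟩
    have hcl : closure Q ⊆ closedBall (g z) (1 / (n + 1 : ℝ)) := by
      refine closure_minimal ?_ isClosed_closedBall
      rintro _ ⟨z', hz', rfl⟩
      exact h z' hz'.1 z hz hz'.2 hzr
    rw [dist_comm]; exact hcl hpQ
  choose r hr p hpJ hp using hstep
  obtain ⟨q, hq, φ, hφ, hlim⟩ := hJc.tendsto_subseq hpJ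
  refine ⟨q, hq, ?_⟩
  have hd0 : 0 < dist (g 0) q := dist_pos.2 fun h =>
    hJV hq (h ▸ hmem 0 (mem_ball_self one_pos))
  rw [Metric.tendsto_nhds]
  intro ε' hε'
  set ε := min (ε' / 2) (dist (g 0) q / 2) with hε
  have hε0 : 0 < ε := by positivity
  obtain ⟨M, N, hM, hN, hMp, -, hMN, hqN, hMε⟩ := hJ q hq ε hε0
  obtain ⟨δ₀, hδ₀, hδN⟩ := Metric.nhds_basis_closedBall.mem_iff.1 (hN.isClosed.isOpen_compl.mem_nhds hqN)
  set δ := min δ₀ ε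
  have hδ : 0 < δ := lt_min hδ₀ hε0
  have h1 : Tendsto (fun n : ℕ => 1 / ((φ n : ℝ) + 1) + dist (p (φ n)) q) atTop (𝓝 (0 + 0)) := by
    refine Tendsto.add (tendsto_one_div_add_atTop_nhds_zero_nat.comp hφ.tendsto_atTop) ?_
    exact tendsto_iff_dist_tendsto_zero.1 hlim
  rw [add_zero] at h1
  obtain ⟨n, hn⟩ := (h1.eventually (gt_mem_nhds hδ)).exists
  set ρ := r (φ n)
  have hρ : ρ ∈ Ioo (0 : ℝ) 1 := hr (φ n)
  have hQ : ∀ z ∈ ball (0 : ℂ) 1, dist z ζ = ρ → g z ∈ closedBall q δ := by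
    intro z hz hzr
    have := hp (φ n) z hz hzr
    rw [mem_closedBall]
    exact (dist_triangle _ (p (φ n)) _).trans (by linarith)
  have hF : closedBall q δ ∪ M ⊆ closedBall q ε :=
    union_subset (closedBall_subset_closedBall (min_le_right _ _)) hMε
  have hint : (closedBall q δ ∪ M) ∩ frontier V = M := by
    ext z
    constructor
    · rintro ⟨h | h, hz⟩
      · rw [← hMN] at hz
        exact hz.elim id fun hzN => absurd hzN
          (hδN (closedBall_subset_closedBall (min_le_left _ _) h))
      · exact h
    · exact fun h => ⟨Or.inr h, hMN ▸ Or.inl h⟩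
  have hmain : ∀ z ∈ ball (0 : ℂ) 1, ∀ w ∈ ball (0 : ℂ) 1, dist z ζ < ρ → ρ < dist w ζ →
      g z ∉ closedBall q ε → g w ∉ closedBall q ε → False := by
    intro z hz w hw hzr hwr hgz hgw
    have u1 : Unsep (closedBall q δ ∪ M) (g z) (g w) :=
      ⟨(closedBall q ε)ᶜ, isPreconnected_compl_closedBall q hε0, compl_subset_compl.2 hF, hgz, hgw⟩
    have u2 : Unsep (frontier V) (g z) (g w) :=
      ⟨V, hVp, subset_compl_comm.1 hJV, hmem z hz, hmem w hw⟩
    obtain ⟨S, hS, hSs, hzS, hwS⟩ := Unsep.union ((isCompact_closedBall q δ).union hM) hJc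
      (by rw [hint]; exact hMp) u1 u2
    have hSV : S ⊆ V := by
      refine hS.subset_left_of_subset_union hVo isClosed_closure.isOpen_compl
        (v := (closure V)ᶜ) (disjoint_compl_right.mono_left subset_closure) (fun x hx => ?_)
        ⟨g z, hzS, hmem z hz⟩
      by_cases hxV : x ∈ V
      · exact Or.inl hxV
      · exact Or.inr fun hxc => hSs hx (Or.inr (by rw [hVo.frontier_eq]; exact ⟨hxc, hxV⟩))
    have hfS : IsPreconnected (f '' S) := hS.image f (hfc.mono hSV)
    obtain ⟨y, ⟨x, hx, rfl⟩, hy⟩ := hfS.intermediate_value (f := fun y => dist y ζ)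
      ⟨g z, hzS, hfg z hz⟩ ⟨g w, hwS, hfg w hw⟩ (by fun_prop)
      (show ρ ∈ Icc (dist z ζ) (dist w ζ) from ⟨hzr.le, hwr.le⟩)
    obtain ⟨h1, h2⟩ := hgf x (hSV hx)
    have := hQ _ h1 hy
    rw [h2] at this
    exact hSs hx (Or.inl (Or.inl this))
  have h0 : ρ < dist 0 ζ := by rw [dist_zero_left, hζ]; exact hρ.2
  have hg0 : g 0 ∉ closedBall q ε := by
    rw [mem_closedBall]
    intro h
    linarith [min_le_right (ε' / 2) (dist (g 0) q / 2)]
  rw [eventually_nhdsWithin_iff]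
  filter_upwards [ball_mem_nhds ζ hρ.1] with z hzρ hz
  by_contra hcon
  refine hmain z hz 0 (mem_ball_self one_pos) hzρ h0 (fun h => hcon ?_) hg0
  rw [mem_closedBall] at h
  linarith [min_le_left (ε' / 2) (dist (g 0) q / 2)]

end

end

section

open Filter Topology

theorem circleMap_mul_circleMap (α β : ℝ) :
    circleMap 0 1 α * circleMap 0 1 β = circleMap 0 1 (α + β) := by
  simp only [circleMap_zero, Complex.ofReal_one, one_mul, ← Complex.exp_add]
  push_cast; ring_nf

theorem circleMap_sub_nat_mul (θ : ℝ) (M : ℕ) :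
    circleMap 0 1 (θ - M * (2 * Real.pi)) = circleMap 0 1 θ :=
  (periodic_circleMap 0 1).sub_nat_mul_eq M

theorem eq_of_eqOn_circle_arc {G : ℂ → ℂ} (hG : DiffContOnCl ℂ G (ball 0 1)) {p : ℂ} {a b : ℝ}
    (hab : a < b) (h : ∀ θ ∈ Ioo a b, G (circleMap 0 1 θ) = p) : G 0 = p := by
  obtain ⟨M, hM⟩ := exists_nat_ge ((Real.pi - a) / (2 * Real.pi))
  rw [div_le_iff₀ Real.two_pi_pos] at hM
  set d := (b - a) / 2 with hd
  have hd0 : 0 < d := by linarith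
  set c := a + M * (2 * Real.pi) with hc
  obtain ⟨N, hN⟩ := exists_nat_gt ((c + d + Real.pi) / d)
  rw [div_lt_iff₀ hd0] at hN
  let P : ℂ → ℂ := fun z => ∏ k ∈ Finset.range N, (G (circleMap 0 1 (k * d) * z) - p)
  have hmul : ∀ θ : ℝ, MapsTo (fun z => circleMap 0 1 θ * z) (ball (0 : ℂ) 1) (ball 0 1) := by
    intro θ z hz
    rw [mem_ball_zero_iff] at hz ⊢
    rwa [norm_mul, norm_circleMap_zero, abs_one, one_mul]
  have hmulc : ∀ θ : ℝ, MapsTo (fun z => circleMap 0 1 θ * z)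
      (closure (ball (0 : ℂ) 1)) (closure (ball 0 1)) :=
    fun θ => (hmul θ).closure (by fun_prop)
  have hP : DiffContOnCl ℂ P (ball 0 1) := by
    refine ⟨?_, ?_⟩
    · refine DifferentiableOn.fun_finsetProd fun k _ => ?_
      exact (hG.1.comp (by fun_prop) (hmul _)).sub_const p
    · refine continuousOn_finsetProd _ fun k _ => ?_
      exact (hG.2.comp (by fun_prop) (hmulc _)).sub continuousOn_const
  have hP0 : ∀ z ∈ frontier (ball (0 : ℂ) 1), ‖P z‖ ≤ 0 := by
    intro z hz
    rw [frontier_ball _ one_ne_zero] at hz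
    obtain ⟨θ, hθ, rfl⟩ := exists_circleMap_eq hz
    obtain ⟨m, hm, -⟩ := existsUnique_add_zsmul_mem_Ioc hd0 θ c
    rw [zsmul_eq_mul] at hm
    have hm0 : 0 ≤ m := by
      by_contra hneg
      have : (m : ℝ) ≤ 0 := by exact_mod_cast (not_le.1 hneg).le
      nlinarith [hm.1, hθ.2]
    obtain ⟨k, rfl⟩ := Int.eq_ofNat_of_zero_le hm0
    rw [Int.cast_natCast] at hm
    have hk : k < N := by
      have : (k : ℝ) * d < N * d := by linarith [hm.2, hθ.1]
      exact_mod_cast lt_of_mul_lt_mul_right this hd0.le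
    refine (norm_eq_zero.2 (Finset.prod_eq_zero (Finset.mem_range.2 hk) ?_)).le
    rw [circleMap_mul_circleMap, ← circleMap_sub_nat_mul _ M, h _ ?_, sub_self]
    constructor <;> linarith [hm.1, hm.2]
  have := Complex.norm_le_of_forall_mem_frontier_norm_le isBounded_ball hP hP0
    (subset_closure (mem_ball_self one_pos))
  have h0 := norm_le_zero_iff.1 this
  obtain ⟨k, -, hk⟩ := Finset.prod_eq_zero_iff.1 h0
  rw [mul_zero] at hk
  exact sub_eq_zero.1 hk

theorem exists_small_connection {V : Set ℂ} (hVo : IsOpen V) (hVp : IsPreconnected V)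
    (hVb : Bornology.IsBounded V) (hJ : CurveLike (frontier V)) {p : ℂ} (hp : p ∈ frontier V)
    {ε : ℝ} (hε : 0 < ε) : ∃ δ > 0, ∀ x ∈ V ∩ ball p δ, ∀ y ∈ V ∩ ball p δ,
      ∃ S ⊆ V ∩ ball p ε, IsPreconnected S ∧ x ∈ S ∧ y ∈ S := by
  have hJV : frontier V ⊆ Vᶜ := fun p hp hpV => by
    rw [hVo.frontier_eq] at hp; exact hp.2 hpV
  have hJc : IsCompact (frontier V) :=
    Metric.isCompact_of_isClosed_isBounded isClosed_frontier
      (hVb.closure.subset frontier_subset_closure)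
  obtain ⟨M, N, hM, hN, hMp, hNp, hMN, hpN, hMε⟩ := hJ p hp (ε / 2) (by linarith)
  obtain ⟨δ₀, hδ₀, hδN⟩ := Metric.nhds_basis_ball.mem_iff.1 (hN.isClosed.isOpen_compl.mem_nhds hpN)
  have hδε : min δ₀ ε ≤ ε := min_le_right _ _
  refine ⟨min δ₀ ε, lt_min hδ₀ hε, fun x hx y hy => ?_⟩
  have hball : ball p (min δ₀ ε) ⊆ (sphere p ε ∪ N)ᶜ := by
    rintro z hz (hzs | hzN)
    · rw [mem_ball] at hz; rw [mem_sphere] at hzs; linarith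
    · exact hδN (ball_subset_ball (min_le_left _ _) hz) hzN
  have hint : frontier V ∩ (sphere p ε ∪ N) = N := by
    ext z
    constructor
    · rintro ⟨hz, hzs | hzN⟩
      · rw [← hMN] at hz
        refine hz.elim (fun hzM => ?_) id
        have := hMε hzM
        rw [mem_closedBall, mem_sphere.1 hzs] at this
        linarith
      · exact hzN
    · exact fun hz => ⟨hMN ▸ Or.inr hz, Or.inr hz⟩
  obtain ⟨S, hS, hSs, hxS, hyS⟩ := Unsep.union hJc ((isCompact_sphere p ε).union hN)
    (by rw [hint]; exact hNp) ⟨V, hVp, subset_compl_comm.1 hJV, hx.1, hy.1⟩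
    ⟨_, (convex_ball p _).isPreconnected, hball, hx.2, hy.2⟩
  have hSV : S ⊆ V := by
    refine hS.subset_left_of_subset_union hVo isClosed_closure.isOpen_compl
      (v := (closure V)ᶜ) (disjoint_compl_right.mono_left subset_closure) (fun z hz => ?_)
      ⟨x, hxS, hx.1⟩
    by_cases hzV : z ∈ V
    · exact Or.inl hzV
    · exact Or.inr fun hzc => hSs hz (Or.inl (by rw [hVo.frontier_eq]; exact ⟨hzc, hzV⟩))
  have hSb : S ⊆ ball p ε := by
    refine hS.subset_left_of_subset_union isOpen_ball isClosed_closedBall.isOpen_compl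
      (v := (closedBall p ε)ᶜ) (disjoint_compl_right.mono_left ball_subset_closedBall)
      (fun z hz => ?_) ⟨x, hxS, ball_subset_ball hδε hx.2⟩
    by_cases hzb : z ∈ ball p ε
    · exact Or.inl hzb
    · refine Or.inr fun hzc => hSs hz (Or.inr (Or.inl ?_))
      rw [mem_sphere]
      exact le_antisymm (mem_closedBall.1 hzc) (not_lt.1 hzb)
  exact ⟨S, subset_inter hSV hSb, hS, hxS, hyS⟩

end

section

open Filter Topology

def radius (θ : ℝ) : Set ℂ := (fun s : ℝ => circleMap 0 s θ) '' Icc 0 1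

theorem continuous_circleMap_radius (θ : ℝ) : Continuous fun s : ℝ => circleMap 0 s θ := by
  unfold circleMap; fun_prop

theorem isCompact_radius (θ : ℝ) : IsCompact (radius θ) :=
  isCompact_Icc.image (continuous_circleMap_radius θ)

theorem isPreconnected_radius (θ : ℝ) : IsPreconnected (radius θ) :=
  isPreconnected_Icc.image _ (continuous_circleMap_radius θ).continuousOn

theorem circleMap_radius_ne {α β s t : ℝ} (hs : 0 < s) (ht : 0 ≤ t) (hαβ : α < β)
    (hβ : β < α + 2 * Real.pi) : circleMap 0 s α ≠ circleMap 0 t β := by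
  intro h
  have hst : s = t := by
    have := congrArg norm h
    rwa [norm_circleMap_zero, norm_circleMap_zero, abs_of_pos hs, abs_of_nonneg ht] at this
  subst hst
  exact hαβ.ne (injOn_circleMap_of_abs_sub_le' (a := α) (b := α + 2 * Real.pi) (c := 0) hs.ne'
    (by linarith) ⟨le_refl _, by linarith [Real.pi_pos]⟩ ⟨hαβ.le, hβ⟩ h)

theorem radius_subset (θ : ℝ) : radius θ ⊆ closedBall 0 1 := by
  rintro _ ⟨s, hs, rfl⟩
  rw [mem_closedBall_zero_iff, norm_circleMap_zero, abs_of_nonneg hs.1]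
  exact hs.2

theorem eq_or_eq_of_boundary_eq {V : Set ℂ} {G f : ℂ → ℂ} (hVo : IsOpen V) (hVp : IsPreconnected V)
    (hVb : Bornology.IsBounded V) (hJ : CurveLike (frontier V))
    (hG : ContinuousOn G (closedBall 0 1)) (hGV : MapsTo G (ball 0 1) V) (hf : ContinuousOn f V)
    (hfV : MapsTo f V (ball 0 1)) (hGf : ∀ z ∈ V, G (f z) = z) (hfG : ∀ w ∈ ball 0 1, f (G w) = w)
    {p : ℂ} (hp : p ∈ frontier V) {α β γ δ : ℝ} (hαβ : α < β) (hβγ : β < γ) (hγδ : γ < δ)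
    (hδα : δ < α + 2 * Real.pi) (hα : G (circleMap 0 1 α) = p) (hγ : G (circleMap 0 1 γ) = p) :
    G (circleMap 0 1 β) = p ∨ G (circleMap 0 1 δ) = p := by
  have hpV : p ∉ V := by rw [hVo.frontier_eq] at hp; exact hp.2
  set R := radius β ∪ radius δ with hR
  have hRc : IsCompact R := (isCompact_radius β).union (isCompact_radius δ)
  have h0 : ∀ θ, (0 : ℂ) ∈ radius θ := fun θ => ⟨0, by simp, by simp⟩
  have h1 : ∀ θ, circleMap 0 1 θ ∈ radius θ := fun θ => ⟨1, by simp, rfl⟩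
  have hRp : IsPreconnected R :=
    (isPreconnected_radius β).union 0 (h0 β) (h0 δ) (isPreconnected_radius δ)
  have hRD : R ⊆ closedBall 0 1 := union_subset (radius_subset β) (radius_subset δ)
  suffices hmain : ∀ ε > 0, ∃ w ∈ R, dist (G w) p < ε by
    obtain ⟨w, hw, hmin⟩ := hRc.exists_isMinOn ⟨0, Or.inl (h0 β)⟩ (f := fun w => dist (G w) p)
      (continuous_dist.comp_continuousOn ((hG.mono hRD).prodMk continuousOn_const))
    have hwp : G w = p := by
      by_contra hne
      obtain ⟨w', hw', hlt⟩ := hmain _ (dist_pos.2 hne)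
      exact absurd (hmin hw') (not_le.2 hlt)
    have hw1 : ∀ s ∈ Icc (0 : ℝ) 1, ∀ θ, G (circleMap 0 s θ) = p → s = 1 := by
      intro s hs θ h
      by_contra hne
      refine hpV (h ▸ hGV ?_)
      rw [mem_ball_zero_iff, norm_circleMap_zero, abs_of_nonneg hs.1]
      exact lt_of_le_of_ne hs.2 hne
    rcases hw with ⟨s, hs, rfl⟩ | ⟨s, hs, rfl⟩
    · exact Or.inl (by rwa [hw1 s hs _ hwp] at hwp)
    · exact Or.inr (by rwa [hw1 s hs _ hwp] at hwp)
  intro ε hε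
  obtain ⟨r, hr, hconn⟩ := exists_small_connection hVo hVp hVb hJ hp hε
  have hnear : ∀ θ, G (circleMap 0 1 θ) = p →
      ∀ᶠ s in 𝓝[<] (1 : ℝ), G (circleMap 0 s θ) ∈ ball p r := by
    intro θ h
    have hc : ContinuousWithinAt (fun s : ℝ => G (circleMap 0 s θ)) (Icc 0 1) 1 :=
      (hG.comp (continuous_circleMap_radius θ).continuousOn
        (fun s hs => radius_subset θ ⟨s, hs, rfl⟩)) 1 (by simp)
    have := hc.eventually_mem (s := ball p r) (by
      change ball p r ∈ 𝓝 (G (circleMap 0 1 θ))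
      rw [h]; exact ball_mem_nhds p hr)
    rw [← nhdsWithin_Ico_eq_nhdsLT zero_lt_one]
    exact this.filter_mono (nhdsWithin_mono _ Ico_subset_Icc_self)
  obtain ⟨t, ⟨htα, htγ⟩, ht0, ht1⟩ :=
    (((hnear α hα).and (hnear γ hγ)).and (Ioo_mem_nhdsLT zero_lt_one)).exists
  have htb : ∀ θ, circleMap 0 t θ ∈ ball (0 : ℂ) 1 := fun θ => by
    rw [mem_ball_zero_iff, norm_circleMap_zero, abs_of_pos ht0]; exact ht1
  obtain ⟨S, hSV, hSp, hxS, hyS⟩ := hconn _ ⟨hGV (htb α), htα⟩ _ ⟨hGV (htb γ), htγ⟩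
  have hfS : IsPreconnected (f '' S) := hSp.image f (hf.mono fun z hz => (hSV hz).1)
  have hxS' : circleMap 0 t α ∈ f '' S := ⟨_, hxS, hfG _ (htb α)⟩
  have hyS' : circleMap 0 t γ ∈ f '' S := ⟨_, hyS, hfG _ (htb γ)⟩
  let E : ℝ → Set ℂ := fun θ => (fun s : ℝ => circleMap 0 s θ) '' Icc t 1
  have hE : ∀ θ, IsPreconnected (E θ) := fun θ =>
    isPreconnected_Icc.image _ (continuous_circleMap_radius θ).continuousOn
  have hER : ∀ θ, E θ ⊆ radius θ := fun θ => image_mono (Icc_subset_Icc_left ht0.le)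
  have hEt : ∀ θ, circleMap 0 t θ ∈ E θ := fun θ => ⟨t, ⟨le_rfl, ht1.le⟩, rfl⟩
  have hE1 : ∀ θ, circleMap 0 1 θ ∈ E θ := fun θ => ⟨1, ⟨ht1.le, le_rfl⟩, rfl⟩
  have hT : IsPreconnected ((E α ∪ f '' S) ∪ E γ) :=
    ((hE α).union (circleMap 0 t α) (hEt α) hxS' hfS).union (circleMap 0 t γ)
      (Or.inr hyS') (hEt γ) (hE γ)
  have hTD : (E α ∪ f '' S) ∪ E γ ⊆ closedBall 0 1 := by
    refine union_subset (union_subset ((hER α).trans (radius_subset α)) ?_)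
      ((hER γ).trans (radius_subset γ))
    rintro _ ⟨z, hz, rfl⟩
    exact ball_subset_closedBall (hfV (hSV hz).1)
  have hnd : ¬ Disjoint R ((E α ∪ f '' S) ∪ E γ) := fun hd =>
    crossing one_pos hRc hRp hT hRD hTD hd hβγ hγδ hδα
      (by linarith) (Or.inl (h1 β)) (Or.inr (hE1 γ)) (Or.inr (h1 δ))
      (by rw [periodic_circleMap 0 1 α]; exact Or.inl (Or.inl (hE1 α)))
  obtain ⟨w, hwR, hwT⟩ := not_disjoint_iff.1 hnd
  have hpi := Real.pi_pos
  rcases hwT with (hwE | ⟨z, hz, rfl⟩) | hwE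
  · exfalso
    obtain ⟨s, hs, rfl⟩ := hwE
    rcases hwR with ⟨s', hs', h⟩ | ⟨s', hs', h⟩
    · exact circleMap_radius_ne (by linarith [hs.1]) hs'.1 hαβ (by linarith) h.symm
    · exact circleMap_radius_ne (by linarith [hs.1]) hs'.1 (by linarith) hδα h.symm
  · exact ⟨f z, hwR, by rw [hGf z (hSV hz).1]; exact (hSV hz).2⟩
  · exfalso
    obtain ⟨s, hs, rfl⟩ := hwE
    rcases hwR with ⟨s', hs', h⟩ | ⟨s', hs', h⟩
    · refine circleMap_radius_ne (s := s) (t := s') (α := γ) (β := β + 2 * Real.pi) (by linarith [hs.1]) hs'.1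
        (by linarith) (by linarith) ?_
      rw [periodic_circleMap 0 s']; exact h.symm
    · exact circleMap_radius_ne (by linarith [hs.1]) hs'.1 hγδ (by linarith) h.symm

theorem caratheodory {V : Set ℂ} (hVo : IsOpen V) (hVc : IsConnected V)
    (hVb : Bornology.IsBounded V) (hE : IsPreconnected Vᶜ) (hJ : CurveLike (frontier V)) :
    ∃ G : ℂ → ℂ, ContinuousOn G (closedBall 0 1) ∧ InjOn G (closedBall 0 1) ∧
      G '' ball 0 1 = V ∧ G '' sphere 0 1 = frontier V := by
  obtain ⟨g, f, hgd, hgi, hgV, hf, hfV, hfg⟩ := exists_riemann_map hVo hVc hVb hE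
  have hlim := fun ζ (hζ : ‖ζ‖ = 1) =>
    exists_boundary_limit hVo hVb hJ hgd hgi hgV hf hfV hfg hζ
  set G := extendFrom (ball (0 : ℂ) 1) g with hGdef
  have hcl : closure (ball (0 : ℂ) 1) = closedBall 0 1 := closure_ball _ one_ne_zero
  have hGg : ∀ z ∈ ball (0 : ℂ) 1, G z = g z := extendFrom_extends hgd.continuousOn
  have hGJ : ∀ z ∈ sphere (0 : ℂ) 1, G z ∈ frontier V := by
    intro z hz
    obtain ⟨p, hp, h⟩ := hlim z (mem_sphere_zero_iff_norm.1 hz)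
    rw [hGdef, extendFrom_eq (by rw [hcl]; exact sphere_subset_closedBall hz) h]
    exact hp
  have hG : ContinuousOn G (closedBall 0 1) := by
    refine continuousOn_extendFrom hcl.ge fun z hz => ?_
    rcases (mem_closedBall_zero_iff.1 hz).lt_or_eq with h | h
    · exact ⟨_, hgd.continuousOn z (mem_ball_zero_iff.2 h)⟩
    · obtain ⟨p, -, h⟩ := hlim z h
      exact ⟨p, h⟩
  have hGV : G '' ball 0 1 = V := by rw [image_congr hGg, hgV]
  have hmaps : MapsTo G (ball 0 1) V := fun z hz => hGV ▸ ⟨z, hz, rfl⟩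
  have hJV : ∀ p ∈ frontier V, p ∉ V := fun p hp => by
    rw [hVo.frontier_eq] at hp; exact hp.2
  have hdc : DiffContOnCl ℂ G (ball 0 1) := ⟨hgd.congr hGg, by rw [hcl]; exact hG⟩
  have key := fun p hp α β γ δ => eq_or_eq_of_boundary_eq hVo hVc.isPreconnected hVb hJ hG hmaps hf
    (fun z hz => (hfV z hz).1) (fun z hz => by rw [hGg _ (hfV z hz).1]; exact (hfV z hz).2)
    (fun w hw => by rw [hGg w hw]; exact hfg w hw) (p := p) hp (α := α) (β := β) (γ := γ) (δ := δ)
  have hne : ∀ p ∈ frontier V, G 0 ≠ p := fun p hp h =>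
    hJV p hp (h ▸ hmaps (mem_ball_self one_pos))
  have hpi := Real.pi_pos
  have harc : ∀ α γ, α < γ → γ < α + 2 * Real.pi →
      G (circleMap 0 1 α) ≠ G (circleMap 0 1 γ) := by
    intro α γ hαγ hγα heq
    have hp := hGJ _ (circleMap_mem_sphere 0 zero_le_one α)
    by_cases h : ∀ θ ∈ Ioo α γ, G (circleMap 0 1 θ) = G (circleMap 0 1 α)
    · exact hne _ hp (eq_of_eqOn_circle_arc hdc hαγ h)
    · push Not at h
      obtain ⟨β, hβ, hβn⟩ := h
      refine hne _ hp (eq_of_eqOn_circle_arc hdc hγα fun δ hδ => ?_)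
      exact (key _ hp α β γ δ hβ.1 hβ.2 hδ.1 hδ.2 rfl heq.symm).resolve_left hβn
  have hcl2 : G '' closedBall 0 1 = closure V := by
    refine Subset.antisymm ?_ ?_
    · rw [← hcl, ← hGV]
      exact hdc.2.image_closure
    · refine closure_minimal (hGV ▸ image_mono ball_subset_closedBall) ?_
      exact ((isCompact_closedBall (0 : ℂ) 1).image_of_continuousOn hG).isClosed
  refine ⟨G, hG, ?_, hGV, ?_⟩
  · intro z hz w hw hzw
    rcases (mem_closedBall_zero_iff.1 hz).lt_or_eq with hz1 | hz1 <;>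
    rcases (mem_closedBall_zero_iff.1 hw).lt_or_eq with hw1 | hw1
    · refine hgi (mem_ball_zero_iff.2 hz1) (mem_ball_zero_iff.2 hw1) ?_
      rwa [← hGg _ (mem_ball_zero_iff.2 hz1), ← hGg _ (mem_ball_zero_iff.2 hw1)]
    · exact absurd (hzw ▸ hmaps (mem_ball_zero_iff.2 hz1)) (hJV _ (hGJ w (by simpa using hw1)))
    · exact absurd (hzw ▸ hmaps (mem_ball_zero_iff.2 hw1) : G z ∈ V) (hJV _ (hGJ z (by simpa using hz1)))
    · obtain ⟨α, hα, rfl⟩ := exists_circleMap_eq (mem_sphere_zero_iff_norm.2 hz1)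
      obtain ⟨β, hβ, rfl⟩ := exists_circleMap_eq (mem_sphere_zero_iff_norm.2 hw1)
      rcases lt_trichotomy α β with h | h | h
      · exact absurd hzw (harc α β h (by linarith [hα.1, hβ.2]))
      · rw [h]
      · exact absurd hzw.symm (harc β α h (by linarith [hβ.1, hα.2]))
  · refine Subset.antisymm (by rintro _ ⟨z, hz, rfl⟩; exact hGJ z hz) fun q hq => ?_
    have : q ∈ G '' closedBall 0 1 := hcl2 ▸ frontier_subset_closure hq
    obtain ⟨z, hz, rfl⟩ := this
    refine ⟨z, ?_, rfl⟩
    by_contra hzs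
    refine hJV _ hq (hmaps ?_)
    rw [← ball_union_sphere] at hz
    exact hz.resolve_right hzs

end

section

open Filter Topology

theorem exists_small_continuum_of_mem_arc {A B : Set ℂ} {a b : ℂ} (hA : IsArc A a b)
    (hB : IsArc B a b) (hAB : A ∩ B ⊆ {a, b}) {p : ℂ} (hp : p ∈ A) (hpa : p ≠ a) (hpb : p ≠ b)
    {ε : ℝ} (hε : 0 < ε) : ∃ M N : Set ℂ, IsCompact M ∧ IsCompact N ∧ IsPreconnected M ∧
    IsPreconnected N ∧ M ∪ N = A ∪ B ∧ p ∉ N ∧ M ⊆ closedBall p ε := by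
  obtain ⟨γ, f, hγ, hf, h0, h1, hγf, hfγ⟩ := hA.exists_coord
  obtain ⟨hs, hsp⟩ := hfγ p hp
  set s := f p
  have hs0 : 0 < s := lt_of_le_of_ne hs.1 fun h => hpa (by rw [← hsp, ← h, h0])
  have hs1 : s < 1 := lt_of_le_of_ne hs.2 fun h => hpb (by rw [← hsp, h, h1])
  obtain ⟨η, hη, hηs⟩ := Metric.continuous_iff.1 hγ s ε hε
  obtain ⟨d, hd0, hd⟩ := exists_between (lt_min hη (lt_min hs0 (sub_pos.2 hs1)))
  rw [lt_min_iff, lt_min_iff] at hd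
  obtain ⟨hd1, hd2, hd3⟩ := hd
  have hsub : ∀ u v, 0 ≤ u → v ≤ 1 → γ '' Icc u v ⊆ A := by
    rintro u v hu hv _ ⟨t, ht, rfl⟩
    exact (hγf t ⟨hu.trans ht.1, ht.2.trans hv⟩).1
  have hne : ∀ u v, 0 ≤ u → v ≤ 1 → s ∉ Icc u v → p ∉ γ '' Icc u v := by
    rintro u v hu hv hsn ⟨t, ht, htp⟩
    refine hsn ?_
    have := (hγf t ⟨hu.trans ht.1, ht.2.trans hv⟩).2
    rw [htp] at this
    rwa [show s = t from this]
  have hc : ∀ u v, IsCompact (γ '' Icc u v) := fun u v => isCompact_Icc.image hγ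
  have hpc : ∀ u v, IsPreconnected (γ '' Icc u v) := fun u v =>
    isPreconnected_Icc.image _ hγ.continuousOn
  have ha' : a ∈ γ '' Icc 0 (s - d) := ⟨0, ⟨le_rfl, by linarith⟩, h0⟩
  have hb' : b ∈ γ '' Icc (s + d) 1 := ⟨1, ⟨by linarith, le_rfl⟩, h1⟩
  refine ⟨γ '' Icc (s - d) (s + d), (γ '' Icc 0 (s - d) ∪ B) ∪ γ '' Icc (s + d) 1, hc _ _,
    ((hc _ _).union hB.isCompact).union (hc _ _), hpc _ _, ?_, ?_, ?_, ?_⟩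
  · exact ((hpc _ _).union a ha' hB.left_mem hB.isConnected.isPreconnected).union b
      (Or.inr hB.right_mem) hb' (hpc _ _)
  · apply Subset.antisymm
    · refine union_subset ((hsub _ _ (by linarith) (by linarith)).trans subset_union_left)
        (union_subset (union_subset ?_ subset_union_right) ?_)
      · exact (hsub _ _ le_rfl (by linarith)).trans subset_union_left
      · exact (hsub _ _ (by linarith) le_rfl).trans subset_union_left
    · rintro z (hz | hz)
      · obtain ⟨ht, htz⟩ := hfγ z hz
        rcases le_or_gt (f z) (s - d) with h | h
        · exact Or.inr (Or.inl (Or.inl ⟨f z, ⟨ht.1, h⟩, htz⟩))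
        · rcases le_or_gt (s + d) (f z) with h' | h'
          · exact Or.inr (Or.inr ⟨f z, ⟨h', ht.2⟩, htz⟩)
          · exact Or.inl ⟨f z, ⟨h.le, h'.le⟩, htz⟩
      · exact Or.inr (Or.inl (Or.inr hz))
  · rintro ((h | h) | h)
    · exact hne _ _ le_rfl (by linarith) (fun h => by linarith [h.2]) h
    · rcases hAB ⟨hp, h⟩ with h | h
      · exact hpa h
      · exact hpb h
    · exact hne _ _ (by linarith) le_rfl (fun h => by linarith [h.1]) h
  · rintro _ ⟨t, ht, rfl⟩
    rw [← hsp]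
    refine (hηs t ?_).le
    rw [Real.dist_eq, abs_lt]
    constructor <;> linarith [ht.1, ht.2]

theorem exists_small_continuum_of_endpoint {A B : Set ℂ} {a b : ℂ} (hA : IsArc A a b)
    (hB : IsArc B a b) (hAB : A ∩ B ⊆ {a, b})
    {ε : ℝ} (hε : 0 < ε) : ∃ M N : Set ℂ, IsCompact M ∧ IsCompact N ∧ IsPreconnected M ∧
    IsPreconnected N ∧ M ∪ N = A ∪ B ∧ a ∉ N ∧ M ⊆ closedBall a ε := by
  obtain ⟨w, hw, hwa, hwb⟩ := hA.exists_interior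
  obtain ⟨v, hv, hva, hvb⟩ := hB.exists_interior
  obtain ⟨A₁, A₂, hA₁, hA₂, hAu, hAi⟩ := hA.split hw hwa hwb
  obtain ⟨B₁, B₂, hB₁, hB₂, hBu, hBi⟩ := hB.split hv hva hvb
  have sA₁ : A₁ ⊆ A := hAu ▸ subset_union_left
  have sA₂ : A₂ ⊆ A := hAu ▸ subset_union_right
  have sB₁ : B₁ ⊆ B := hBu ▸ subset_union_left
  have sB₂ : B₂ ⊆ B := hBu ▸ subset_union_right
  have hbA₁ : b ∉ A₁ := fun h => hwb (hAi.le ⟨h, hA₂.right_mem⟩ : b = w).symm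
  have haA₂ : a ∉ A₂ := fun h => hwa (hAi.le ⟨hA₁.left_mem, h⟩ : a = w).symm
  have hbB₁ : b ∉ B₁ := fun h => hvb (hBi.le ⟨h, hB₂.right_mem⟩ : b = v).symm
  have haB₂ : a ∉ B₂ := fun h => hva (hBi.le ⟨hB₁.left_mem, h⟩ : a = v).symm
  have h1 : IsArc (B₁ ∪ A₁) v w := by
    refine hB₁.symm.union hA₁ ?_
    rintro z ⟨hzB, hzA⟩
    rcases hAB ⟨sA₁ hzA, sB₁ hzB⟩ with h | h
    · exact h
    · exact absurd (h ▸ hzA) hbA₁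
  have h2 : IsArc (B₂ ∪ A₂) v w := by
    refine hB₂.union hA₂.symm ?_
    rintro z ⟨hzB, hzA⟩
    rcases hAB ⟨sA₂ hzA, sB₂ hzB⟩ with h | h
    · exact absurd (h ▸ hzA) haA₂
    · exact h
  have h3 : (B₁ ∪ A₁) ∩ (B₂ ∪ A₂) ⊆ {v, w} := by
    rintro z ⟨h | h, h' | h'⟩
    · exact Or.inl (hBi.le ⟨h, h'⟩)
    · rcases hAB ⟨sA₂ h', sB₁ h⟩ with e | e
      · exact absurd (e ▸ h') haA₂
      · exact absurd (e ▸ h) hbB₁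
    · rcases hAB ⟨sA₁ h, sB₂ h'⟩ with e | e
      · exact absurd (e ▸ h') haB₂
      · exact absurd (e ▸ h) hbA₁
    · exact Or.inr (hAi.le ⟨h, h'⟩)
  have h4 : (B₁ ∪ A₁) ∪ (B₂ ∪ A₂) = A ∪ B := by
    rw [← hAu, ← hBu, union_union_union_comm, union_comm]
  rw [← h4]
  exact exists_small_continuum_of_mem_arc h1 h2 h3 (Or.inr hA₁.left_mem) hva.symm hwa.symm hε

theorem curveLike_union {A B : Set ℂ} {a b : ℂ} (hA : IsArc A a b)
    (hB : IsArc B a b) (hAB : A ∩ B ⊆ {a, b}) : CurveLike (A ∪ B) := by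
  have key : ∀ {A B : Set ℂ}, IsArc A a b → IsArc B a b → A ∩ B ⊆ {a, b} → ∀ p ∈ A, ∀ ε > 0,
      ∃ M N : Set ℂ, IsCompact M ∧ IsCompact N ∧ IsPreconnected M ∧
        IsPreconnected N ∧ M ∪ N = A ∪ B ∧ p ∉ N ∧ M ⊆ closedBall p ε := by
    intro A B hA hB hAB p hp ε hε
    by_cases hpa : p = a
    · rw [hpa]; exact exists_small_continuum_of_endpoint hA hB hAB hε
    by_cases hpb : p = b
    · rw [hpb]
      exact exists_small_continuum_of_endpoint hA.symm hB.symm (by rwa [pair_comm]) hε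
    exact exists_small_continuum_of_mem_arc hA hB hAB hp hpa hpb hε
  rintro p (hp | hp) ε hε
  · exact key hA hB hAB p hp ε hε
  · rw [union_comm]; exact key hB hA (by rwa [inter_comm]) p hp ε hε

end

section

open Filter Topology

theorem not_frontier_subset_of_unsep {V F : Set ℂ} (hVo : IsOpen V) (hVn : V.Nonempty)
    (hVb : Bornology.IsBounded V) (hFb : Bornology.IsBounded F) (hVF : Disjoint V F)
    (hF : ∀ p q, p ∉ F → q ∉ F → Unsep F p q) : ¬ frontier V ⊆ F := by
  intro hfr
  obtain ⟨z, hz⟩ := hVn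
  obtain ⟨w, hw⟩ : ∃ w, w ∉ closure V ∪ F := by
    by_contra hcon
    push Not at hcon
    refine NormedSpace.unbounded_univ ℝ ℂ ((hVb.closure.union hFb).subset fun x _ => hcon x)
  obtain ⟨S, hS, hSF, hzS, hwS⟩ := hF z w (disjoint_left.1 hVF hz) fun h => hw (Or.inr h)
  have hSV : S ⊆ V := by
    refine hS.subset_left_of_subset_union hVo isClosed_closure.isOpen_compl
      (v := (closure V)ᶜ) (disjoint_compl_right.mono_left subset_closure) (fun z hz => ?_)
      ⟨z, hzS, hz⟩
    by_cases hzV : z ∈ V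
    · exact Or.inl hzV
    · exact Or.inr fun hzc => hSF hz (hfr (by rw [hVo.frontier_eq]; exact ⟨hzc, hzV⟩))
  exact hw (Or.inl (subset_closure (hSV hwS)))

theorem subset_frontier_of_arcs {A c V : Set ℂ} {a b : ℂ} (hA : IsArc A a b) (hc : IsArc c a b)
    (hAc : A ∩ c ⊆ {a, b}) (hVo : IsOpen V) (hVn : V.Nonempty) (hVb : Bornology.IsBounded V)
    (hfr : frontier V ⊆ A ∪ c) (hdis : Disjoint V (A ∪ c)) : A ⊆ frontier V := by
  obtain ⟨γ, f, hγ, hf, h0, h1, hγf, hfγ⟩ := hA.exists_coord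
  have hinj : InjOn γ (Icc 0 1) := fun s hs t ht h => by
    rw [← (hγf s hs).2, h, (hγf t ht).2]
  suffices hmain : γ '' Ioo 0 1 ⊆ frontier V by
    intro z hz
    obtain ⟨ht, htz⟩ := hfγ z hz
    refine closure_minimal hmain isClosed_frontier (image_closure_subset_closure_image hγ ?_)
    rw [closure_Ioo zero_ne_one]
    exact ⟨f z, ht, htz⟩
  rintro _ ⟨s, hs, rfl⟩
  by_contra hn
  obtain ⟨η, hη, hηs⟩ := Metric.isOpen_iff.1 ((isClosed_frontier (s := V)).isOpen_compl.preimage hγ) s hn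
  obtain ⟨d, hd0, hd⟩ := exists_between (lt_min hη (lt_min hs.1 (sub_pos.2 hs.2)))
  rw [lt_min_iff, lt_min_iff] at hd
  obtain ⟨hd1, hd2, hd3⟩ := hd
  have e1 : IsArc (γ '' Icc 0 (s - d)) a (γ (s - d)) := by
    have := IsArc.of_param (s := 0) (t := s - d) (by linarith) hγ.continuousOn
      (hinj.mono (Icc_subset_Icc_right (by linarith [hs.2])))
    rwa [h0] at this
  have e2 : IsArc (γ '' Icc (s + d) 1) (γ (s + d)) b := by
    have := IsArc.of_param (s := s + d) (t := 1) (by linarith) hγ.continuousOn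
      (hinj.mono (Icc_subset_Icc_left (by linarith [hs.1])))
    rwa [h1] at this
  have hsub : ∀ u v, 0 ≤ u → v ≤ 1 → γ '' Icc u v ⊆ A := by
    rintro u v hu hv _ ⟨t, ht, rfl⟩
    exact (hγf t ⟨hu.trans ht.1, ht.2.trans hv⟩).1
  have hs1 := hsub 0 (s - d) le_rfl (by linarith [hs.2])
  have hs2 := hsub (s + d) 1 (by linarith [hs.1]) le_rfl
  have hF : IsArc (γ '' Icc 0 (s - d) ∪ c ∪ γ '' Icc (s + d) 1) (γ (s - d)) (γ (s + d)) := by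
    refine (e1.symm.union hc ?_).union e2.symm ?_
    · rintro z ⟨hz, hzc⟩
      rcases hAc ⟨hs1 hz, hzc⟩ with h | h
      · exact h
      · exfalso
        obtain ⟨t, ht, rfl⟩ := hz
        have := hinj ⟨ht.1, by linarith [ht.2, hs.2]⟩ ⟨zero_le_one, le_rfl⟩ (h.trans h1.symm)
        linarith [ht.2, hs.2]
    · rintro z ⟨hz | hzc, hz2⟩
      · exfalso
        obtain ⟨t, ht, rfl⟩ := hz
        obtain ⟨t', ht', h⟩ := hz2
        have := hinj ⟨by linarith [ht'.1, hs.1], ht'.2⟩ ⟨ht.1, by linarith [ht.2, hs.2]⟩ h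
        linarith [ht.2, ht'.1]
      · rcases hAc ⟨hs2 hz2, hzc⟩ with h | h
        · exfalso
          obtain ⟨t, ht, rfl⟩ := hz2
          have := hinj ⟨by linarith [ht.1, hs.1], ht.2⟩ ⟨le_rfl, zero_le_one⟩ (h.trans h0.symm)
          linarith [ht.1, hs.1]
        · exact h
  refine not_frontier_subset_of_unsep hVo hVn hVb hF.isCompact.isBounded ?_
    (fun p q hp hq => hF.unsep hp hq) ?_
  · refine hdis.mono_right (union_subset (union_subset ?_ subset_union_right) ?_)
    · exact hs1.trans subset_union_left
    · exact hs2.trans subset_union_left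
  · intro z hz
    rcases hfr hz with hzA | hzc
    · obtain ⟨ht, htz⟩ := hfγ z hzA
      rcases le_or_gt (f z) (s - d) with h | h
      · exact Or.inl (Or.inl ⟨f z, ⟨ht.1, h⟩, htz⟩)
      · rcases le_or_gt (s + d) (f z) with h' | h'
        · exact Or.inr ⟨f z, ⟨h', ht.2⟩, htz⟩
        · refine absurd hz (htz ▸ hηs ?_)
          rw [mem_ball, Real.dist_eq, abs_lt]
          constructor <;> linarith
    · exact Or.inl (Or.inr hzc)

section
variable {z₀ : ℂ} {r : ℝ} {A V V' : Set ℂ}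

theorem exists_ball_inter_subset (hA : IsClosed A)
    (hV : ∃ x, V = connectedComponentIn (ball z₀ r \ A) x) {q : ℂ} (hq : q ∈ closure V)
    (hqA : q ∉ A) : ∃ ε > 0, ball q ε ∩ ball z₀ r ⊆ V := by
  obtain ⟨x, rfl⟩ := hV
  obtain ⟨ε, hε, hεA⟩ := Metric.isOpen_iff.1 hA.isOpen_compl q hqA
  refine ⟨ε, hε, ?_⟩
  obtain ⟨y, hyV, hy⟩ := Metric.mem_closure_iff.1 hq ε hε
  have hyD := connectedComponentIn_subset _ _ hyV
  rw [connectedComponentIn_eq hyV]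
  refine ((convex_ball q ε).inter (convex_ball z₀ r)).isPreconnected.subset_connectedComponentIn
    ⟨by rwa [mem_ball, dist_comm], hyD.1⟩ fun z hz => ⟨hz.2, hεA hz.1⟩

theorem mem_closure_of_ball_inter_subset (hr : 0 < r) {q : ℂ} (hq : q ∈ sphere z₀ r) {ε : ℝ}
    {q' : ℂ} (hq' : q ∈ ball q' ε) (h : ball q' ε ∩ ball z₀ r ⊆ V) : q ∈ closure V := by
  refine closure_mono h (isOpen_ball.inter_closure ⟨hq', ?_⟩)
  rw [closure_ball _ hr.ne']; exact sphere_subset_closedBall hq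

theorem subset_closure_of_mem (hr : 0 < r) (hA : IsClosed A)
    (hV : ∃ x, V = connectedComponentIn (ball z₀ r \ A) x) {c : Set ℂ} (hc : IsPreconnected c)
    (hcS : c ⊆ sphere z₀ r) (hcA : Disjoint c A) {q : ℂ} (hqc : q ∈ c) (hqV : q ∈ closure V) :
    c ⊆ closure V := by
  let W : Set ℂ := {q | ∃ q' ε, q ∈ ball q' ε ∧ ball q' ε ∩ ball z₀ r ⊆ V}
  have hW : IsOpen W := by
    rw [Metric.isOpen_iff]
    rintro q ⟨q', ε, hq, h⟩
    obtain ⟨η, hη, hs⟩ := Metric.isOpen_iff.1 isOpen_ball q hq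
    exact ⟨η, hη, fun z hz => ⟨q', ε, hs hz, h⟩⟩
  have hWV : ∀ q ∈ c, q ∈ W → q ∈ closure V := by
    rintro q hqc ⟨q', ε, hq, h⟩
    exact mem_closure_of_ball_inter_subset hr (hcS hqc) hq h
  have hVW : ∀ q ∈ c, q ∈ closure V → q ∈ W := fun q hqc hqV => by
    obtain ⟨ε, hε, h⟩ := exists_ball_inter_subset hA hV hqV (disjoint_left.1 hcA hqc)
    exact ⟨q, ε, mem_ball_self hε, h⟩
  rcases isPreconnected_iff_subset_of_disjoint.1 hc W (closure V)ᶜ hW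
    isClosed_closure.isOpen_compl (fun z hz => by
      by_cases h : z ∈ closure V
      · exact Or.inl (hVW z hz h)
      · exact Or.inr h) (by
      ext z
      simp only [mem_inter_iff, mem_compl_iff, mem_empty_iff_false, iff_false]
      rintro ⟨h1, h2, h3⟩
      exact h3 (hWV z h1 h2)) with h | h
  · exact fun z hz => hWV z hz (h hz)
  · exact absurd hqV (h hqc)

theorem component_eq_of_mem_closure (hr : 0 < r) (hA : IsClosed A)
    (hV : ∃ x, V = connectedComponentIn (ball z₀ r \ A) x)
    (hV' : ∃ x, V' = connectedComponentIn (ball z₀ r \ A) x) {q : ℂ} (hqS : q ∈ sphere z₀ r)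
    (hqA : q ∉ A) (hq : q ∈ closure V) (hq' : q ∈ closure V') : V = V' := by
  obtain ⟨ε, hε, h⟩ := exists_ball_inter_subset hA hV hq hqA
  obtain ⟨ε', hε', h'⟩ := exists_ball_inter_subset hA hV' hq' hqA
  obtain ⟨y, hy⟩ : (ball q (min ε ε') ∩ ball z₀ r).Nonempty := by
    have : q ∈ closure (ball z₀ r) := by
      rw [closure_ball _ hr.ne']; exact sphere_subset_closedBall hqS
    exact mem_closure_iff.1 this _ isOpen_ball (mem_ball_self (lt_min hε hε'))
  have h1 := h ⟨ball_subset_ball (min_le_left _ _) hy.1, hy.2⟩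
  have h2 := h' ⟨ball_subset_ball (min_le_right _ _) hy.1, hy.2⟩
  obtain ⟨x, rfl⟩ := hV
  obtain ⟨x', rfl⟩ := hV'
  rw [connectedComponentIn_eq h1, connectedComponentIn_eq h2]

theorem exists_component_mem_closure (hr : 0 < r) (hA : IsClosed A) {q : ℂ}
    (hqS : q ∈ sphere z₀ r) (hqA : q ∉ A) :
    ∃ x ∈ ball z₀ r \ A, q ∈ closure (connectedComponentIn (ball z₀ r \ A) x) := by
  obtain ⟨ε, hε, hεA⟩ := Metric.isOpen_iff.1 hA.isOpen_compl q hqA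
  obtain ⟨y, hy⟩ : (ball q ε ∩ ball z₀ r).Nonempty := by
    have : q ∈ closure (ball z₀ r) := by
      rw [closure_ball _ hr.ne']; exact sphere_subset_closedBall hqS
    exact mem_closure_iff.1 this _ isOpen_ball (mem_ball_self hε)
  have hsub : ball q ε ∩ ball z₀ r ⊆ ball z₀ r \ A := fun z hz => ⟨hz.2, hεA hz.1⟩
  exact ⟨y, hsub hy, mem_closure_of_ball_inter_subset hr hqS (mem_ball_self hε)
    (((convex_ball q ε).inter (convex_ball z₀ r)).isPreconnected.subset_connectedComponentIn hy hsub)⟩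

end

end

section

open Filter Topology

/-- One of the two sides of the crosscut `A` of a disc. -/
structure IsSide (z₀ : ℂ) (r : ℝ) (A V : Set ℂ) : Prop where
  isOpen : IsOpen V
  isConnected : IsConnected V
  subset : V ⊆ ball z₀ r
  compl : IsPreconnected Vᶜ
  arc_subset : A ⊆ frontier V
  curve : CurveLike (frontier V)

theorem isPreconnected_compl_ball (p : ℂ) {r : ℝ} (hr : 0 < r) : IsPreconnected (ball p r)ᶜ := by
  refine (isPreconnected_compl_closedBall p hr).subset_closure
    (compl_subset_compl.2 ball_subset_closedBall) ?_
  rw [closure_compl, interior_closedBall _ hr.ne']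

theorem exists_sides_of_angle {z₀ : ℂ} {r : ℝ} (hr : 0 < r) {A : Set ℂ} {α β : ℝ} (hαβ : α < β)
    (hβα : β < α + 2 * Real.pi) (hA : IsArc A (circleMap z₀ r α) (circleMap z₀ r β))
    (hAD : A ⊆ closedBall z₀ r)
    (hAS : A ∩ sphere z₀ r ⊆ {circleMap z₀ r α, circleMap z₀ r β}) :
    ∃ V₁ V₂ : Set ℂ, IsSide z₀ r A V₁ ∧ IsSide z₀ r A V₂ ∧ Disjoint V₁ V₂ ∧
      ball z₀ r \ A = V₁ ∪ V₂ := by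
  have hpi := Real.pi_pos
  set a := circleMap z₀ r α with ha
  set b := circleMap z₀ r β with hb
  have hper : circleMap z₀ r (α + 2 * Real.pi) = a := periodic_circleMap z₀ r α
  have hS : ∀ θ, circleMap z₀ r θ ∈ sphere z₀ r := circleMap_mem_sphere z₀ hr.le
  have hAc := hA.isCompact.isClosed
  have hinj : ∀ u : ℝ, InjOn (circleMap z₀ r) (Ico u (u + 2 * Real.pi)) := fun u =>
    injOn_circleMap_of_abs_sub_le' hr.ne' (by linarith)
  set c₁ := circleMap z₀ r '' Icc α β with hc₁
  set c₂ := circleMap z₀ r '' Icc β (α + 2 * Real.pi) with hc₂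
  have hc₁A : IsArc c₁ a b := IsArc.of_param hαβ (continuous_circleMap z₀ r).continuousOn
    ((hinj α).mono (Icc_subset_Ico_right hβα))
  have hc₂A : IsArc c₂ a b := by
    have := (IsArc.of_param hβα (continuous_circleMap z₀ r).continuousOn
      ((hinj β).mono (Icc_subset_Ico_right (by linarith)))).symm
    rwa [hper] at this
  have hAci : ∀ {c : Set ℂ}, c ⊆ sphere z₀ r → A ∩ c ⊆ {a, b} := fun h z hz =>
    hAS ⟨hz.1, h hz.2⟩
  have hcS₁ : c₁ ⊆ sphere z₀ r := by rintro _ ⟨θ, -, rfl⟩; exact hS θ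
  have hcS₂ : c₂ ⊆ sphere z₀ r := by rintro _ ⟨θ, -, rfl⟩; exact hS θ
  have ho₁ : ∀ θ ∈ Ioo α β, circleMap z₀ r θ ∉ A := by
    intro θ hθ hθA
    rcases hAS ⟨hθA, hS θ⟩ with h | h
    · exact hθ.1.ne' (hinj α ⟨hθ.1.le, by linarith [hθ.2]⟩ ⟨le_rfl, by linarith⟩ h)
    · exact hθ.2.ne (hinj α ⟨hθ.1.le, by linarith [hθ.2]⟩ ⟨hαβ.le, by linarith⟩ h)
  have ho₂ : ∀ θ ∈ Ioo β (α + 2 * Real.pi), circleMap z₀ r θ ∉ A := by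
    intro θ hθ hθA
    rcases hAS ⟨hθA, hS θ⟩ with h | h
    · rw [← hper] at h
      exact hθ.2.ne (hinj β ⟨hθ.1.le, by linarith [hθ.2]⟩ ⟨hβα.le, by linarith⟩ h)
    · exact hθ.1.ne' (hinj β ⟨hθ.1.le, by linarith [hθ.2]⟩ ⟨le_rfl, by linarith⟩ h)
  have hcover : ∀ z ∈ sphere z₀ r, z ∈ A ∨ z ∈ circleMap z₀ r '' Ioo α β ∨
      z ∈ circleMap z₀ r '' Ioo β (α + 2 * Real.pi) := by
    intro z hz
    obtain ⟨θ', -, rfl⟩ := exists_circleMap_eq hz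
    obtain ⟨θ, hθ, h⟩ := (periodic_circleMap z₀ r).exists_mem_Ioc Real.two_pi_pos θ' α
    rw [h]
    rcases lt_trichotomy θ β with hlt | rfl | hlt
    · exact Or.inr (Or.inl ⟨θ, ⟨hθ.1, hlt⟩, rfl⟩)
    · exact Or.inl hA.right_mem
    · rcases hθ.2.lt_or_eq with hlt' | heq
      · exact Or.inr (Or.inr ⟨θ, ⟨hlt, hlt'⟩, rfl⟩)
      · rw [heq, hper]; exact Or.inl hA.left_mem
  have hθ₁ : (α + β) / 2 ∈ Ioo α β := ⟨by linarith, by linarith⟩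
  have hθ₂ : (β + (α + 2 * Real.pi)) / 2 ∈ Ioo β (α + 2 * Real.pi) := ⟨by linarith, by linarith⟩
  set q₁ := circleMap z₀ r ((α + β) / 2)
  set q₂ := circleMap z₀ r ((β + (α + 2 * Real.pi)) / 2)
  obtain ⟨x₁, hx₁, hq₁⟩ := exists_component_mem_closure hr hAc (hS _) (ho₁ _ hθ₁)
  obtain ⟨x₂, hx₂, hq₂⟩ := exists_component_mem_closure hr hAc (hS _) (ho₂ _ hθ₂)
  set C := fun x => connectedComponentIn (ball z₀ r \ A) x with hC
  have hCsub : ∀ x, C x ⊆ ball z₀ r \ A := connectedComponentIn_subset _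
  have hoD : IsOpen (ball z₀ r \ A) := isOpen_ball.sdiff hAc
  have hCo : ∀ x, IsOpen (C x) := fun x => hoD.connectedComponentIn
  have hCcl : ∀ x, closure (C x) ⊆ closedBall z₀ r := fun x =>
    closure_minimal (((hCsub x).trans sdiff_subset).trans ball_subset_closedBall) isClosed_closedBall
  have hclo₁ : circleMap z₀ r '' Ioo α β ⊆ closure (C x₁) := by
    refine subset_closure_of_mem hr hAc ⟨x₁, rfl⟩
      (isPreconnected_Ioo.image _ (continuous_circleMap z₀ r).continuousOn) ?_ ?_
      ⟨_, hθ₁, rfl⟩ hq₁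
    · rintro _ ⟨θ, -, rfl⟩; exact hS θ
    · rw [disjoint_left]; rintro _ ⟨θ, hθ, rfl⟩; exact ho₁ θ hθ
  have hclo₂ : circleMap z₀ r '' Ioo β (α + 2 * Real.pi) ⊆ closure (C x₂) := by
    refine subset_closure_of_mem hr hAc ⟨x₂, rfl⟩
      (isPreconnected_Ioo.image _ (continuous_circleMap z₀ r).continuousOn) ?_ ?_
      ⟨_, hθ₂, rfl⟩ hq₂
    · rintro _ ⟨θ, -, rfl⟩; exact hS θ
    · rw [disjoint_left]; rintro _ ⟨θ, hθ, rfl⟩; exact ho₂ θ hθ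
  have hne : C x₁ ≠ C x₂ := by
    intro heq
    have hT : IsPreconnected (insert q₁ (insert q₂ (C x₁))) := by
      refine isPreconnected_connectedComponentIn.subset_closure (s := C x₁)
        ((subset_insert _ _).trans (subset_insert _ _)) ?_
      refine insert_subset hq₁ (insert_subset ?_ subset_closure)
      rw [heq]; exact hq₂
    refine crossing hr hA.isCompact hA.isConnected.isPreconnected hT hAD ?_ ?_ hθ₁.1 hθ₁.2 hθ₂.1
      hθ₂.2 hA.left_mem (Or.inl rfl) hA.right_mem (Or.inr (Or.inl rfl))
    · refine insert_subset (hCcl _ hq₁) (insert_subset (hCcl _ hq₂) (subset_closure.trans (hCcl _)))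
    · rw [disjoint_right]
      rintro z (rfl | rfl | hz)
      · exact ho₁ _ hθ₁
      · exact ho₂ _ hθ₂
      · exact (hCsub _ hz).2
  have hor : ∀ x ∈ ball z₀ r \ A, C x = C x₁ ∨ C x = C x₂ := by
    intro x hx
    by_contra hcon
    push Not at hcon
    refine not_frontier_subset_of_unsep (hCo x) ⟨x, mem_connectedComponentIn hx⟩
      (isBounded_ball.subset ((hCsub x).trans sdiff_subset)) hA.isCompact.isBounded
      (disjoint_left.2 fun z hz => (hCsub x hz).2) (fun p q hp hq => hA.unsep hp hq) fun z hz => ?_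
    by_contra hzA
    have hzcl := frontier_subset_closure hz
    have hzb : z ∉ ball z₀ r := fun h => frontier_connectedComponentIn_subset hoD x hz ⟨h, hzA⟩
    have hzS : z ∈ sphere z₀ r := by
      have := hCcl x hzcl
      rw [← ball_union_sphere] at this
      exact this.resolve_left hzb
    rcases hcover z hzS with h | h | h
    · exact hzA h
    · exact hcon.1 (component_eq_of_mem_closure hr hAc ⟨x, rfl⟩ ⟨x₁, rfl⟩ hzS hzA hzcl (hclo₁ h))
    · exact hcon.2 (component_eq_of_mem_closure hr hAc ⟨x, rfl⟩ ⟨x₂, rfl⟩ hzS hzA hzcl (hclo₂ h))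
  have hdis : Disjoint (C x₁) (C x₂) := by
    rw [disjoint_left]
    intro z h1 h2
    exact hne ((connectedComponentIn_eq h1).trans (connectedComponentIn_eq h2).symm)
  have hcov : ball z₀ r \ A = C x₁ ∪ C x₂ := by
    refine Subset.antisymm (fun z hz => ?_) (union_subset (hCsub _) (hCsub _))
    have := mem_connectedComponentIn hz
    rcases hor z hz with h | h
    · exact Or.inl (h ▸ this)
    · exact Or.inr (h ▸ this)
  have hfrsub : ∀ x x' c c', C x ≠ C x' → c' ⊆ closure (C x') →
      (∀ z ∈ sphere z₀ r, z ∈ A ∨ z ∈ c ∨ z ∈ c') → frontier (C x) ⊆ A ∪ c := by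
    intro x x' c c' hne hcl hcov z hz
    by_cases hzA : z ∈ A
    · exact Or.inl hzA
    have hzcl := frontier_subset_closure hz
    have hzb : z ∉ ball z₀ r := fun h => frontier_connectedComponentIn_subset hoD x hz ⟨h, hzA⟩
    have hzS : z ∈ sphere z₀ r := by
      have := hCcl x hzcl
      rw [← ball_union_sphere] at this
      exact this.resolve_left hzb
    rcases hcov z hzS with h | h | h
    · exact absurd h hzA
    · exact Or.inr h
    · exact absurd (component_eq_of_mem_closure hr hAc ⟨x, rfl⟩ ⟨x', rfl⟩ hzS hzA hzcl (hcl h)) hne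
  have hfr₁ : frontier (C x₁) ⊆ A ∪ c₁ := (hfrsub x₁ x₂ _ _ hne hclo₂ hcover).trans
    (union_subset_union_right A (image_mono Ioo_subset_Icc_self))
  have hfr₂ : frontier (C x₂) ⊆ A ∪ c₂ :=
    (hfrsub x₂ x₁ _ _ hne.symm hclo₁ fun z hz => (hcover z hz).imp id Or.symm).trans
    (union_subset_union_right A (image_mono Ioo_subset_Icc_self))
  have hdisc : ∀ x c, c ⊆ sphere z₀ r → Disjoint (C x) (A ∪ c) := by
    intro x c hc
    rw [disjoint_left]
    rintro z hz (h | h)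
    · exact (hCsub x hz).2 h
    · have h1 := (hCsub x hz).1
      have h2 := hc h
      rw [mem_ball] at h1; rw [mem_sphere] at h2; linarith
  have hfreq : ∀ x c, x ∈ ball z₀ r \ A → IsArc c a b → c ⊆ sphere z₀ r →
      frontier (C x) ⊆ A ∪ c → frontier (C x) = A ∪ c := by
    intro x c hx hc hcS hfr
    have hb := isBounded_ball.subset ((hCsub x).trans sdiff_subset)
    have hn : (C x).Nonempty := ⟨x, mem_connectedComponentIn hx⟩
    refine hfr.antisymm (union_subset ?_ ?_)
    · exact subset_frontier_of_arcs hA hc (hAci hcS) (hCo x) hn hb hfr (hdisc x c hcS)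
    · exact subset_frontier_of_arcs hc hA (by rw [inter_comm]; exact hAci hcS) (hCo x) hn hb
        (by rwa [union_comm]) (by rw [union_comm]; exact hdisc x c hcS)
  have hE₁ := hfreq x₁ c₁ hx₁ hc₁A hcS₁ hfr₁
  have hE₂ := hfreq x₂ c₂ hx₂ hc₂A hcS₂ hfr₂
  have hcompl : ∀ x x', A ⊆ frontier (C x') → Disjoint (C x) (C x') →
      ball z₀ r \ A = C x ∪ C x' → IsPreconnected (C x)ᶜ := by
    intro x x' hf hd hcov
    have : (C x)ᶜ = (ball z₀ r)ᶜ ∪ closure (C x') := by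
      ext z
      constructor
      · intro hz
        by_cases hzb : z ∈ ball z₀ r
        · by_cases hzA : z ∈ A
          · exact Or.inr (frontier_subset_closure (hf hzA))
          · have : z ∈ C x ∪ C x' := hcov ▸ ⟨hzb, hzA⟩
            exact Or.inr (subset_closure (this.resolve_left hz))
        · exact Or.inl hzb
      · rintro (hz | hz) hzx
        · exact hz (hCsub x hzx).1
        · exact disjoint_left.1 (hd.closure_right (hCo x)) hzx hz
    rw [this]
    refine (isPreconnected_compl_ball z₀ hr).union a ?_ (frontier_subset_closure (hf hA.left_mem))
      isPreconnected_connectedComponentIn.closure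
    intro h
    have := hS α
    rw [← ha] at this
    rw [mem_ball] at h; rw [mem_sphere] at this; linarith
  refine ⟨C x₁, C x₂, ⟨hCo _, isConnected_connectedComponentIn_iff.2 hx₁,
      (hCsub _).trans sdiff_subset, ?_, ?_, ?_⟩, ⟨hCo _, isConnected_connectedComponentIn_iff.2 hx₂,
      (hCsub _).trans sdiff_subset, ?_, ?_, ?_⟩, hdis, hcov⟩
  · exact hcompl x₁ x₂ (hE₂ ▸ subset_union_left) hdis hcov
  · rw [hE₁]; exact subset_union_left
  · rw [hE₁]; exact curveLike_union hA hc₁A (hAci hcS₁)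
  · exact hcompl x₂ x₁ (hE₁ ▸ subset_union_left) hdis.symm (by rw [hcov, union_comm])
  · rw [hE₂]; exact subset_union_left
  · rw [hE₂]; exact curveLike_union hA hc₂A (hAci hcS₂)

theorem exists_sides {z₀ : ℂ} {r : ℝ} (hr : 0 < r) {A : Set ℂ} {a b : ℂ} (hA : IsArc A a b)
    (hAD : A ⊆ closedBall z₀ r) (ha : a ∈ sphere z₀ r) (hb : b ∈ sphere z₀ r)
    (hAS : A ∩ sphere z₀ r ⊆ {a, b}) :
    ∃ V₁ V₂ : Set ℂ, IsSide z₀ r A V₁ ∧ IsSide z₀ r A V₂ ∧ Disjoint V₁ V₂ ∧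
      ball z₀ r \ A = V₁ ∪ V₂ := by
  obtain ⟨α, hα, rfl⟩ := exists_circleMap_eq ha
  obtain ⟨β, hβ, rfl⟩ := exists_circleMap_eq hb
  rcases lt_trichotomy α β with h | h | h
  · exact exists_sides_of_angle hr h (by linarith [hα.1, hβ.2]) hA hAD hAS
  · exact absurd (by rw [h]) hA.ne
  · exact exists_sides_of_angle hr h (by linarith [hβ.1, hα.2]) hA.symm hAD (by rwa [pair_comm])

end

section

open Filter Topology

theorem isOpenMap_of_injective_real {f : ℝ → ℝ} (hf : Continuous f) (hi : Function.Injective f) :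
    IsOpenMap f := by
  have key : ∀ g : ℝ → ℝ, Continuous g → StrictMono g → IsOpenMap g := by
    intro g hg hm
    rw [isOpenMap_iff_nhds_le]
    intro x N hN
    rw [mem_map] at hN
    obtain ⟨ε, hε, hN⟩ := (nhds_basis_Icc_pos x).mem_iff.1 hN
    have h1 : g '' Icc (x - ε) (x + ε) ⊆ N := by rintro _ ⟨t, ht, rfl⟩; exact hN ht
    refine mem_of_superset (Icc_mem_nhds (hm (by linarith : x - ε < x)) (hm (by linarith : x < x + ε)))
      ((intermediate_value_Icc (by linarith) hg.continuousOn).trans h1)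
  rcases hf.strictMono_of_inj hi with h | h
  · exact key f hf h
  · have := (key (fun x => -f x) hf.neg fun x y hxy => neg_lt_neg (h hxy))
    have h2 := (Homeomorph.neg ℝ).isOpenMap.comp this
    convert h2 using 1
    ext x; simp

theorem exists_half_chart {V : Set ℂ} {G : ℂ → ℂ} {γ : ℝ → ℂ}
    (hG : ContinuousOn G (closedBall 0 1)) (hGi : InjOn G (closedBall 0 1))
    (hGV : G '' ball 0 1 = V) (hGS : G '' sphere 0 1 = frontier V) (hγ : Continuous γ)
    (hγi : Function.Injective γ) (hγV : ∀ s, γ s ∈ frontier V) :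
    ∃ E : ℝ × ℝ → ℂ, Continuous E ∧ (∀ s, E (s, 0) = γ s) ∧ InjOn E {p | 0 ≤ p.2} ∧
      (∀ p, 0 < p.2 → E p ∈ V) ∧
      ∀ p, 0 ≤ p.2 → ∀ N ∈ 𝓝 p, E '' (N ∩ {p | 0 ≤ p.2}) ∈ 𝓝[closure V] (E p) := by
  set F := Function.invFunOn G (closedBall 0 1) with hF
  have hFG : LeftInvOn F G (closedBall 0 1) := hGi.leftInvOn_invFunOn
  have hcl : G '' closedBall 0 1 = closure V := by
    rw [← ball_union_sphere, image_union, hGV, hGS, closure_eq_self_union_frontier]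
  have hFc : ContinuousOn F (closure V) :=
    hcl ▸ continuousOn_leftInv_image (isCompact_closedBall 0 1) hG hFG
  have hFV : ∀ z ∈ closure V, F z ∈ closedBall (0 : ℂ) 1 ∧ G (F z) = z := by
    rw [← hcl]
    rintro _ ⟨w, hw, rfl⟩
    rw [hFG hw]; exact ⟨hw, rfl⟩
  have hw1 : ∀ s, ‖F (γ s)‖ = 1 := by
    intro s
    obtain ⟨w, hw, h⟩ : γ s ∈ G '' sphere 0 1 := hGS ▸ hγV s
    rw [← h, hFG (sphere_subset_closedBall hw)]
    simpa using hw
  have hγc : ∀ s, γ s ∈ closure V := fun s => frontier_subset_closure (hγV s)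
  obtain ⟨l, hl, hle⟩ := exists_continuous_log (g := fun s => F (γ s))
    (hFc.comp_continuous hγ hγc)
    (fun s => norm_pos_iff.1 (by rw [hw1]; exact one_pos))
  have hlre : ∀ s, (l s).re = 0 := by
    intro s
    have := hw1 s
    rw [← hle, Complex.norm_exp] at this
    exact Real.exp_eq_one_iff _ |>.1 this
  let e : ℝ × ℝ → ℂ := fun p => Complex.exp (l p.1 - (p.2 : ℂ))
  have hec : Continuous e := by fun_prop
  have henorm : ∀ p, ‖e p‖ = Real.exp (-p.2) := by
    intro p
    simp only [e, Complex.norm_exp, Complex.sub_re, hlre, Complex.ofReal_re, zero_sub]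
  have heball : ∀ p, 0 ≤ p.2 → e p ∈ closedBall (0 : ℂ) 1 := fun p hp => by
    rw [mem_closedBall_zero_iff, henorm]; exact Real.exp_le_one_iff.2 (by linarith)
  have he0 : ∀ s, e (s, 0) = F (γ s) := fun s => by simp only [e]; rw [← hle]; simp
  have hli : Function.Injective fun s => (l s).im := by
    intro s s' h
    have h1 : l s = l s' := Complex.ext (by rw [hlre, hlre]) h
    have h2 : F (γ s) = F (γ s') := by rw [← hle, ← hle, h1]
    exact hγi (by rw [← (hFV _ (hγc s)).2, h2, (hFV _ (hγc s')).2])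
  have heo : IsOpenMap e := by
    have h1 := (Complex.equivRealProdCLM.symm.toHomeomorph.isOpenMap).comp
      ((Homeomorph.prodComm ℝ ℝ).isOpenMap.comp
      ((isOpenMap_of_injective_real (Complex.continuous_im.comp hl) hli).prodMap
        (Homeomorph.neg ℝ).isOpenMap))
    have h2 := Complex.isOpenMap_exp.comp h1
    convert h2 using 1
    ext p
    simp only [e, Function.comp]
    congr 1
    apply Complex.ext
    · simp [hlre]
    · simp
  have hei : InjOn e {p | 0 ≤ p.2} := by
    intro p hp q hq h
    have h1 : p.2 = q.2 := by
      have := congrArg norm h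
      rw [henorm, henorm, Real.exp_eq_exp] at this
      linarith
    refine Prod.ext ?_ h1
    have h2 : F (γ p.1) = F (γ q.1) := by
      simp only [e, Complex.exp_sub, h1] at h
      rw [← hle, ← hle]
      exact (div_left_inj' (Complex.exp_ne_zero _)).1 h
    exact hγi (by rw [← (hFV _ (hγc _)).2, h2, (hFV _ (hγc _)).2])
  have hmax : ∀ p : ℝ × ℝ, 0 ≤ p.2 → (p.1, max p.2 0) = p := fun p hp => by
    rw [max_eq_left hp]
  let E : ℝ × ℝ → ℂ := fun p => G (e (p.1, max p.2 0))
  have hE : ∀ p : ℝ × ℝ, 0 ≤ p.2 → E p = G (e p) := fun p hp => by simp only [E]; rw [hmax p hp]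
  refine ⟨E, ?_, ?_, ?_, ?_, ?_⟩
  · exact hG.comp_continuous (hec.comp (by fun_prop)) fun p => heball _ (le_max_right _ _)
  · intro s
    rw [hE _ le_rfl, he0]; exact (hFV _ (hγc s)).2
  · intro p hp q hq h
    rw [hE p hp, hE q hq] at h
    exact hei hp hq (hGi (heball p hp) (heball q hq) h)
  · intro p hp
    rw [hE p hp.le, ← hGV]
    refine ⟨_, ?_, rfl⟩
    rw [mem_ball_zero_iff, henorm]
    exact Real.exp_lt_one_iff.2 (by linarith)
  · intro p hp N hN
    have hpV : E p ∈ closure V := by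
      rw [hE p hp, ← hcl]; exact ⟨_, heball p hp, rfl⟩
    have hFE : F (E p) = e p := by rw [hE p hp, hFG (heball p hp)]
    have h1 : e '' N ∈ 𝓝 (F (E p)) := by rw [hFE]; exact heo.image_mem_nhds hN
    filter_upwards [(hFc _ hpV).preimage_mem_nhdsWithin h1, self_mem_nhdsWithin] with z hz hzV
    obtain ⟨q, hqN, hq⟩ := hz
    have hq0 : 0 ≤ q.2 := by
      have := (hFV z hzV).1
      rw [← hq, mem_closedBall_zero_iff, henorm, Real.exp_le_one_iff] at this
      linarith
    exact ⟨q, ⟨hqN, hq0⟩, by rw [hE q hq0, hq, (hFV z hzV).2]⟩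

end

section

open Filter Topology

theorem IsArc.exists_line_param {A : Set ℂ} {a b : ℂ} (hA : IsArc A a b) :
    ∃ γ : ℝ → ℂ, Continuous γ ∧ Function.Injective γ ∧ range γ = A \ {a, b} := by
  obtain ⟨γ, f, hγ, -, h0, h1, hγf, hfγ⟩ := hA.exists_coord
  have hpi := Real.pi_pos
  let h : ℝ → ℝ := fun s => 1 / 2 + Real.arctan s / Real.pi
  have hh : ∀ s, h s ∈ Ioo (0 : ℝ) 1 := by
    intro s
    have h1 := Real.neg_pi_div_two_lt_arctan s
    have h2 := Real.arctan_lt_pi_div_two s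
    have h3 : -(1 / 2) < Real.arctan s / Real.pi := by rw [lt_div_iff₀ hpi]; linarith
    have h4 : Real.arctan s / Real.pi < 1 / 2 := by rw [div_lt_iff₀ hpi]; linarith
    constructor <;> simp only [h] <;> linarith
  have hI : ∀ s, h s ∈ Icc (0 : ℝ) 1 := fun s => Ioo_subset_Icc_self (hh s)
  have hfa : f a = 0 := by rw [← h0]; exact (hγf 0 (by simp)).2
  have hfb : f b = 1 := by rw [← h1]; exact (hγf 1 (by simp)).2
  refine ⟨fun s => γ (h s), hγ.comp (by fun_prop), ?_, ?_⟩
  · intro s s' hs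
    have h2 : h s = h s' := by
      rw [← (hγf _ (hI s)).2, ← (hγf _ (hI s')).2]; exact congrArg f hs
    simp only [h, add_right_inj] at h2
    exact Real.arctan_injective ((div_left_inj' hpi.ne').1 h2)
  · apply Subset.antisymm
    · rintro _ ⟨s, rfl⟩
      refine ⟨(hγf _ (hI s)).1, ?_⟩
      have h2 := (hγf _ (hI s)).2
      rintro (h3 | h3)
      · simp only [] at h3
        rw [h3, hfa] at h2; exact (hh s).1.ne h2
      · simp only [mem_singleton_iff] at h3
        rw [h3, hfb] at h2; exact (hh s).2.ne h2.symm
    · rintro z ⟨hz, hzab⟩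
      obtain ⟨hfz, hγz⟩ := hfγ z hz
      have hz0 : f z ≠ 0 := fun h => hzab (Or.inl (by rw [← hγz, h, h0]))
      have hz1 : f z ≠ 1 := fun h => hzab (Or.inr (by rw [← hγz, h, h1]; rfl))
      have hl := lt_of_le_of_ne hfz.1 hz0.symm
      have hr := lt_of_le_of_ne hfz.2 hz1
      refine ⟨Real.tan (Real.pi * (f z - 1 / 2)), ?_⟩
      simp only [h]
      rw [Real.arctan_tan (by nlinarith) (by nlinarith), mul_div_cancel_left₀ _ hpi.ne']
      simpa using hγz

theorem crosscut_chart {A : Set ℂ} {a b z₀ : ℂ} {r : ℝ} (hr : 0 < r) (hA : IsArc A a b)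
    (hAD : A ⊆ closedBall z₀ r) (ha : a ∈ sphere z₀ r) (hb : b ∈ sphere z₀ r)
    (hAS : A ∩ sphere z₀ r ⊆ {a, b}) :
    ∃ θ : ℝ × ℝ → ℂ, IsOpenEmbedding θ ∧ (∀ p, θ p ∈ A ↔ p.2 = 0) ∧
      A \ {a, b} ⊆ θ '' {p | p.2 = 0} := by
  obtain ⟨V₁, V₂, h₁, h₂, hd, hV⟩ := exists_sides hr hA hAD ha hb hAS
  obtain ⟨γ, hγ, hγi, hγr⟩ := hA.exists_line_param
  have hγA : ∀ s, γ s ∈ A := fun s => (hγr ▸ mem_range_self s : γ s ∈ A \ {a, b}).1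
  have hγB : ∀ s, γ s ∈ ball z₀ r := by
    intro s
    have h : γ s ∈ A \ {a, b} := hγr ▸ mem_range_self s
    rw [← closedBall_sdiff_sphere]
    exact ⟨hAD h.1, fun h' => h.2 (hAS ⟨h.1, h'⟩)⟩
  have hchart : ∀ V, IsSide z₀ r A V → ∃ E : ℝ × ℝ → ℂ, Continuous E ∧ (∀ s, E (s, 0) = γ s) ∧
      InjOn E {p | 0 ≤ p.2} ∧ (∀ p, 0 < p.2 → E p ∈ V) ∧
      ∀ p, 0 ≤ p.2 → ∀ N ∈ 𝓝 p, E '' (N ∩ {p | 0 ≤ p.2}) ∈ 𝓝[closure V] (E p) := by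
    intro V h
    obtain ⟨G, hG, hGi, hGV, hGS⟩ := caratheodory h.isOpen h.isConnected
      (isBounded_ball.subset h.subset) h.compl h.curve
    exact exists_half_chart hG hGi hGV hGS hγ hγi fun s => h.arc_subset (hγA s)
  obtain ⟨E₁, hE₁, hEγ₁, hEi₁, hEV₁, hEo₁⟩ := hchart V₁ h₁
  obtain ⟨E₂, hE₂, hEγ₂, hEi₂, hEV₂, hEo₂⟩ := hchart V₂ h₂
  have hVA₁ : ∀ z ∈ V₁, z ∉ A := fun z hz => (hV ▸ Or.inl hz : z ∈ ball z₀ r \ A).2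
  have hVA₂ : ∀ z ∈ V₂, z ∉ A := fun z hz => (hV ▸ Or.inr hz : z ∈ ball z₀ r \ A).2
  let σ : ℝ × ℝ → ℝ × ℝ := fun p => (p.1, -p.2)
  have hσ : Continuous σ := by fun_prop
  have hσσ : ∀ p, σ (σ p) = p := fun p => by simp [σ]
  let θ : ℝ × ℝ → ℂ := fun p => if 0 ≤ p.2 then E₁ p else E₂ (σ p)
  have hEE : ∀ p : ℝ × ℝ, p.2 = 0 → E₁ p = γ p.1 ∧ E₂ p = γ p.1 := by
    rintro ⟨x, y⟩ h
    simp only at h; subst h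
    exact ⟨hEγ₁ x, hEγ₂ x⟩
  have hθ₁ : ∀ p : ℝ × ℝ, 0 ≤ p.2 → θ p = E₁ p := fun p hp => if_pos hp
  have hθ₂ : ∀ p : ℝ × ℝ, 0 ≤ p.2 → θ (σ p) = E₂ p := by
    intro p hp
    rcases hp.eq_or_lt with h | h
    · have h1 : (σ p).2 = 0 := by simp [σ, ← h]
      rw [hθ₁ _ h1.ge, (hEE _ h1).1, (hEE _ h.symm).2]
    · have h1 : ¬ 0 ≤ (σ p).2 := by simp only [σ]; linarith
      simp only [θ, if_neg h1, hσσ]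
  have hθA : ∀ p, θ p ∈ A ↔ p.2 = 0 := by
    intro p
    rcases lt_trichotomy p.2 0 with h | h | h
    · have h1 : 0 < (σ p).2 := by simp only [σ]; linarith
      have h2 : θ p ∈ V₂ := by rw [← hσσ p, hθ₂ _ h1.le]; exact hEV₂ _ h1
      exact ⟨fun h' => absurd h' (hVA₂ _ h2), fun h' => absurd h' h.ne⟩
    · refine ⟨fun _ => h, fun _ => ?_⟩
      rw [hθ₁ _ h.ge, (hEE _ h).1]; exact hγA _
    · have h2 : θ p ∈ V₁ := by rw [hθ₁ _ h.le]; exact hEV₁ _ h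
      exact ⟨fun h' => absurd h' (hVA₁ _ h2), fun h' => absurd h' h.ne'⟩
  have hneg : ∀ p : ℝ × ℝ, ¬ 0 ≤ p.2 → 0 < (σ p).2 ∧ θ p = E₂ (σ p) := fun p hp =>
    ⟨by simp only [σ]; linarith, if_neg hp⟩
  have hmix : ∀ p q : ℝ × ℝ, 0 ≤ p.2 → ¬ 0 ≤ q.2 → θ p ≠ θ q := by
    intro p q hp hq h
    have hq2 : θ q ∈ V₂ := by rw [(hneg q hq).2]; exact hEV₂ _ (hneg q hq).1
    rcases hp.eq_or_lt with h0 | h0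
    · exact hVA₂ _ hq2 (h ▸ (hθA p).2 h0.symm)
    · refine disjoint_left.1 hd ?_ hq2
      rw [← h, hθ₁ p hp]; exact hEV₁ p h0
  have hθi : Function.Injective θ := by
    intro p q h
    by_cases hp : 0 ≤ p.2 <;> by_cases hq : 0 ≤ q.2
    · rw [hθ₁ p hp, hθ₁ q hq] at h
      exact hEi₁ hp hq h
    · exact absurd h (hmix p q hp hq)
    · exact absurd h.symm (hmix q p hq hp)
    · rw [(hneg p hp).2, (hneg q hq).2] at h
      rw [← hσσ p, hEi₂ (hneg p hp).1.le (hneg q hq).1.le h, hσσ]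
  have hθc : Continuous θ := by
    refine Continuous.if_le hE₁ (hE₂.comp hσ) continuous_const continuous_snd fun p hp => ?_
    have h1 : (σ p).2 = 0 := by simp [σ, ← hp]
    rw [(hEE p hp.symm).1, (hEE _ h1).2]
  have ho₁ : ∀ p : ℝ × ℝ, 0 ≤ p.2 → ∀ N ∈ 𝓝 p, θ '' N ∈ 𝓝[closure V₁] (θ p) := by
    intro p hp N hN
    rw [hθ₁ p hp]
    refine mem_of_superset (hEo₁ p hp N hN) ?_
    rintro _ ⟨q, ⟨hq, hq0⟩, rfl⟩
    exact ⟨q, hq, hθ₁ q hq0⟩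
  have ho₂ : ∀ p : ℝ × ℝ, p.2 ≤ 0 → ∀ N ∈ 𝓝 p, θ '' N ∈ 𝓝[closure V₂] (θ p) := by
    intro p hp N hN
    have h0 : 0 ≤ (σ p).2 := by simp only [σ]; linarith
    have h1 : θ p = E₂ (σ p) := by rw [← hθ₂ _ h0, hσσ]
    rw [h1]
    have h2 : σ ⁻¹' N ∈ 𝓝 (σ p) := hσ.continuousAt.preimage_mem_nhds (by rwa [hσσ])
    refine mem_of_superset (hEo₂ _ h0 _ h2) ?_
    rintro _ ⟨q, ⟨hq, hq0⟩, rfl⟩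
    exact ⟨σ q, hq, hθ₂ q hq0⟩
  have hθo : IsOpenMap θ := by
    rw [isOpenMap_iff_nhds_le]
    intro p S hS
    refine mem_of_superset (?_ : θ '' (θ ⁻¹' S) ∈ 𝓝 (θ p)) (image_preimage_subset θ S)
    have hN : θ ⁻¹' S ∈ 𝓝 p := hS
    rcases lt_trichotomy p.2 0 with h | h | h
    · have h2 : θ p ∈ V₂ := by
        rw [(hneg p h.not_ge).2]; exact hEV₂ _ (hneg p h.not_ge).1
      have := ho₂ p h.le _ hN
      rwa [nhdsWithin_eq_nhds.2 (mem_of_superset (h₂.isOpen.mem_nhds h2) subset_closure)] at this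
    · have h3 : closure V₁ ∪ closure V₂ ∈ 𝓝 (θ p) := by
        have hB : θ p ∈ ball z₀ r := by rw [hθ₁ p h.ge, (hEE p h).1]; exact hγB _
        refine mem_of_superset (isOpen_ball.mem_nhds hB) fun z hz => ?_
        by_cases hzA : z ∈ A
        · exact Or.inl (frontier_subset_closure (h₁.arc_subset hzA))
        · have h4 : z ∈ V₁ ∪ V₂ := hV ▸ ⟨hz, hzA⟩
          exact h4.imp (fun h => subset_closure h) fun h => subset_closure h
      rw [← nhdsWithin_eq_nhds.2 h3, nhdsWithin_union]
      exact ⟨ho₁ p h.ge _ hN, ho₂ p h.le _ hN⟩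
    · have h2 : θ p ∈ V₁ := by rw [hθ₁ p h.le]; exact hEV₁ _ h
      have := ho₁ p h.le _ hN
      rwa [nhdsWithin_eq_nhds.2 (mem_of_superset (h₁.isOpen.mem_nhds h2) subset_closure)] at this
  refine ⟨θ, .of_continuous_injective_isOpenMap hθc hθi hθo, hθA, ?_⟩
  rw [← hγr]
  rintro _ ⟨s, rfl⟩
  exact ⟨(s, 0), rfl, by rw [hθ₁ _ le_rfl, hEγ₁]⟩

end

section

open Filter Topology

theorem exists_isOpenEmbedding_interval (c : ℝ) {η : ℝ} (hη : 0 < η) :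
    ∃ k : ℝ → ℝ, IsOpenEmbedding k ∧ k 0 = c ∧ ∀ s, |k s - c| < η := by
  have hpi := Real.pi_pos
  let k : ℝ → ℝ := fun s => c + 2 * η / Real.pi * Real.arctan s
  have hk : Continuous k := by fun_prop
  have hki : Function.Injective k := by
    intro s s' h
    simp only [k, add_right_inj] at h
    exact Real.arctan_injective (mul_left_cancel₀ (by positivity) h)
  refine ⟨k, .of_continuous_injective_isOpenMap hk hki (isOpenMap_of_injective_real hk hki),
    by simp [k], fun s => ?_⟩
  have h1 : |Real.arctan s| < Real.pi / 2 :=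
    abs_lt.2 ⟨by linarith [Real.neg_pi_div_two_lt_arctan s], Real.arctan_lt_pi_div_two s⟩
  simp only [k, add_sub_cancel_left, abs_mul]
  rw [abs_of_pos (by positivity), div_mul_eq_mul_div, div_lt_iff₀ hpi]
  nlinarith

theorem exists_local_chart {J A : Set ℂ} {a b z₀ x : ℂ} {r δ : ℝ} (hr : 0 < r) (hA : IsArc A a b)
    (hAD : A ⊆ closedBall z₀ r) (ha : a ∈ sphere z₀ r) (hb : b ∈ sphere z₀ r)
    (hAS : A ∩ sphere z₀ r ⊆ {a, b}) (hx : x ∈ A) (hxa : x ≠ a) (hxb : x ≠ b) (hδ : 0 < δ)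
    (hJ : J ∩ ball x δ = A ∩ ball x δ) :
    ∃ U : Set ℂ, IsOpen U ∧ x ∈ U ∧ U ⊆ ball x δ ∧ ∃ φ : ↥U ≃ₜ ℝ × ℝ,
      {p | ∃ y : ↥U, (y : ℂ) ∈ J ∧ φ y = p} = {p | p.2 = 0} := by
  obtain ⟨θ, hθ, hθA, hAθ⟩ := crosscut_chart hr hA hAD ha hb hAS
  have hxm : x ∈ A \ {a, b} := ⟨hx, by simp [hxa, hxb]⟩
  obtain ⟨⟨s, y⟩, hy, hθx⟩ := hAθ hxm
  have hy : y = 0 := hy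
  subst hy
  have h1 : θ ⁻¹' ball x δ ∈ 𝓝 (s, (0 : ℝ)) :=
    hθ.continuous.continuousAt.preimage_mem_nhds (by rw [hθx]; exact ball_mem_nhds x hδ)
  obtain ⟨η, hη, hball⟩ := Metric.mem_nhds_iff.1 h1
  obtain ⟨k, hk, hk0, hkη⟩ := exists_isOpenEmbedding_interval s hη
  obtain ⟨k', hk', hk0', hkη'⟩ := exists_isOpenEmbedding_interval 0 hη
  let ψ : ℝ × ℝ → ℂ := θ ∘ Prod.map k k'
  have hψ : IsOpenEmbedding ψ := hθ.comp (hk.prodMap hk')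
  have hψB : ∀ p, ψ p ∈ ball x δ := by
    intro p
    apply hball
    rw [mem_ball, Prod.dist_eq, Real.dist_eq, Real.dist_eq]
    exact max_lt (hkη _) (hkη' _)
  have hψA : ∀ p, ψ p ∈ J ↔ p.2 = 0 := by
    intro p
    have h2 : ψ p ∈ J ↔ ψ p ∈ A := by
      constructor <;> intro h
      · have h3 : ψ p ∈ A ∩ ball x δ := hJ ▸ ⟨h, hψB p⟩
        exact h3.1
      · have h3 : ψ p ∈ J ∩ ball x δ := hJ ▸ ⟨h, hψB p⟩
        exact h3.1
    rw [h2]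
    refine (hθA _).trans ⟨fun h => hk'.injective (h.trans hk0'.symm), fun h => ?_⟩
    simp [h, hk0']
  refine ⟨range ψ, hψ.isOpen_range, ⟨(0, 0), by simp [ψ, hk0, hk0', hθx]⟩,
    range_subset_iff.2 hψB, hψ.toIsEmbedding.toHomeomorph.symm, ?_⟩
  ext p
  constructor
  · rintro ⟨⟨_, q, rfl⟩, hq, h⟩
    have h3 : q = p := by
      rw [← h, Homeomorph.eq_symm_apply]; rfl
    rw [← h3]
    exact (hψA q).1 hq
  · intro hp
    refine ⟨⟨ψ p, p, rfl⟩, (hψA p).2 hp, ?_⟩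
    rw [Homeomorph.symm_apply_eq]; rfl

end

section

open Filter Topology

theorem LebMonotoneOn.neg {E : Type*} [TopologicalSpace E] {Ω : Set E} {u : E → ℝ}
    (h : LebMonotoneOn Ω u) : LebMonotoneOn Ω fun z => -u z := by
  intro U h1 h2 h3 h4
  obtain ⟨h5, h6⟩ := h U h1 h2 h3 h4
  constructor
  · obtain ⟨y, hy, hy'⟩ := h6
    exact ⟨y, hy, fun z hz => neg_le_neg (hy' z hz)⟩
  · obtain ⟨y, hy, hy'⟩ := h5
    exact ⟨y, hy, fun z hz => neg_le_neg (hy' z hz)⟩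

variable {Ω : Set ℂ} {u : ℂ → ℝ} {t : ℝ}

theorem exists_superlevel_to_sphere (hu : ContinuousOn u Ω) (hm : LebMonotoneOn Ω u)
    {p q : ℂ} {R : ℝ} (hD : closedBall p R ⊆ Ω) (hq : q ∈ ball p R) (hqt : t < u q) :
    ∃ S, IsPreconnected S ∧ q ∈ S ∧ S ⊆ closedBall p R ∧ (S ∩ sphere p R).Nonempty ∧
      ∀ z ∈ S, z ∈ sphere p R ∨ u z ≠ t := by
  have hub : ContinuousOn u (ball p R) := hu.mono (ball_subset_closedBall.trans hD)
  let W := ball p R ∩ u ⁻¹' Ioi t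
  have hW : IsOpen W := hub.isOpen_inter_preimage isOpen_ball isOpen_Ioi
  let O := connectedComponentIn W q
  have hO : IsOpen O := hW.connectedComponentIn
  have hqO : q ∈ O := mem_connectedComponentIn ⟨hq, hqt⟩
  have hOW : O ⊆ W := connectedComponentIn_subset _ _
  have hOD : closure O ⊆ closedBall p R :=
    closure_minimal (hOW.trans (inter_subset_left.trans ball_subset_closedBall)) isClosed_closedBall
  obtain ⟨y, hyO, hy⟩ : (closure O ∩ sphere p R).Nonempty := by
    by_contra hcon
    rw [not_nonempty_iff_eq_empty] at hcon
    obtain ⟨⟨z, hz, hzm⟩, -⟩ := hm O hO ⟨q, hqO⟩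
      ((isCompact_closedBall p R).of_isClosed_subset isClosed_closure hOD) (hOD.trans hD)
    have h1 := hzm q (subset_closure hqO)
    have h2 : z ∉ W := frontier_connectedComponentIn_subset hW q hz
    have h3 : z ∈ ball p R := by
      rw [← closedBall_sdiff_sphere]
      exact ⟨hOD hz.1, fun h => (hcon ▸ ⟨hz.1, h⟩ : z ∈ (∅ : Set ℂ))⟩
    exact h2 ⟨h3, hqt.trans_le h1⟩
  refine ⟨insert y O, isPreconnected_connectedComponentIn.subset_closure (subset_insert _ _)
    (insert_subset hyO subset_closure), Or.inr hqO, insert_subset (hOD hyO)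
    (subset_closure.trans hOD), ⟨y, Or.inl rfl, hy⟩, ?_⟩
  rintro z (rfl | hz)
  · exact Or.inl hy
  · exact Or.inr (hOW hz).2.ne'

theorem exists_offlevel_to_sphere (hu : ContinuousOn u Ω) (hm : LebMonotoneOn Ω u)
    {p q : ℂ} {R : ℝ} (hD : closedBall p R ⊆ Ω) (hq : q ∈ ball p R) (hqt : u q ≠ t) :
    ∃ S, IsPreconnected S ∧ q ∈ S ∧ S ⊆ closedBall p R ∧ (S ∩ sphere p R).Nonempty ∧
      ∀ z ∈ S, z ∈ sphere p R ∨ u z ≠ t := by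
  rcases hqt.lt_or_gt with h | h
  · obtain ⟨S, h1, h2, h3, h4, h5⟩ := exists_superlevel_to_sphere (t := -t) hu.neg
      (LebMonotoneOn.neg hm) hD hq (neg_lt_neg h)
    exact ⟨S, h1, h2, h3, h4, fun z hz => (h5 z hz).imp_right fun h g => h (congrArg Neg.neg g)⟩
  · exact exists_superlevel_to_sphere hu hm hD hq h

theorem not_unsep_level (hu : ContinuousOn u Ω) {p q₁ q₂ : ℂ} {R : ℝ} (hD : closedBall p R ⊆ Ω)
    (hq₁ : q₁ ∈ ball p R) (h₁ : t < u q₁) (h₂ : u q₂ < t) :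
    ¬ Unsep (({z ∈ Ω | u z = t} ∩ closedBall p R) ∪ sphere p R) q₁ q₂ := by
  rintro ⟨S, hS, hSc, hS₁, hS₂⟩
  have hSB : S ⊆ ball p R := by
    intro z hz
    by_contra hzB
    obtain ⟨w, hw, hwR⟩ := hS.intermediate_value hS₁ hz
      (f := fun z => dist z p) (by fun_prop) (⟨(mem_ball.1 hq₁).le, not_lt.1 hzB⟩ : R ∈ Icc _ _)
    exact hSc hw (Or.inr hwR)
  have hSD : S ⊆ closedBall p R := hSB.trans ball_subset_closedBall
  obtain ⟨w, hw, hwt⟩ := hS.intermediate_value hS₂ hS₁ (hu.mono (hSD.trans hD)) ⟨h₂.le, h₁.le⟩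
  exact hSc hw (Or.inl ⟨⟨hD (hSD hw), hwt⟩, hSD hw⟩)

theorem level_component_meets_sphere (hu : ContinuousOn u Ω) (hm : LebMonotoneOn Ω u)
    (hN : Nice Ω {z ∈ Ω | u z = t})
    (hext : ∀ x ∈ Ω, u x = t → ∀ ε > 0, (∃ q ∈ ball x ε, t < u q) ∧ ∃ q ∈ ball x ε, u q < t)
    {p x : ℂ} {R : ℝ} (hD : closedBall p R ⊆ Ω) (hxΩ : u x = t) (hx : x ∈ ball p R) :
    (connectedComponentIn ({z ∈ Ω | u z = t} ∩ closedBall p R) x ∩ sphere p R).Nonempty := by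
  by_contra hcon
  rw [not_nonempty_iff_eq_empty] at hcon
  set L := {z ∈ Ω | u z = t} with hL
  have hxD := ball_subset_closedBall hx
  obtain ⟨Z, hZY, hZ, hZ', hxZ, hZT⟩ := exists_separation_of_component (hN.cpt p R hD)
    isClosed_sphere (x := x) ⟨⟨hD hxD, hxΩ⟩, hxD⟩ hcon
  have hZs : ∀ z ∈ Z, z ∉ sphere p R := fun z hz h => (hZT ▸ ⟨hz, h⟩ : z ∈ (∅ : Set ℂ))
  obtain ⟨ε, hε, hεs⟩ := Metric.isOpen_iff.1 (isOpen_ball.inter hZ'.isClosed.isOpen_compl) x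
    ⟨hx, fun h => h.2 hxZ⟩
  obtain ⟨⟨q₁, hq₁, h₁⟩, q₂, hq₂, h₂⟩ := hext x (hD hxD) hxΩ ε hε
  have htoS : ∀ q ∈ ball x ε, u q ≠ t → ∃ y ∈ sphere p R, Unsep Z q y := by
    intro q hq hqt
    obtain ⟨S, g1, g2, g3, ⟨y, hyS, hy⟩, g5⟩ := exists_offlevel_to_sphere hu hm hD (hεs hq).1 hqt
    exact ⟨y, hy, S, g1, fun z hz hzZ => (g5 z hz).elim (hZs z hzZ) fun h => h (hZY hzZ).1.2,
      g2, hyS⟩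
  obtain ⟨y₁, hy₁, hU₁⟩ := htoS q₁ hq₁ h₁.ne'
  obtain ⟨y₂, hy₂, hU₂⟩ := htoS q₂ hq₂ h₂.ne
  have hUs : Unsep Z y₁ y₂ := ⟨sphere p R,
    isPreconnected_sphere (by rw [Complex.rank_real_complex]; norm_num) p R,
    fun z hz hzZ => hZs z hzZ hz, hy₁, hy₂⟩
  have hUB : Unsep ((L ∩ closedBall p R) \ Z ∪ sphere p R) q₁ q₂ := by
    refine ⟨ball x ε, (convex_ball x ε).isPreconnected, ?_, hq₁, hq₂⟩
    rintro z hz (h | h)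
    · exact (hεs hz).2 h
    · exact (mem_ball.1 (hεs hz).1).ne h
  have hempty : Z ∩ ((L ∩ closedBall p R) \ Z ∪ sphere p R) = ∅ := by
    ext z
    simp only [mem_inter_iff, mem_union, mem_empty_iff_false, iff_false]
    rintro ⟨hz, h | h⟩
    · exact h.2 hz
    · exact hZs z hz h
  refine not_unsep_level hu hD (hεs hq₁).1 h₁ h₂ (((hU₁.trans (hUs.trans hU₂.symm)).union hZ
    (hZ'.union (isCompact_sphere p R)) (hempty ▸ isPreconnected_empty) hUB).mono ?_)
  rw [← union_assoc, union_sdiff_cancel hZY]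

end

section

open Filter Topology

variable {Ω C : Set ℂ} {u : ℂ → ℝ} {t : ℝ}

theorem Nice.arc_endpoint_isOpen (h : Nice Ω C) (hC : IsPreconnected C) (hf : FewHits Ω C)
    {p : ℂ} (hno : ∀ A ⊆ C, ∀ a b, IsArc A a b → p ∈ A → p = a ∨ p = b) {A : Set ℂ} {a : ℂ}
    (hA : IsArc A p a) (hAC : A ⊆ C) : ∃ δ > 0, C ∩ ball p δ ⊆ A := by
  obtain ⟨r, hr, hrΩ⟩ := Metric.nhds_basis_closedBall.mem_iff.1
    ((h.isOpen.sdiff (isClosed_singleton (x := a))).mem_nhds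
      (show p ∈ Ω \ {a} from ⟨h.sub (hAC hA.left_mem), hA.ne⟩))
  obtain ⟨K, h1, h2, h3, h4, δ, hδ, h5⟩ :=
    h.exists_local hC (hAC hA.left_mem) hr (hrΩ.trans sdiff_subset)
  refine ⟨δ, hδ, fun z hz => ?_⟩
  by_contra hzA
  have hKC : K ⊆ C := fun w hw => (h4 hw).1
  obtain ⟨B, hBK, hB⟩ := (h.of_isCompact hKC h1).exists_isArc h2 (h5 hz) h3
    (fun h0 => hzA (h0 ▸ hA.left_mem))
  obtain ⟨w, hw, B', hB'B, hB', hB'A⟩ :=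
    hB.exists_first_hit hA.isCompact.isClosed hzA hA.left_mem
  have hB'C : B' ⊆ C := hB'B.trans (hBK.trans hKC)
  have hwa : w ≠ a := (hrΩ (h4 (hBK (hB'B hB'.right_mem))).2).2
  rcases eq_or_ne w p with rfl | hwp
  · rcases hno _ (union_subset hB'C hAC) z a (hB'.union hA hB'A.subset)
      (Or.inr hA.left_mem) with h0 | h0
    · exact hzA (h0 ▸ hw)
    · exact hwa h0
  · obtain ⟨A₁, A₂, hA₁, hA₂, hU, hI⟩ := hA.split hw hwp hwa
    have hs1 : A₁ ⊆ A := hU ▸ subset_union_left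
    have hs2 : A₂ ⊆ A := hU ▸ subset_union_right
    refine hf.no_arc_triod h.isOpen h.sub (hs1.trans hAC) (hs2.trans hAC) hB'C
      hA₁ hA₂.symm hB' hI.subset ?_ ?_
    · rw [← hB'A, inter_comm]
      exact inter_subset_inter_right _ hs2
    · rw [← hB'A, inter_comm]
      exact inter_subset_inter_right _ hs1

theorem level_exists_interior_arc (hu : ContinuousOn u Ω)
    (hext : ∀ x ∈ Ω, u x = t → ∀ ε > 0, (∃ q ∈ ball x ε, t < u q) ∧ ∃ q ∈ ball x ε, u q < t)
    (hCn : Nice Ω C) (hC : IsPreconnected C) (hf : FewHits Ω C) (hCL : C ⊆ {z ∈ Ω | u z = t})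
    {p : ℂ} {δ : ℝ} (hδ : 0 < δ) (hpδ : {z ∈ Ω | u z = t} ∩ ball p δ ⊆ C) (hp : p ∈ C)
    (hne : ∃ a ∈ C, a ≠ p) : ∃ A ⊆ C, ∃ a b, IsArc A a b ∧ p ∈ A ∧ p ≠ a ∧ p ≠ b := by
  by_contra! hcon
  have hno : ∀ A ⊆ C, ∀ a b, IsArc A a b → p ∈ A → p = a ∨ p = b := fun A hA a b hab hpA =>
    or_iff_not_imp_left.2 fun h => hcon A hA a b hab hpA h
  obtain ⟨a, haC, hap⟩ := hne
  obtain ⟨A, hAC, hA⟩ := hCn.exists_isArc hC hp haC hap.symm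
  obtain ⟨η, hη, hηA⟩ := hCn.arc_endpoint_isOpen hC hf hno hA hAC
  obtain ⟨ρ, hρ, hρΩ⟩ := Metric.nhds_basis_closedBall.mem_iff.1 (hCn.isOpen.mem_nhds (hCn.sub hp))
  obtain ⟨R, hR, hRm⟩ : ∃ R > 0, R < min (min δ η) (min ρ (dist a p)) :=
    exists_between (lt_min (lt_min hδ hη) (lt_min hρ (dist_pos.2 hap)))
  have hRδ : R < δ := hRm.trans_le ((min_le_left _ _).trans (min_le_left _ _))
  have hRη : R < η := hRm.trans_le ((min_le_left _ _).trans (min_le_right _ _))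
  have hRρ : R < ρ := hRm.trans_le ((min_le_right _ _).trans (min_le_left _ _))
  have hRa : R < dist a p := hRm.trans_le ((min_le_right _ _).trans (min_le_right _ _))
  have hD : closedBall p R ⊆ Ω := (closedBall_subset_closedBall hRρ.le).trans hρΩ
  have hT : IsClosed (ball p R)ᶜ := isOpen_ball.isClosed_compl
  obtain ⟨w, hw, B, D, hB, hBT, hDc, hBD, hBDi⟩ := hA.exists_first_hit_split hT
    (fun h => h (mem_ball_self hR)) (fun h => (mem_ball.1 h).not_gt hRa)
  have hpD : p ∉ D := fun h => hB.ne (hBDi ▸ ⟨hB.left_mem, h⟩ : p ∈ ({w} : Set ℂ))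
  obtain ⟨ε, hε, hεs⟩ := Metric.isOpen_iff.1 (isOpen_ball.inter hDc.isClosed.isOpen_compl) p
    ⟨mem_ball_self hR, hpD⟩
  obtain ⟨⟨q₁, hq₁, h₁⟩, q₂, hq₂, h₂⟩ := hext p (hCn.sub hp) (hCL hp).2 ε hε
  have hBL : ∀ z ∈ B, u z = t := fun z hz => (hCL (hAC (hBD ▸ Or.inl hz))).2
  have hUB : Unsep B q₁ q₂ := hB.unsep (fun h => h₁.ne' (hBL _ h)) fun h => h₂.ne (hBL _ h)
  have hannc : IsCompact (closedBall p (dist w p + R) \ ball p R) :=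
    (isCompact_closedBall p _).diff isOpen_ball
  have hUD : Unsep (D ∪ (closedBall p (dist w p + R) \ ball p R)) q₁ q₂ := by
    refine ⟨ball p ε, (convex_ball p ε).isPreconnected, ?_, hq₁, hq₂⟩
    rintro z hz (h | h)
    · exact (hεs hz).2 h
    · exact h.2 (hεs hz).1
  have hI : B ∩ (D ∪ (closedBall p (dist w p + R) \ ball p R)) = {w} := by
    apply Subset.antisymm
    · rintro z ⟨hz, h | h⟩
      · rw [← hBDi]; exact ⟨hz, h⟩
      · rw [← hBT]; exact ⟨hz, h.2⟩
    · have h0 : w ∈ B ∩ D := hBDi ▸ mem_singleton w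
      exact singleton_subset_iff.2 ⟨h0.1, Or.inl h0.2⟩
  refine not_unsep_level hu hD (hεs hq₁).1 h₁ h₂ ((hUB.union hB.isCompact (hDc.union hannc)
    (hI ▸ isPreconnected_singleton) hUD).mono ?_)
  rw [← union_assoc, hBD]
  have hwR : R ≤ dist w p + R := by linarith [dist_nonneg (x := w) (y := p)]
  rintro z (⟨hzL, hzD⟩ | hz)
  · have hzδ : z ∈ ball p δ := mem_ball.2 ((mem_closedBall.1 hzD).trans_lt hRδ)
    exact Or.inl (hηA ⟨hpδ ⟨hzL, hzδ⟩, mem_ball.2 ((mem_closedBall.1 hzD).trans_lt hRη)⟩)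
  · have hz : dist z p = R := hz
    exact Or.inr ⟨mem_closedBall.2 (hz.le.trans hwR), fun h => (mem_ball.1 h).ne hz⟩

/-- An arc with prescribed end is shortened to one meeting a sphere only at its end. -/
theorem IsArc.exists_subarc_to_sphere {A : Set ℂ} {p a : ℂ} {R : ℝ} (hA : IsArc A p a) (hR : 0 < R)
    (ha : R < dist a p) : ∃ w ∈ sphere p R, ∃ B ⊆ A, IsArc B p w ∧ B ⊆ closedBall p R ∧
      B ∩ sphere p R = {w} := by
  obtain ⟨w, hw, B, hBA, hB, hBT⟩ := hA.exists_first_hit (T := (ball p R)ᶜ)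
    isOpen_ball.isClosed_compl (fun h => h (mem_ball_self hR)) (fun h => (mem_ball.1 h).not_gt ha)
  have hsub : sphere p R ⊆ (ball p R)ᶜ := fun z hz h => (mem_ball.1 h).ne hz
  have hws : w ∈ sphere p R := by
    obtain ⟨z, hz, hzR⟩ := hB.isConnected.isPreconnected.intermediate_value hB.left_mem
      hB.right_mem (f := fun z => dist z p) (by fun_prop)
      (⟨by simpa using hR.le, by simpa using hw⟩ : R ∈ Icc _ _)
    have h1 : z ∈ B ∩ (ball p R)ᶜ := ⟨hz, hsub hzR⟩
    rw [hBT] at h1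
    exact h1 ▸ hzR
  refine ⟨w, hws, B, hBA, hB, fun z hz => ?_, ?_⟩
  · by_cases hzb : z ∈ ball p R
    · exact ball_subset_closedBall hzb
    · have h1 : z ∈ B ∩ (ball p R)ᶜ := ⟨hz, hzb⟩
      rw [hBT] at h1
      exact h1 ▸ sphere_subset_closedBall hws
  · apply Subset.antisymm
    · rw [← hBT]; exact inter_subset_inter_right _ hsub
    · rintro _ rfl
      exact ⟨hB.right_mem, hws⟩

theorem level_isEmbedded1Submanifold (hu : ContinuousOn u Ω) (hm : LebMonotoneOn Ω u)
    (hN : Nice Ω {z ∈ Ω | u z = t}) (hf : FewHits Ω {z ∈ Ω | u z = t})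
    (hext : ∀ x ∈ Ω, u x = t → ∀ ε > 0, (∃ q ∈ ball x ε, t < u q) ∧ ∃ q ∈ ball x ε, u q < t) :
    IsEmbedded1Submanifold {z ∈ Ω | u z = t} := by
  set L := {z ∈ Ω | u z = t} with hL
  intro p hp
  obtain ⟨ρ, hρ, hρΩ⟩ := Metric.nhds_basis_closedBall.mem_iff.1 (hN.isOpen.mem_nhds hp.1)
  have hmeet : ∀ x ∈ L ∩ closedBall p (ρ / 2),
      (connectedComponentIn (L ∩ closedBall p ρ) x ∩ sphere p ρ).Nonempty := fun x hx =>
    level_component_meets_sphere hu hm hN hext hρΩ hx.1.2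
      (mem_ball.2 ((mem_closedBall.1 hx.2).trans_lt (by linarith)))
  obtain ⟨δ, hδ, hδC⟩ := hN.exists_ball_subset_component hp hρ hρΩ hmeet
  set C := connectedComponentIn (L ∩ closedBall p ρ) p with hCdef
  have hCL : C ⊆ L := (connectedComponentIn_subset _ _).trans inter_subset_left
  have hCn : Nice Ω C := hN.of_isCompact hCL (isCompact_component (hN.cpt p ρ hρΩ) p)
  have hC : IsPreconnected C := isPreconnected_connectedComponentIn
  have hCf : FewHits Ω C := hf.mono subset_rfl hCL
  have hpC : p ∈ C := mem_connectedComponentIn ⟨hp, mem_closedBall_self hρ.le⟩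
  have hne : ∃ a ∈ C, a ≠ p := by
    obtain ⟨a, haC, ha⟩ := hmeet p ⟨hp, mem_closedBall_self (by linarith)⟩
    refine ⟨a, haC, ?_⟩
    rintro rfl
    have : dist a a = ρ := ha
    rw [dist_self] at this
    exact hρ.ne this
  obtain ⟨A, hAC, a, b, hA, hpA, hpa, hpb⟩ :=
    level_exists_interior_arc hu hext hCn hC hCf hCL hδ hδC hpC hne
  obtain ⟨A₁, A₂, hA₁, hA₂, hAU, hAI⟩ := hA.split hpA hpa hpb
  obtain ⟨R, hR, hRm⟩ : ∃ R > 0, R < min (dist a p) (dist b p) :=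
    exists_between (lt_min (dist_pos.2 hpa.symm) (dist_pos.2 hpb.symm))
  obtain ⟨w₁, hw₁, B₁, hBA₁, hB₁, hBD₁, hBS₁⟩ :=
    hA₁.symm.exists_subarc_to_sphere hR (hRm.trans_le (min_le_left _ _))
  obtain ⟨w₂, hw₂, B₂, hBA₂, hB₂, hBD₂, hBS₂⟩ :=
    hA₂.exists_subarc_to_sphere hR (hRm.trans_le (min_le_right _ _))
  have hB : IsArc (B₁ ∪ B₂) w₁ w₂ := hB₁.symm.union hB₂
    ((inter_subset_inter hBA₁ hBA₂).trans hAI.subset)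
  have hBC : B₁ ∪ B₂ ⊆ C := (union_subset_union hBA₁ hBA₂).trans (hAU.subset.trans hAC)
  have hpB : p ∈ B₁ ∪ B₂ := Or.inl hB₁.left_mem
  have hpw : ∀ w ∈ sphere p R, p ≠ w := by
    rintro _ hw rfl
    have : dist p p = R := hw
    rw [dist_self] at this
    exact hR.ne this
  obtain ⟨η, hη, hηB⟩ := hCn.arc_isOpen hC hCf hB hBC hpB (hpw _ hw₁) (hpw _ hw₂)
  obtain ⟨U, hU, hpU, -, hφ⟩ := exists_local_chart (J := L) (δ := min δ η) hR hB
    (union_subset hBD₁ hBD₂) hw₁ hw₂ (by rw [union_inter_distrib_right, hBS₁, hBS₂]; rfl) hpB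
    (hpw _ hw₁) (hpw _ hw₂) (lt_min hδ hη) (by
      apply Subset.antisymm
      · rintro z ⟨hz, hzb⟩
        exact ⟨hηB ⟨hδC ⟨hz, ball_subset_ball (min_le_left _ _) hzb⟩,
          ball_subset_ball (min_le_right _ _) hzb⟩, hzb⟩
      · exact inter_subset_inter_left _ (hBC.trans hCL))
  exact ⟨U, hU, hpU, hφ⟩

end

section

open Filter Topology

theorem countable_extremal_values {α β : Type*} [TopologicalSpace α] [SecondCountableTopology α]
    (v : α → β) (rel : β → β → Prop) (hrel : ∀ a b, rel a b → rel b a → a = b) :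
    {t | ∃ x, v x = t ∧ ∃ O ∈ 𝓝 x, ∀ q ∈ O, rel (v q) t}.Countable := by
  have h1 : {t | ∃ x, v x = t ∧ ∃ O ∈ 𝓝 x, ∀ q ∈ O, rel (v q) t} ⊆
      ⋃ B ∈ TopologicalSpace.countableBasis α, {t | ∃ x ∈ B, v x = t ∧ ∀ q ∈ B, rel (v q) t} := by
    rintro t ⟨x, hx, O, hO, h⟩
    obtain ⟨B, hB, hxB, hBO⟩ :=
      (TopologicalSpace.isBasis_countableBasis α).mem_nhds_iff.1 hO
    exact mem_biUnion hB ⟨x, hxB, hx, fun q hq => h q (hBO hq)⟩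
  refine ((TopologicalSpace.countable_countableBasis α).biUnion fun B _ => ?_).mono h1
  refine Set.Subsingleton.countable ?_
  rintro _ ⟨x, hx, rfl, hx'⟩ _ ⟨y, hy, rfl, hy'⟩
  exact hrel _ _ (hy' x hx) (hx' y hy)

theorem nice_level {Ω : Set ℂ} {v : ℂ → ℝ} {t : ℝ} (hΩ : IsOpen Ω) (hv : ContinuousOn v Ω)
    (h : FinCross Ω {z ∈ Ω | v z = t}) : Nice Ω {z ∈ Ω | v z = t} where
  isOpen := hΩ
  sub := fun z hz => hz.1
  cpt p r hp := by
    have h1 : {z ∈ Ω | v z = t} ∩ closedBall p r = closedBall p r ∩ v ⁻¹' {t} := by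
      ext z
      exact ⟨fun hz => ⟨hz.2, hz.1.2⟩, fun hz => ⟨⟨hp hz.1, hz.2⟩, hz.1⟩⟩
    rw [h1]
    exact (isCompact_closedBall p r).of_isClosed_subset
      ((hv.mono hp).preimage_isClosed_of_isClosed isClosed_closedBall isClosed_singleton)
      inter_subset_left
  fin := h

variable {X Y : Type*} [TopologicalSpace X] [TopologicalSpace Y]

theorem IsJordanCurve.of_image (e : X ≃ₜ Y) {S : Set X} (h : IsJordanCurve (e '' S)) :
    IsJordanCurve S := h.map fun f => f.trans (e.image S).symm

theorem HomeoToInterval.of_image (e : X ≃ₜ Y) {S : Set X} (h : HomeoToInterval (e '' S)) :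
    HomeoToInterval S := by
  obtain ⟨I, h1, h2, h3⟩ := h
  exact ⟨I, h1, h2, h3.map fun f => f.trans (e.image S).symm⟩

theorem IsEmbedded1Submanifold.of_image (e : X ≃ₜ Y) {J : Set X}
    (h : IsEmbedded1Submanifold (e '' J)) : IsEmbedded1Submanifold J := by
  intro x hx
  obtain ⟨U, hU, hxU, φ, hφ⟩ := h (e x) (mem_image_of_mem e hx)
  let ψ : ↥(e ⁻¹' U) ≃ₜ ↥U := e.subtype fun _ => Iff.rfl
  refine ⟨e ⁻¹' U, hU.preimage e.continuous, hxU, ψ.trans φ, ?_⟩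
  rw [← hφ]
  ext p
  constructor
  · rintro ⟨y, hy, hp⟩
    exact ⟨ψ y, mem_image_of_mem e hy, hp⟩
  · rintro ⟨y, ⟨z, hz, hzy⟩, hp⟩
    have hzU : e z ∈ U := hzy ▸ y.2
    refine ⟨⟨z, hzU⟩, hz, ?_⟩
    rw [← hp]
    exact congrArg φ (Subtype.ext hzy)

theorem LebMonotoneOn.image (e : X ≃ₜ Y) {Ω : Set X} {u : X → ℝ} (h : LebMonotoneOn Ω u) :
    LebMonotoneOn (e '' Ω) (u ∘ e.symm) := by
  intro U hU hUn hUc hUΩ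
  have hcl : closure (e ⁻¹' U) = e ⁻¹' closure U := (e.preimage_closure U).symm
  have hfr : frontier (e ⁻¹' U) = e ⁻¹' frontier U := (e.preimage_frontier U).symm
  obtain ⟨⟨x, hx, hx'⟩, y, hy, hy'⟩ := h (e ⁻¹' U) (hU.preimage e.continuous)
    (hUn.preimage e.surjective) (by rw [hcl]; exact e.isCompact_preimage.2 hUc) (by
      rw [hcl]
      intro z hz
      obtain ⟨w, hw, hwz⟩ := hUΩ hz
      exact e.injective hwz ▸ hw)
  rw [hfr] at hx hy
  rw [hcl] at hx' hy'
  refine ⟨⟨e x, hx, fun z hz => ?_⟩, e y, hy, fun z hz => ?_⟩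
  · simpa using hx' (e.symm z) (by simpa using hz)
  · simpa using hy' (e.symm z) (by simpa using hz)

theorem image_level (e : X ≃ₜ Y) (Ω : Set X) (u : X → ℝ) (t : ℝ) :
    e '' {x ∈ Ω | u x = t} = {z ∈ e '' Ω | (u ∘ e.symm) z = t} := by
  ext z
  constructor
  · rintro ⟨x, hx, rfl⟩
    exact ⟨mem_image_of_mem e hx.1, by simpa using hx.2⟩
  · rintro ⟨⟨x, hx, rfl⟩, h⟩
    exact ⟨x, ⟨hx, by simpa using h⟩, rfl⟩

end

end PlaneTop

/-- level sets of continuous functions on open subsets of metric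
spaces homeomorphic to `ℝ²`, under the assumption that a.e. level set has locally
finite Hausdorff 1-measure. -/
theorem ae_level_set_structure_metric {X : Type*} [MetricSpace X]
    [MeasurableSpace X] [BorelSpace X]
    (hX : Nonempty (X ≃ₜ ℝ × ℝ))
    (Ω : Set X) (hΩ : IsOpen Ω)
    (u : X → ℝ) (hu : ContinuousOn u Ω)
    (hlen : ∀ᵐ t : ℝ, ∀ K : Set X, IsCompact K → K ⊆ Ω →
      (MeasureTheory.Measure.hausdorffMeasure 1 : Measure X) ({x ∈ Ω | u x = t} ∩ K) < ⊤) :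
    (∀ᵐ t : ℝ, ∀ x ∈ Ω, u x = t →
      (∃ px, connectedComponentIn {y ∈ Ω | u y = t} x = {px}) ∨
      IsJordanCurve (connectedComponentIn {y ∈ Ω | u y = t} x) ∨
      HomeoToInterval (connectedComponentIn {y ∈ Ω | u y = t} x)) ∧
    (LebMonotoneOn Ω u →
      ∀ᵐ t : ℝ, IsEmbedded1Submanifold {x ∈ Ω | u x = t}) := by
  obtain ⟨e₀⟩ := hX
  let e : X ≃ₜ ℂ := e₀.trans Complex.equivRealProdCLM.symm.toHomeomorph
  let v : ℂ → ℝ := u ∘ e.symm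
  have hΩ' : IsOpen (e '' Ω) := e.isOpenMap _ hΩ
  have hv : ContinuousOn v (e '' Ω) := hu.comp e.symm.continuous.continuousOn (by
    rintro _ ⟨x, hx, rfl⟩
    simpa using hx)
  have hnice : ∀ᵐ t : ℝ, PlaneTop.Nice (e '' Ω) {z ∈ e '' Ω | v z = t} := by
    filter_upwards [hlen] with t ht
    refine PlaneTop.nice_level hΩ' hv ?_
    rw [← PlaneTop.image_level]
    exact PlaneTop.finCross_of_hausdorffMeasure e ht
  have hfew : ∀ᵐ t : ℝ, PlaneTop.FewHits (e '' Ω) {z ∈ e '' Ω | v z = t} := by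
    filter_upwards [(PlaneTop.countable_not_fewHits (e '' Ω) v).ae_notMem volume] with t ht
    exact not_not.1 ht
  refine ⟨?_, fun hm => ?_⟩
  · filter_upwards [hnice, hfew] with t hN hf x hx hxt
    have hxL : x ∈ {y ∈ Ω | u y = t} := ⟨hx, hxt⟩
    have himg := (e.image_connectedComponentIn hxL).trans
      (congrArg (connectedComponentIn · (e x)) (PlaneTop.image_level e Ω u t))
    have hexL : e x ∈ {z ∈ e '' Ω | v z = t} :=
      PlaneTop.image_level e Ω u t ▸ mem_image_of_mem e hxL
    have hc := (hN.component (e x)).classification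
      (isConnected_connectedComponentIn_iff.2 hexL)
      (hf.mono subset_rfl (connectedComponentIn_subset _ _))
    rw [← himg] at hc
    refine hc.imp ?_ (Or.imp (PlaneTop.IsJordanCurve.of_image e)
      (PlaneTop.HomeoToInterval.of_image e))
    rintro ⟨p, hp⟩
    refine ⟨e.symm p, ?_⟩
    rw [← e.injective.image_injective.eq_iff, hp, image_singleton, e.apply_symm_apply]
  · filter_upwards [hnice, hfew,
      (PlaneTop.countable_extremal_values v (· ≤ ·) fun a b => le_antisymm).ae_notMem volume,
      (PlaneTop.countable_extremal_values v (· ≥ ·)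
        fun a b h h' => le_antisymm h' h).ae_notMem volume] with t hN hf hmax hmin
    apply PlaneTop.IsEmbedded1Submanifold.of_image e
    rw [PlaneTop.image_level]
    refine PlaneTop.level_isEmbedded1Submanifold hv (PlaneTop.LebMonotoneOn.image e hm) hN hf
      fun x _ hxt ε hε => ⟨?_, ?_⟩
    · by_contra! h
      exact hmax ⟨x, hxt, _, ball_mem_nhds x hε, h⟩
    · by_contra! h
      exact hmin ⟨x, hxt, _, ball_mem_nhds x hε, h⟩
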